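/- Let (P_α)_{α ∈ I} be a family of fields, K = Π_{α ∈ I} P_α, n ≥ 1, and let G be a subgroup of GL_n(K) such that every two elements of G generate a solvable subgroup. Then G possesses a locally nilpotent normal subgroup N such that the quotient G/N is solvable. -/

import Mathlib

/-- Engel words with the convention of the paper: the commutator is
`[x, y] = x⁻¹ * y⁻¹ * x * y`, `engelWord 0 x y = x` and
`engelWord (n+1) x y = [engelWord n x y, y]`; thus for `n ≥ 1`,
`engelWord n x y` is the Engel word `e_n(x, y)`. -/
def engelWord {G : Type*} [Group G] : ℕ → G → G → G
  | 0, x, _ => x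
  | n + 1, x, y => (engelWord n x y)⁻¹ * y⁻¹ * engelWord n x y * y

/-- Iterated Engel words: `epsEngel [(n₁,a₁),…,(n_k,a_k)] y` is
`ε_{(n₁,…,n_k)}(a₁,…,a_k; y)`, defined by `ε_{(n₁)}(a₁;y) = e_{n₁}(a₁,y)` and
`ε_{(n₁,…,n_k)}(a₁,…,a_k;y) = e_{n_k}(a_k, ε_{(n₁,…,n_{k-1})}(a₁,…,a_{k-1};y))`. -/
def epsEngel {G : Type*} [Group G] (l : List (ℕ × G)) (y : G) : G :=
  l.foldl (fun z p => engelWord p.1 p.2 z) y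

/-- `g` is a nil-element if for every `a` there is `n ≥ 1` with `e_n(a, g) = 1`. -/
def IsNilElement {G : Type*} [Group G] (g : G) : Prop :=
  ∀ a : G, ∃ n, 1 ≤ n ∧ engelWord n a g = 1

/-- A group is locally nilpotent if every finitely generated subgroup is nilpotent. -/
def LocallyNilpotent (G : Type*) [Group G] : Prop :=
  ∀ H : Subgroup G, H.FG → Group.IsNilpotent H

/-- `g` is quasi-nil of order ≤ `k`: there are functions `ν i : G^(i+1) → ℕ` (with values ≥ 1,
`ν i` depending only on `a₁,…,a_{i+1}` and `g`) such that for all `a : Fin k → G`,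
`ε_{(ν₁(a₁),…,ν_k(a₁,…,a_k))}(a₁,…,a_k; g) = 1`. -/
def IsQuasiNilOfOrder {G : Type*} [Group G] (k : ℕ) (g : G) : Prop :=
  ∃ ν : ∀ i : Fin k, (Fin ((i : ℕ) + 1) → G) → ℕ,
    (∀ i f, 1 ≤ ν i f) ∧
    ∀ a : Fin k → G,
      epsEngel (List.ofFn fun i : Fin k =>
        (ν i fun j => a (Fin.castLE i.isLt j), a i)) g = 1

/-- `g` is quasi-nil if it is quasi-nil of order ≤ `k` for some `k ≥ 1`. -/
def IsQuasiNil {G : Type*} [Group G] (g : G) : Prop :=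
  ∃ k, 1 ≤ k ∧ IsQuasiNilOfOrder k g

/-- `g` maps to a nil-element of the quotient `G ⧸ N` (for `N` normal). -/
def IsNilElementQuot {G : Type*} [Group G] (N : Subgroup G) (hN : N.Normal) (g : G) : Prop :=
  @IsNilElement (G ⧸ N) (@QuotientGroup.Quotient.group G _ N hN) (QuotientGroup.mk g)

open scoped commutatorElement

section DerivedSeries

variable {G : Type*} [Group G]

theorem map_subtype_derivedSeries_derivedSeries (m j : ℕ) :
    (derivedSeries (derivedSeries G m) j).map (derivedSeries G m).subtype
      = derivedSeries G (m + j) := by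
  induction j with
  | zero => simp [derivedSeries_zero, ← MonoidHom.range_eq_map]
  | succ j ih => rw [derivedSeries_succ, Subgroup.map_commutator, ih, ← add_assoc,
      derivedSeries_succ]

theorem derivedSeries_lt_of_ne_bot [hG : Group.IsSolvable G] {j : ℕ}
    (h : derivedSeries G j ≠ ⊥) : derivedSeries G (j + 1) < derivedSeries G j := by
  rw [derivedSeries_succ]
  exact Group.IsSolvable.commutator_lt_of_ne_bot h

theorem derivedSeries_natCard_eq_bot [Finite G] [Group.IsSolvable G] :
    derivedSeries G (Nat.card G) = ⊥ := by
  have key : ∀ j, derivedSeries G j = ⊥ ∨ Nat.card (derivedSeries G j) + j ≤ Nat.card G := by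
    intro j
    induction j with
    | zero => right; simp [derivedSeries_zero]
    | succ j ih =>
      by_cases hj : derivedSeries G j = ⊥
      · left
        exact le_bot_iff.mp (hj ▸ derivedSeries_antitone G j.le_succ)
      · right
        have h1 := ih.resolve_left hj
        have h2 := derivedSeries_lt_of_ne_bot hj
        have h3 : Nat.card (derivedSeries G (j + 1)) < Nat.card (derivedSeries G j) :=
          Set.Finite.card_lt_card (Set.toFinite _) (SetLike.coe_ssubset_coe.mpr h2)
        omega
  rcases key (Nat.card G) with h | h
  · exact h
  · have : 0 < Nat.card (derivedSeries G (Nat.card G)) := Nat.card_pos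
    omega

end DerivedSeries

section Weights

variable {k G W : Type*} [Field k] [Group G] [AddCommGroup W] [Module k W]

/-- `w` is a simultaneous eigenvector of the subgroup `B`, with eigenvalues given by `χ`. -/
def IsWeightVector (σ : Representation k G W) (B : Subgroup G) (χ : B → k) (w : W) : Prop :=
  ∀ b : B, σ b w = χ b • w

theorem IsWeightVector.eq_zero_of_sum_eq_zero {σ : Representation k G W} {B : Subgroup G}
    {ι : Type*} (f : ι → B → k) (s : Finset ι) (hs : Set.InjOn f s) (w : ι → W)
    (hw : ∀ i ∈ s, IsWeightVector σ B (f i) (w i)) (h0 : ∑ i ∈ s, w i = 0) :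
    ∀ i ∈ s, w i = 0 := by
  classical
  induction s using Finset.induction_on generalizing w with
  | empty => simp
  | insert a s ha ih =>
    have hs' : Set.InjOn f s := hs.mono (by simp)
    have main : ∀ i ∈ s, w i = 0 := by
      intro i hi
      have hne : f i ≠ f a := fun h => ha (by
        have := hs (by simp [hi]) (by simp) h
        exact this ▸ hi)
      obtain ⟨b, hb⟩ := Function.ne_iff.mp hne
      have := ih hs' (fun j => (f j b - f a b) • w j) (fun j hj b' => by
        rw [map_smul, hw j (by simp [hj]) b', smul_comm]) (by
        have h1 := congrArg (fun v => σ b v - f a b • v) h0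
        simp only [map_sum, map_zero, smul_zero, sub_zero] at h1
        rw [Finset.smul_sum, ← Finset.sum_sub_distrib, Finset.sum_insert ha,
          hw a (by simp) b, sub_self, zero_add] at h1
        rw [← h1]
        refine Finset.sum_congr rfl fun j hj => ?_
        rw [hw j (by simp [hj]) b, sub_smul]) i hi
      exact (smul_eq_zero.mp this).resolve_left (sub_ne_zero.mpr hb)
    intro i hi
    rcases Finset.mem_insert.mp hi with rfl | hi
    · rw [Finset.sum_insert ha, Finset.sum_eq_zero main, add_zero] at h0
      exact h0
    · exact main i hi

/-- The set of weights of `B` on `W`. -/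
def weights (σ : Representation k G W) (B : Subgroup G) : Set (B → k) :=
  {χ | ∃ w, w ≠ 0 ∧ IsWeightVector σ B χ w}

theorem linearIndependent_weightVectors (σ : Representation k G W) (B : Subgroup G) :
    LinearIndependent k (fun χ : weights σ B => χ.2.choose) := by
  rw [linearIndependent_iff']
  intro s g h0 i hi
  have := IsWeightVector.eq_zero_of_sum_eq_zero (σ := σ) (fun χ : weights σ B => χ.1) s
    Subtype.val_injective.injOn (fun χ => g χ • χ.2.choose)
    (fun χ _ b => by rw [map_smul, χ.2.choose_spec.2 b, smul_comm]) h0 i hi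
  exact (smul_eq_zero.mp this).resolve_right i.2.choose_spec.1

theorem finite_weights [FiniteDimensional k W] (σ : Representation k G W) (B : Subgroup G) :
    Finite (weights σ B) :=
  (linearIndependent_weightVectors σ B).finite

theorem natCard_weights_le [FiniteDimensional k W] (σ : Representation k G W) (B : Subgroup G) :
    Nat.card (weights σ B) ≤ Module.finrank k W := by
  have := finite_weights σ B
  have := Fintype.ofFinite (weights σ B)
  rw [Nat.card_eq_fintype_card]
  exact (linearIndependent_weightVectors σ B).fintype_card_le_finrank

variable {σ : Representation k G W} {B : Subgroup G} [B.Normal]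

theorem IsWeightVector.map {χ : B → k} {w : W} (h : IsWeightVector σ B χ w) (g : G) :
    IsWeightVector σ B (fun b => χ (MulAut.conjNormal g⁻¹ b)) (σ g w) := by
  intro b
  have := congrArg (σ g) (h (MulAut.conjNormal g⁻¹ b))
  rw [map_smul, MulAut.conjNormal_apply, ← Module.End.mul_apply, ← map_mul] at this
  rw [← this, ← Module.End.mul_apply, ← map_mul]
  congr 2
  group

theorem conj_mem_weights {χ : B → k} (h : χ ∈ weights σ B) (g : G) :
    (fun b => χ (MulAut.conjNormal g⁻¹ b)) ∈ weights σ B := by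
  obtain ⟨w, hw, h⟩ := h
  refine ⟨σ g w, fun h0 => hw ?_, h.map g⟩
  have := congrArg (σ g⁻¹) h0
  rwa [← Module.End.mul_apply, ← map_mul, inv_mul_cancel, map_one, map_zero] at this

/-- The permutation action on the set of weights of a normal subgroup. -/
def weightsPerm (σ : Representation k G W) (B : Subgroup G) [B.Normal] :
    G →* Equiv.Perm (weights σ B) where
  toFun g :=
    { toFun := fun χ => ⟨_, conj_mem_weights χ.2 g⟩
      invFun := fun χ => ⟨_, conj_mem_weights χ.2 g⁻¹⟩
      left_inv := fun χ => by ext b; simp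
      right_inv := fun χ => by ext b; simp }
  map_one' := by ext χ b; simp
  map_mul' g h := by ext χ b; simp

theorem weight_conj_eq_of_mem_derivedSeries [FiniteDimensional k W] [Group.IsSolvable G]
    {χ : B → k} (hχ : χ ∈ weights σ B) {g : G}
    (hg : g ∈ derivedSeries G (Module.finrank k W).factorial) (b : B) :
    χ (MulAut.conjNormal g⁻¹ b) = χ b := by
  have := finite_weights σ B
  set f := weightsPerm σ B
  have hcard : Nat.card f.range ≤ (Module.finrank k W).factorial := by
    calc Nat.card f.range ≤ Nat.card (Equiv.Perm (weights σ B)) :=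
          Nat.card_le_card_of_injective _ Subtype.val_injective
      _ = (Nat.card (weights σ B)).factorial := Nat.card_perm
      _ ≤ _ := Nat.factorial_le (natCard_weights_le σ B)
  have : Group.IsSolvable f.range := Group.isSolvable_of_surjective f.rangeRestrict_surjective
  have h1 : derivedSeries f.range (Module.finrank k W).factorial = ⊥ :=
    le_bot_iff.mp ((derivedSeries_antitone _ hcard).trans derivedSeries_natCard_eq_bot.le)
  have h2 : f.rangeRestrict g = 1 := by
    have := map_derivedSeries_le_derivedSeries f.rangeRestrict _
      (Subgroup.mem_map_of_mem f.rangeRestrict hg)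
    rwa [h1, Subgroup.mem_bot] at this
  have h3 : f g = 1 := congrArg Subtype.val h2
  have h4 := congrArg Subtype.val (Equiv.congr_fun h3 ⟨χ, hχ⟩)
  exact congrFun h4 b

end Weights

section QuasiUnipotent

variable {k G W : Type*} [Field k] [Group G] [AddCommGroup W] [Module k W]
  {σ : Representation k G W} {B : Subgroup G} [B.Normal]

theorem weight_conj_eq_of_sub_one_pow_eq_zero (p : ℕ) [hp : Fact p.Prime] [CharP k p]
    {χ : B → k} (hχ : χ ∈ weights σ B) {x : G} {r : ℕ} (hr : r < p)
    (hx : (σ x - 1) ^ r = 0) (b : B) :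
    χ (MulAut.conjNormal x⁻¹ b) = χ b := by
  obtain ⟨w, hw0, hw⟩ := hχ
  have : Nontrivial W := ⟨w, 0, hw0⟩
  have : CharP (Module.End k W) p :=
    charP_of_injective_algebraMap (algebraMap k (Module.End k W)).injective p
  have hxp : σ (x ^ p) = 1 := by
    have h : (σ x - 1) ^ p = 0 := pow_eq_zero_of_le hr.le hx
    rwa [sub_pow_char_of_commute _ (Commute.one_right _), one_pow, sub_eq_zero, ← map_pow] at h
  set T : (B → k) → (B → k) := fun χ b => χ (MulAut.conjNormal x⁻¹ b) with hT
  have hiter : ∀ i, IsWeightVector σ B (T^[i] χ) (σ (x ^ i) w) := by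
    intro i
    induction i with
    | zero => simpa using hw
    | succ i ih =>
      rw [Function.iterate_succ_apply', pow_succ', map_mul]
      exact ih.map x
  by_contra hne
  have hper : Function.IsPeriodicPt T p χ := by
    have h1 := hiter p
    rw [hxp] at h1
    refine funext fun b => ?_
    have := (h1 b).symm.trans (hw b)
    exact smul_left_injective k hw0 this
  have hmin : Function.minimalPeriod T χ = p := by
    refine ((Nat.dvd_prime hp.out).mp hper.minimalPeriod_dvd).resolve_left fun h => hne ?_
    exact congrFun (Function.minimalPeriod_eq_one_iff_isFixedPt.mp h) b
  have hinj : Set.InjOn (fun i => T^[i] χ) (Finset.range (r + 1)) := by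
    refine (Function.iterate_injOn_Iio_minimalPeriod (f := T) (x := χ)).mono fun i hi => ?_
    simp only [Finset.coe_range, Set.mem_Iio] at hi ⊢
    omega
  have hsum : ∑ i ∈ Finset.range (r + 1),
      ((-1 : k) ^ (r - i) * (r.choose i : k)) • σ (x ^ i) w = 0 := by
    rw [sub_eq_add_neg, Commute.add_pow (Commute.neg_right (Commute.one_right _))] at hx
    have := congrArg (fun f : Module.End k W => f w) hx
    simp only [LinearMap.sum_apply, LinearMap.zero_apply] at this
    rw [← this]
    refine Finset.sum_congr rfl fun i _ => ?_
    rw [map_pow, mul_assoc, Module.End.mul_apply, ← map_smul]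
    congr 1
    rcases Nat.even_or_odd (r - i) with h | h
    · rw [h.neg_one_pow, h.neg_one_pow, one_mul, one_mul]
      simp [← Nat.cast_smul_eq_nsmul k]
    · rw [h.neg_one_pow, h.neg_one_pow]
      simp [← Nat.cast_smul_eq_nsmul k]
  have := IsWeightVector.eq_zero_of_sum_eq_zero (σ := σ) _ _ hinj _
    (fun i _ b' => by rw [map_smul, hiter i b', smul_comm]) hsum r (by simp)
  simp only [tsub_self, pow_zero, Nat.choose_self, Nat.cast_one, mul_one, one_smul] at this
  have h := congrArg (σ (x ^ r)⁻¹) this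
  rw [← Module.End.mul_apply, ← map_mul, inv_mul_cancel, map_one, map_zero] at h
  exact hw0 h

end QuasiUnipotent

section Nonscalar

variable {k G V : Type*} [Field k] [Group G] [AddCommGroup V] [Module k V]

/-- The linear map `f` is a scalar. -/
def IsScalarEnd (f : Module.End k V) : Prop := ∃ c : k, f = c • 1

theorem exists_normal_not_isScalarEnd [hG : Group.IsSolvable G] (ρ : Representation k G V)
    (h : ∃ g, ¬ IsScalarEnd (ρ g)) :
    ∃ B : Subgroup G, B.Normal ∧ (∃ b ∈ B, ¬ IsScalarEnd (ρ b)) ∧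
      ((∀ b ∈ B, ∀ b' ∈ B, Commute (ρ b) (ρ b')) ∨
        (∀ b ∈ B, ∀ b' ∈ B, IsScalarEnd (ρ ⁅b, b'⁆))) := by
  classical
  obtain ⟨N, hN⟩ := hG.solvable
  have hex : ∃ j, ∀ b ∈ derivedSeries G j, IsScalarEnd (ρ b) :=
    ⟨N, fun b hb => ⟨1, by rw [hN, Subgroup.mem_bot] at hb; simp [hb]⟩⟩
  set j := Nat.find hex with hj
  have hspec := Nat.find_spec hex
  rw [← hj] at hspec
  have hj0 : j ≠ 0 := by
    intro h0
    obtain ⟨g, hg⟩ := h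
    refine hg (hspec g ?_)
    rw [h0]; trivial
  obtain ⟨i, hi⟩ := Nat.exists_eq_succ_of_ne_zero hj0
  have hmin := Nat.find_min hex (m := i) (by omega)
  push Not at hmin
  refine ⟨derivedSeries G i, derivedSeries_normal G i, hmin, Or.inr fun b hb b' hb' => ?_⟩
  refine hspec _ ?_
  rw [hi, Nat.succ_eq_add_one, derivedSeries_succ]
  exact Subgroup.commutator_mem_commutator hb hb'

variable [IsAlgClosed k] [FiniteDimensional k V]

theorem exists_invariant_of_commute {T : Module.End k V} (hT : ¬ IsScalarEnd T) :
    ∃ U : Submodule k V, U ≠ ⊥ ∧ U ≠ ⊤ ∧ ∀ f : Module.End k V, Commute T f → U ≤ U.comap f := by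
  have : Nontrivial V := by
    by_contra h
    rw [not_nontrivial_iff_subsingleton] at h
    exact hT ⟨0, Subsingleton.elim _ _⟩
  obtain ⟨c, hc⟩ := Module.End.exists_eigenvalue T
  refine ⟨Module.End.eigenspace T c, hc, fun htop => hT ⟨c, ?_⟩, fun f hf v hv => ?_⟩
  · ext v
    have : v ∈ Module.End.eigenspace T c := htop ▸ Submodule.mem_top
    simpa using Module.End.mem_eigenspace_iff.mp this
  · rw [Module.End.mem_eigenspace_iff] at hv
    rw [Submodule.mem_comap, Module.End.mem_eigenspace_iff, ← Module.End.mul_apply, hf.eq,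
      Module.End.mul_apply, hv, map_smul]

theorem weights_nonempty_of_commute [Nontrivial V] (ρ : Representation k G V) (B : Subgroup G)
    (hB : ∀ b ∈ B, ∀ b' ∈ B, Commute (ρ b) (ρ b')) : (weights ρ B).Nonempty := by
  obtain ⟨U, ⟨hU0, hU⟩, hmin⟩ := WellFounded.has_min (wellFounded_lt (α := Submodule k V))
    {U | U ≠ ⊥ ∧ ∀ b ∈ B, U ≤ U.comap (ρ b)} ⟨⊤, top_ne_bot, fun b _ => by simp⟩
  have : Nontrivial U := Submodule.nontrivial_iff_ne_bot.mpr hU0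
  have key : ∀ b : B, ∃ c : k, ∀ u ∈ U, ρ b u = c • u := by
    intro b
    obtain ⟨c, hc⟩ := Module.End.exists_eigenvalue ((ρ b).restrict (hU b b.2))
    obtain ⟨⟨v, hvU⟩, hv⟩ := hc.exists_hasEigenvector
    have hv1 : ρ b v = c • v := congrArg Subtype.val hv.apply_eq_smul
    have hv0 : v ≠ 0 := fun h => hv.2 (Subtype.ext h)
    set U' := U ⊓ Module.End.eigenspace (ρ b) c
    have hU' : ¬ U' < U := hmin U' ⟨fun h => hv0 (by
      have : v ∈ U' := ⟨hvU, Module.End.mem_eigenspace_iff.mpr hv1⟩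
      rwa [h, Submodule.mem_bot] at this), fun b' hb' u hu => ⟨hU b' hb' hu.1, by
        have hu2 := Module.End.mem_eigenspace_iff.mp hu.2
        refine Module.End.mem_eigenspace_iff.mpr ?_
        rw [← Module.End.mul_apply, (hB b b.2 b' hb').eq, Module.End.mul_apply, hu2, map_smul]⟩⟩
    have : U' = U := by
      by_contra hne
      exact hU' (lt_of_le_of_ne inf_le_left hne)
    refine ⟨c, fun u hu => ?_⟩
    rw [← this] at hu
    exact Module.End.mem_eigenspace_iff.mp hu.2
  choose χ hχ using key
  obtain ⟨u, hu⟩ := exists_ne (0 : U)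
  exact ⟨χ, u, fun h => hu (Subtype.ext h), fun b => hχ b u u.2⟩

/-- If the elements of `S` fix all weights of normal subgroups on `V` and `End V`, then either
`S` has a proper invariant subspace or it centralizes a nonscalar element modulo scalars. -/
theorem exists_invariant_or_semicommute [Group.IsSolvable G] (ρ : Representation k G V)
    (h : ∃ g, ¬ IsScalarEnd (ρ g)) (S : Set G)
    (h₁ : ∀ (B : Subgroup G) [B.Normal], ∀ χ ∈ weights ρ B, ∀ s ∈ S, ∀ b,
      χ (MulAut.conjNormal s⁻¹ b) = χ b)
    (h₂ : ∀ (B : Subgroup G) [B.Normal], ∀ χ ∈ weights (ρ.linHom ρ) B, ∀ s ∈ S, ∀ b,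
      χ (MulAut.conjNormal s⁻¹ b) = χ b) :
    (∃ U : Submodule k V, U ≠ ⊥ ∧ U ≠ ⊤ ∧ ∀ s ∈ S, U ≤ U.comap (ρ s)) ∨
      ∃ b, ¬ IsScalarEnd (ρ b) ∧ ∀ s ∈ S, ∃ c : k, ρ (s * b * s⁻¹) = c • ρ b := by
  have hV : Nontrivial V := by
    by_contra hV
    rw [not_nontrivial_iff_subsingleton] at hV
    obtain ⟨g, hg⟩ := h
    exact hg ⟨0, Subsingleton.elim _ _⟩
  have commCase : ∀ B : Subgroup G, B.Normal → (∃ b ∈ B, ¬ IsScalarEnd (ρ b)) →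
      (∀ b ∈ B, ∀ b' ∈ B, Commute (ρ b) (ρ b')) →
      ∃ U : Submodule k V, U ≠ ⊥ ∧ U ≠ ⊤ ∧ ∀ s ∈ S, U ≤ U.comap (ρ s) := by
    intro B hBn ⟨b, hb, hbs⟩ hcomm
    obtain ⟨χ, hχ⟩ := weights_nonempty_of_commute ρ B hcomm
    refine ⟨⨅ b : B, Module.End.eigenspace (ρ b) (χ b), ?_, ?_, ?_⟩
    · obtain ⟨w, hw0, hw⟩ := hχ
      intro hbot
      refine hw0 ?_
      rw [← Submodule.mem_bot k, ← hbot, Submodule.mem_iInf]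
      exact fun b => Module.End.mem_eigenspace_iff.mpr (hw b)
    · intro htop
      refine hbs ⟨χ ⟨b, hb⟩, ?_⟩
      ext v
      have hv : v ∈ ⨅ b : B, Module.End.eigenspace (ρ b) (χ b) := htop ▸ Submodule.mem_top
      rw [Submodule.mem_iInf] at hv
      simpa using Module.End.mem_eigenspace_iff.mp (hv ⟨b, hb⟩)
    · intro s hs v hv
      rw [Submodule.mem_iInf] at hv
      rw [Submodule.mem_comap, Submodule.mem_iInf]
      intro b
      have := IsWeightVector.map (σ := ρ) (B := B) (χ := χ) (w := v)
        (fun b => Module.End.mem_eigenspace_iff.mp (hv b)) s b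
      exact Module.End.mem_eigenspace_iff.mpr (this.trans (congrArg (· • ρ s v) (h₁ B χ hχ s hs b)))
  obtain ⟨B, hBn, hbs, hB⟩ := exists_normal_not_isScalarEnd ρ h
  rcases hB with hB | hB
  · exact Or.inl (commCase B hBn hbs hB)
  by_cases hZ : ∃ b ∈ B, (∀ b' ∈ B, Commute (ρ b) (ρ b')) ∧ ¬ IsScalarEnd (ρ b)
  · left
    let Z : Subgroup G :=
      { carrier := {b | b ∈ B ∧ ∀ b' ∈ B, Commute (ρ b) (ρ b')}
        mul_mem' := fun {a b} ha hb => ⟨B.mul_mem ha.1 hb.1, fun b' hb' => by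
          rw [map_mul]; exact (ha.2 b' hb').mul_left (hb.2 b' hb')⟩
        one_mem' := ⟨B.one_mem, fun b' _ => by rw [map_one]; exact Commute.one_left _⟩
        inv_mem' := fun {a} ha => ⟨B.inv_mem ha.1, fun b' hb' => by
          have := ha.2 b' hb'
          have e : ρ a * ρ a⁻¹ = 1 := by rw [← map_mul, mul_inv_cancel, map_one]
          have e' : ρ a⁻¹ * ρ a = 1 := by rw [← map_mul, inv_mul_cancel, map_one]
          calc ρ a⁻¹ * ρ b' = ρ a⁻¹ * (ρ b' * ρ a) * ρ a⁻¹ := by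
                rw [mul_assoc, mul_assoc, e, mul_one]
            _ = ρ b' * ρ a⁻¹ := by rw [← this.eq, ← mul_assoc, e', one_mul]⟩ }
    refine commCase Z ⟨fun z hz g => ⟨hBn.conj_mem z hz.1 g, fun b' hb' => ?_⟩⟩ ?_ ?_
    · have := hz.2 (g⁻¹ * b' * g) (by simpa using hBn.conj_mem b' hb' g⁻¹)
      have h3 : ρ (z * (g⁻¹ * b' * g)) = ρ ((g⁻¹ * b' * g) * z) := by
        rw [map_mul ρ z, map_mul ρ _ z]; exact this.eq
      have h4 := congrArg (fun f => ρ g * f * ρ g⁻¹) h3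
      simp only [← map_mul] at h4
      rw [Commute, SemiconjBy, ← map_mul, ← map_mul]
      convert h4 using 2 <;> group
    · obtain ⟨b, hb, hb1, hb2⟩ := hZ
      exact ⟨b, ⟨hb, hb1⟩, hb2⟩
    · exact fun b hb b' hb' => hb.2 b' hb'.1
  · right
    push Not at hZ
    obtain ⟨b, hb, hbs⟩ := hbs
    refine ⟨b, hbs, fun s hs => ?_⟩
    choose! c hc using fun b' (hb' : b' ∈ B) => hB b' hb' b hb
    have hw : IsWeightVector (ρ.linHom ρ) B (fun b' => c b') (ρ b) := by
      intro b'
      have := congrArg (fun f => f * ρ b) (hc b' b'.2)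
      simp only [← map_mul] at this
      rw [smul_mul_assoc, one_mul] at this
      rw [← this]
      change ρ b' * (ρ b * ρ (b' : G)⁻¹) = _
      rw [← map_mul, ← map_mul]
      congr 1
      rw [commutatorElement_def]
      group
    have hb0 : ρ b ≠ 0 := fun h0 => hbs ⟨0, by simp [h0]⟩
    have hmem : (fun b' : B => c b') ∈ weights (ρ.linHom ρ) B := ⟨ρ b, hb0, hw⟩
    have hw' := hw.map s
    rw [show (fun b' : B => c (MulAut.conjNormal s⁻¹ b' : B)) = fun b' : B => c b' from
      funext fun b' => h₂ B _ hmem s hs b'] at hw'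
    have e1 : ∀ b' ∈ B, ρ (b' * b * b'⁻¹) = c b' • ρ b := fun b' hb' => by
      simpa [Module.End.mul_eq_comp, mul_assoc] using hw ⟨b', hb'⟩
    have e2 : ∀ b' ∈ B, ρ (b' * (s * b * s⁻¹) * b'⁻¹) = c b' • ρ (s * b * s⁻¹) :=
      fun b' hb' => by
        simpa [Module.End.mul_eq_comp, mul_assoc, LinearMap.comp_assoc] using hw' ⟨b', hb'⟩
    have hu : IsScalarEnd (ρ (b⁻¹ * (s * b * s⁻¹))) := by
      refine hZ _ (B.mul_mem (B.inv_mem hb) (hBn.conj_mem b hb s)) fun b' hb' => ?_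
      have hc0 : c b' ≠ 0 := fun h0 => by
        have h5 := e1 b' hb'
        rw [h0, zero_smul] at h5
        refine hb0 ?_
        have h6 := congrArg (fun f => ρ b'⁻¹ * f * ρ b') h5
        simp only [← map_mul, mul_zero, zero_mul] at h6
        rw [← h6]; congr 1; group
      have e3 : ρ (b' * b⁻¹ * b'⁻¹) = (c b')⁻¹ • ρ b⁻¹ := by
        have h7 : ρ (b' * b⁻¹ * b'⁻¹) * ρ (b' * b * b'⁻¹) = 1 := by
          rw [← map_mul, ← map_one ρ]; congr 1; group
        rw [e1 b' hb'] at h7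
        have h8 := congrArg (fun f => (c b')⁻¹ • (f * ρ b⁻¹)) h7
        simp only [mul_smul_comm, smul_mul_assoc, smul_smul, inv_mul_cancel₀ hc0, one_smul,
          one_mul] at h8
        rw [← h8, ← map_mul, ← map_mul]; congr 1; group
      have e4 : ρ (b' * (b⁻¹ * (s * b * s⁻¹)) * b'⁻¹) = ρ (b⁻¹ * (s * b * s⁻¹)) := by
        have : b' * (b⁻¹ * (s * b * s⁻¹)) * b'⁻¹
            = (b' * b⁻¹ * b'⁻¹) * (b' * (s * b * s⁻¹) * b'⁻¹) := by group
        rw [this, map_mul, e3, e2 b' hb', smul_mul_smul_comm, inv_mul_cancel₀ hc0, one_smul,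
          ← map_mul]
      have h9 := congrArg (fun f => f * ρ b') e4
      simp only [← map_mul] at h9
      rw [Commute, SemiconjBy, ← map_mul, ← map_mul, ← h9]
      congr 1; group
    obtain ⟨d, hd⟩ := hu
    refine ⟨d, ?_⟩
    have h10 := congrArg (fun f => ρ b * f) hd
    simp only [← map_mul, mul_smul_comm, mul_one] at h10
    rw [← h10]; congr 1; group

end Nonscalar

section Zassenhaus

variable {k G V : Type*} [Field k] [Group G] [AddCommGroup V] [Module k V]

theorem subrepresentation_quotient_commutator_trivial (ρ : Representation k G V)
    (U : Submodule k V) {H : Subgroup G} (h₁ : ∀ g ∈ H, ∀ u ∈ U, ρ g u = u)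
    (h₂ : ∀ g ∈ H, ∀ v, ρ g v - v ∈ U) {g : G} (hg : g ∈ ⁅H, H⁆) : ρ g = 1 := by
  have : ⁅H, H⁆ ≤ ρ.ker := by
    rw [Subgroup.commutator_le]
    intro a ha b hb
    rw [MonoidHom.mem_ker]
    have key : ρ (a * b) = ρ (b * a) := by
      ext v
      have e1 := h₁ a ha _ (h₂ b hb v)
      have e2 := h₁ b hb _ (h₂ a ha v)
      rw [map_sub] at e1 e2
      rw [map_mul, map_mul, Module.End.mul_apply, Module.End.mul_apply]
      have e1' : ρ a (ρ b v) = ρ a v + ρ b v - v := by rw [← sub_eq_zero] at e1 ⊢; rw [← e1]; abel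
      have e2' : ρ b (ρ a v) = ρ a v + ρ b v - v := by rw [← sub_eq_zero] at e2 ⊢; rw [← e2]; abel
      rw [e1', e2']
    rw [commutatorElement_def, mul_assoc (a * b), ← mul_inv_rev, map_mul, key, ← map_mul,
      mul_inv_cancel, map_one]
  exact this hg

/-- A bound for the derived length of a solvable linear group of degree at most `n`. -/
def zassenhausBound : ℕ → ℕ
  | 0 => 0
  | n + 1 => ((n + 1) * (n + 1)).factorial + 1 + (zassenhausBound n + 1)

variable [IsAlgClosed k]

theorem apply_eq_one_of_mem_derivedSeries_zassenhausBound (n : ℕ) :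
    ∀ {G V : Type*} [Group G] [AddCommGroup V] [Module k V] [FiniteDimensional k V]
    [Group.IsSolvable G] (ρ : Representation k G V) (_ : Module.finrank k V ≤ n) {g : G}
    (_ : g ∈ derivedSeries G (zassenhausBound n)), ρ g = 1 := by
  induction n with
  | zero =>
    intro G V _ _ _ _ _ ρ hn g _
    have : Subsingleton V := Module.finrank_zero_iff.mp (Nat.le_zero.mp hn)
    exact Subsingleton.elim _ _
  | succ n ih =>
    intro G V _ _ _ _ _ ρ hn g hg
    set m := ((n + 1) * (n + 1)).factorial
    have hfin : (Module.finrank k V).factorial ≤ m :=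
      Nat.factorial_le (hn.trans (Nat.le_mul_of_pos_left _ n.succ_pos))
    have hfin2 : (Module.finrank k (V →ₗ[k] V)).factorial ≤ m := by
      rw [Module.finrank_linearMap]
      exact Nat.factorial_le (Nat.mul_le_mul hn hn)
    by_cases hsc : ∀ g, IsScalarEnd (ρ g)
    · have h1 : g ∈ derivedSeries G 1 := derivedSeries_antitone G (by
        simp only [zassenhausBound]; omega) hg
      have : derivedSeries G 1 ≤ ρ.ker := by
        rw [derivedSeries_succ, Subgroup.commutator_le]
        intro a _ b _
        rw [MonoidHom.mem_ker, commutatorElement_def, mul_assoc (a * b), ← mul_inv_rev, map_mul,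
          map_mul]
        obtain ⟨c, hc⟩ := hsc a
        obtain ⟨d, hd⟩ := hsc b
        have : ρ a * ρ b = ρ b * ρ a := by
          rw [hc, hd, smul_mul_smul_comm, smul_mul_smul_comm, mul_comm]
        rw [this, ← map_mul, ← map_mul, mul_inv_cancel, map_one]
      exact this h1
    push Not at hsc
    have hinv : ∃ U : Submodule k V, U ≠ ⊥ ∧ U ≠ ⊤ ∧
        ∀ s ∈ derivedSeries G (m + 1), U ≤ U.comap (ρ s) := by
      rcases exists_invariant_or_semicommute ρ hsc (derivedSeries G m : Set G)
        (fun B _ χ hχ s hs b => weight_conj_eq_of_mem_derivedSeries hχ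
          (derivedSeries_antitone G hfin hs) b)
        (fun B _ χ hχ s hs b => weight_conj_eq_of_mem_derivedSeries hχ
          (derivedSeries_antitone G hfin2 hs) b) with h | h
      · obtain ⟨U, h1, h2, h3⟩ := h
        exact ⟨U, h1, h2, fun s hs => h3 s (derivedSeries_antitone G m.le_succ hs)⟩
      · obtain ⟨b, hb, hc⟩ := h
        obtain ⟨U, h1, h2, h3⟩ := exists_invariant_of_commute hb
        refine ⟨U, h1, h2, fun s hs => h3 _ ?_⟩
        let C : Subgroup G := (Subgroup.centralizer {MonoidHom.toHomUnits ρ b}).comap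
          (MonoidHom.toHomUnits ρ)
        have : derivedSeries G (m + 1) ≤ C := by
          rw [derivedSeries_succ, Subgroup.commutator_le]
          intro x hx y hy
          obtain ⟨c, hcx⟩ := hc x hx
          obtain ⟨d, hdy⟩ := hc y hy
          obtain ⟨c', hcx'⟩ := hc x⁻¹ (inv_mem hx)
          obtain ⟨d', hdy'⟩ := hc y⁻¹ (inv_mem hy)
          have step : ∀ (z : G) (c e : k) (a : G), ρ (z * b * z⁻¹) = c • ρ b →
              ρ (a * b * a⁻¹) = e • ρ b → ρ (z * a * b * (z * a)⁻¹) = (e * c) • ρ b := by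
            intro z c e a hz ha
            rw [show z * a * b * (z * a)⁻¹ = z * (a * b * a⁻¹) * z⁻¹ by group, map_mul, map_mul,
              ha, mul_smul_comm, smul_mul_assoc, ← map_mul, ← map_mul, hz, smul_smul]
          have hxx := step x c c' x⁻¹ hcx hcx'
          have hyy := step y d d' y⁻¹ hdy hdy'
          have hall := step (x * y * x⁻¹) _ _ y⁻¹ (step (x * y) _ _ x⁻¹ (step x _ _ y hcx hdy) hcx')
            hdy'
          rw [mul_inv_cancel, one_mul, inv_one, mul_one] at hxx hyy
          have hall' : ρ (⁅x, y⁆ * b * ⁅x, y⁆⁻¹) = ρ b := by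
            rw [commutatorElement_def, hall, show d' * (c' * (d * c)) = (d' * d) * (c' * c) by ring,
              mul_smul, ← hxx, ← hyy]
          rw [Subgroup.mem_comap, Subgroup.mem_centralizer_singleton_iff]
          apply Units.ext
          rw [← map_mul, ← map_mul, MonoidHom.coe_toHomUnits, MonoidHom.coe_toHomUnits]
          have h9 := congrArg (fun f => f * ρ ⁅x, y⁆) hall'
          simp only [← map_mul, inv_mul_cancel_right] at h9
          exact h9
        have h10 := Subgroup.mem_centralizer_singleton_iff.mp (this hs)
        have h11 := congrArg Units.val h10
        first | exact h11 | exact h11.symm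
    obtain ⟨U, hU0, hU1, hU⟩ := hinv
    set H := derivedSeries G (m + 1)
    let ρ' : Representation k H V := ρ.comp H.subtype
    have hU' : ∀ s : H, U ≤ U.comap (ρ' s) := fun s => hU s s.2
    have : Group.IsSolvable H := Group.isSolvable_of_isSolvable_injective H.subtype_injective
    have d1 : Module.finrank k U ≤ n := by
      have := Submodule.finrank_lt hU1
      omega
    have d2 : Module.finrank k (V ⧸ U) ≤ n := by
      have := Submodule.finrank_quotient_add_finrank U
      have : 0 < Module.finrank k U := by
        rw [Module.finrank_pos_iff]
        exact Submodule.nontrivial_iff_ne_bot.mpr hU0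
      omega
    have i1 := fun (g : H) hg => ih (ρ'.subrepresentation U hU') d1 (g := g) hg
    have i2 := fun (g : H) hg => ih (ρ'.quotient U hU') d2 (g := g) hg
    have hgm : g ∈ derivedSeries G (m + 1 + (zassenhausBound n + 1)) := hg
    rw [← map_subtype_derivedSeries_derivedSeries, Subgroup.mem_map] at hgm
    obtain ⟨g', hg', rfl⟩ := hgm
    refine subrepresentation_quotient_commutator_trivial ρ' U
      (H := derivedSeries H (zassenhausBound n)) (fun g hg u hu => ?_) (fun g hg v => ?_) hg'
    · have := LinearMap.congr_fun (i1 g hg) ⟨u, hu⟩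
      exact congrArg Subtype.val this
    · have := LinearMap.congr_fun (i2 g hg) (Submodule.Quotient.mk v)
      exact (Submodule.Quotient.eq U).mp this

end Zassenhaus

section Quadratic

variable {k : Type*} [Field k]

theorem linHom_sub_one_pow_three {G V : Type*} [Group G] [AddCommGroup V] [Module k V]
    (ρ : Representation k G V) {x : G} (hx : (ρ x - 1) ^ 2 = 0) :
    ((ρ.linHom ρ) x - 1) ^ 3 = 0 := by
  obtain ⟨a, ha⟩ : ∃ a, a = ρ x - 1 := ⟨_, rfl⟩
  rw [← ha, sq] at hx
  have e1 : ρ x = 1 + a := by rw [ha]; abel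
  have e2 : ρ x⁻¹ = 1 - a := by
    have h1 : ρ x⁻¹ * ρ x = 1 := by rw [← map_mul, inv_mul_cancel, map_one]
    have h2 : ρ x * (1 - a) = 1 := by
      rw [e1, mul_sub, mul_one, add_mul, one_mul, hx]; abel
    calc ρ x⁻¹ = ρ x⁻¹ * (ρ x * (1 - a)) := by rw [h2, mul_one]
      _ = 1 - a := by rw [← mul_assoc, h1, one_mul]
  have key : ∀ f : Module.End k V, ((ρ.linHom ρ) x - 1) f = a * f - f * a - a * f * a := by
    intro f
    change ρ x * (f * ρ x⁻¹) - f = _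
    rw [e1, e2]
    noncomm_ring
  ext1 f
  rw [pow_three, Module.End.mul_apply, Module.End.mul_apply, key, key, key]
  have h3 : ∀ g : Module.End k V, a * (a * g) = 0 := fun g => by rw [← mul_assoc, hx, zero_mul]
  simp only [mul_sub, sub_mul, mul_assoc, hx, h3, mul_zero, zero_mul, sub_zero, zero_sub,
    LinearMap.zero_apply, sub_self, neg_zero, mul_neg, neg_mul]

variable [IsAlgClosed k]

/-- In characteristic `p ≥ 5` a solvable linear group generated by quadratic unipotent elements
is unipotent. -/
theorem exists_sub_one_pow_eq_zero_of_closure_quadratic (p : ℕ) [Fact p.Prime] (hp : 5 ≤ p)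
    [CharP k p] {G : Type*} [Group G] [Group.IsSolvable G] (X : Set G)
    (hX : Subgroup.closure X = ⊤) (n : ℕ) :
    ∀ {V : Type*} [AddCommGroup V] [Module k V] [FiniteDimensional k V]
    (ρ : Representation k G V) (_ : Module.finrank k V ≤ n)
    (_ : ∀ x ∈ X, (ρ x - 1) ^ 2 = 0) (y : G), ∃ N, (ρ y - 1) ^ N = 0 := by
  induction n with
  | zero =>
    intro V _ _ _ ρ hn _ y
    have : Subsingleton V := Module.finrank_zero_iff.mp (Nat.le_zero.mp hn)
    exact ⟨0, Subsingleton.elim _ _⟩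
  | succ n ih =>
    intro V _ _ _ ρ hn hq y
    by_cases hsc : ∀ g, IsScalarEnd (ρ g)
    · have : Subgroup.closure X ≤ ρ.ker := by
        rw [Subgroup.closure_le]
        intro x hx
        obtain ⟨c, hc⟩ := hsc x
        have h := hq x hx
        rw [SetLike.mem_coe, MonoidHom.mem_ker]
        have e : ρ x - 1 = (c - 1) • 1 := by rw [hc, sub_smul, one_smul]
        rw [e, smul_pow, one_pow] at h
        rcases smul_eq_zero.mp h with h | h
        · rw [← sub_eq_zero, e, pow_eq_zero_iff two_ne_zero |>.mp h, zero_smul]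
        · rw [← mul_one (ρ x), h, mul_zero]
      rw [hX] at this
      have hy : ρ y = 1 := this (Subgroup.mem_top y)
      exact ⟨1, by rw [hy, sub_self, pow_one]⟩
    push Not at hsc
    have hinv : ∃ U : Submodule k V, U ≠ ⊥ ∧ U ≠ ⊤ ∧ ∀ s ∈ X, U ≤ U.comap (ρ s) := by
      rcases exists_invariant_or_semicommute ρ hsc X
        (fun B _ χ hχ s hs b => weight_conj_eq_of_sub_one_pow_eq_zero p hχ (by omega) (hq s hs) b)
        (fun B _ χ hχ s hs b => weight_conj_eq_of_sub_one_pow_eq_zero p hχ (by omega)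
          (linHom_sub_one_pow_three ρ (hq s hs)) b) with h | h
      · exact h
      · obtain ⟨b, hb, hc⟩ := h
        obtain ⟨U, h1, h2, h3⟩ := exists_invariant_of_commute hb
        refine ⟨U, h1, h2, fun s hs => h3 _ ?_⟩
        obtain ⟨c, hcs⟩ := hc s hs
        have hcub := LinearMap.congr_fun (linHom_sub_one_pow_three ρ (hq s hs)) (ρ b)
        have e1 : ((ρ.linHom ρ) s - 1) (ρ b) = (c - 1) • ρ b := by
          rw [sub_smul, one_smul, ← hcs]
          change ρ s * (ρ b * ρ s⁻¹) - ρ b = _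
          rw [← map_mul, ← map_mul, mul_assoc]
        rw [pow_three, Module.End.mul_apply, Module.End.mul_apply, e1, map_smul, e1, map_smul,
          map_smul, e1, smul_smul, smul_smul] at hcub
        have hb0 : ρ b ≠ 0 := fun h0 => hb ⟨0, by simp [h0]⟩
        have hc1 : c = 1 := by
          have := (smul_eq_zero.mp hcub).resolve_right hb0
          simpa [sub_eq_zero] using this
        rw [hc1, one_smul] at hcs
        have h9 := congrArg (fun f => f * ρ s) hcs
        simp only [← map_mul, inv_mul_cancel_right] at h9
        rw [Commute, SemiconjBy, ← map_mul, ← map_mul, h9]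
    obtain ⟨U, hU0, hU1, hU⟩ := hinv
    have hU' : ∀ s, U ≤ U.comap (ρ s) := by
      intro s
      have hs : s ∈ Subgroup.closure X := hX ▸ Subgroup.mem_top s
      induction hs using Subgroup.closure_induction with
      | mem x hx => exact hU x hx
      | one => exact fun v hv => by simpa using hv
      | mul a b _ _ ha hb =>
        intro v hv
        rw [Submodule.mem_comap, map_mul]
        exact ha (hb hv)
      | inv a _ ha =>
        have hinj : Function.Injective (ρ a) :=
          Function.LeftInverse.injective (g := ρ a⁻¹) fun v => by
            rw [← Module.End.mul_apply, ← map_mul, inv_mul_cancel, map_one, Module.End.one_apply]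
        have hmap : U.map (ρ a) = U :=
          Submodule.eq_of_le_of_finrank_eq (Submodule.map_le_iff_le_comap.mpr ha)
            (Submodule.equivMapOfInjective _ hinj U).finrank_eq.symm
        intro v hv
        rw [← hmap] at hv
        obtain ⟨u, hu, rfl⟩ := hv
        rw [Submodule.mem_comap, ← Module.End.mul_apply, ← map_mul, inv_mul_cancel, map_one]
        exact hu
    have d1 : Module.finrank k U ≤ n := by
      have := Submodule.finrank_lt hU1
      omega
    have d2 : Module.finrank k (V ⧸ U) ≤ n := by
      have := Submodule.finrank_quotient_add_finrank U
      have : 0 < Module.finrank k U := by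
        rw [Module.finrank_pos_iff]
        exact Submodule.nontrivial_iff_ne_bot.mpr hU0
      omega
    have p1 : ∀ (g : G) (N : ℕ) (u : U),
        (((ρ.subrepresentation U hU' g - 1) ^ N) u : V) = ((ρ g - 1) ^ N) u := by
      intro g N
      induction N with
      | zero => simp
      | succ N ihN =>
        intro u
        rw [pow_succ, pow_succ, Module.End.mul_apply, Module.End.mul_apply, ihN]
        rfl
    have p2 : ∀ (g : G) (N : ℕ) (v : V), ((ρ.quotient U hU' g - 1) ^ N) (Submodule.Quotient.mk v)
        = Submodule.Quotient.mk (((ρ g - 1) ^ N) v) := by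
      intro g N
      induction N with
      | zero => simp
      | succ N ihN =>
        intro v
        rw [pow_succ, pow_succ, Module.End.mul_apply, Module.End.mul_apply, ← ihN]
        rfl
    obtain ⟨N1, hN1⟩ := ih (ρ.subrepresentation U hU') d1 (fun x hx => by
      ext u
      rw [p1, hq x hx]; rfl) y
    obtain ⟨N2, hN2⟩ := ih (ρ.quotient U hU') d2 (fun x hx => by
      ext v
      simp only [LinearMap.comp_apply, Submodule.mkQ_apply]
      rw [p2, hq x hx]; rfl) y
    refine ⟨N1 + N2, ?_⟩
    ext v
    rw [pow_add, Module.End.mul_apply]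
    have h2 : ((ρ y - 1) ^ N2) v ∈ U := by
      rw [← Submodule.Quotient.mk_eq_zero, ← p2, hN2]; rfl
    have := p1 y N1 ⟨_, h2⟩
    rw [← this, hN1]; rfl

end Quadratic

theorem int_isJacobsonRing : IsJacobsonRing ℤ := by
  rw [isJacobsonRing_iff_prime_eq]
  intro I hI
  by_cases h : I = ⊥
  · subst h
    rw [eq_bot_iff]
    intro x hx
    have h1 := Int.isUnit_iff.mp (Ideal.mem_jacobson_bot.mp hx x)
    rw [Ideal.mem_bot]
    rcases h1 with h1 | h1 <;> nlinarith [mul_self_nonneg x]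
  · have := hI.isMaximal h
    exact Ideal.jacobson_eq_self_of_isMaximal

theorem finite_of_finiteType_int (K : Type*) [Field K] [Algebra.FiniteType ℤ K] : Finite K := by
  have := int_isJacobsonRing
  have hfin : Module.Finite ℤ K := finite_of_finite_type_of_isJacobsonRing ℤ K
  obtain ⟨p, hp⟩ := CharP.exists K
  rcases CharP.char_is_prime_or_zero K p with h | h
  · have : Fact p.Prime := ⟨h⟩
    let _ := ZMod.algebra K p
    have : Module.Finite (ZMod p) K := Module.Finite.of_restrictScalars_finite ℤ (ZMod p) K
    exact Module.finite_of_finite (ZMod p)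
  · subst h
    have : CharZero K := CharP.charP_to_charZero K
    have hinj : Function.Injective (algebraMap ℤ K) := (algebraMap ℤ K).injective_int
    have : IsField ℤ := isField_of_isIntegral_of_isField hinj (Field.toIsField K)
    exact absurd this Int.not_isField

section DerivedSeriesOfSubgroups

variable {A B : Type*} [Group A] [Group B]

theorem map_subtype_derivedSeries_succ (K : Subgroup A) (d : ℕ) :
    (derivedSeries K (d + 1)).map K.subtype
      = ⁅(derivedSeries K d).map K.subtype, (derivedSeries K d).map K.subtype⁆ := by
  rw [derivedSeries_succ, Subgroup.map_commutator]

theorem map_subtype_derivedSeries_zero (K : Subgroup A) :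
    (derivedSeries K 0).map K.subtype = K := by
  rw [derivedSeries_zero, ← MonoidHom.range_eq_map, K.range_subtype]

theorem map_subtype_derivedSeries_mono {K L : Subgroup A} (h : K ≤ L) (d : ℕ) :
    (derivedSeries K d).map K.subtype ≤ (derivedSeries L d).map L.subtype := by
  induction d with
  | zero => rwa [map_subtype_derivedSeries_zero, map_subtype_derivedSeries_zero]
  | succ d ih =>
    rw [map_subtype_derivedSeries_succ, map_subtype_derivedSeries_succ]
    exact Subgroup.commutator_mono ih ih

theorem map_map_subtype_derivedSeries (f : A →* B) (K : Subgroup A) (d : ℕ) :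
    ((derivedSeries K d).map K.subtype).map f
      = (derivedSeries (K.map f) d).map (K.map f).subtype := by
  induction d with
  | zero => rw [map_subtype_derivedSeries_zero, map_subtype_derivedSeries_zero]
  | succ d ih => rw [map_subtype_derivedSeries_succ, map_subtype_derivedSeries_succ,
      Subgroup.map_commutator, ih]

theorem exists_finset_mem_derivedSeries_closure (K : Subgroup A) (d : ℕ) {g : A}
    (hg : g ∈ (derivedSeries K d).map K.subtype) :
    ∃ S : Finset A, (S : Set A) ⊆ K ∧
      g ∈ (derivedSeries (Subgroup.closure (S : Set A)) d).map (Subgroup.closure _).subtype := by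
  classical
  induction d generalizing g with
  | zero =>
    rw [map_subtype_derivedSeries_zero] at hg
    refine ⟨{g}, by simpa using hg, ?_⟩
    rw [map_subtype_derivedSeries_zero]
    exact Subgroup.subset_closure (by simp)
  | succ d ih =>
    rw [map_subtype_derivedSeries_succ, Subgroup.commutator_def] at hg
    induction hg using Subgroup.closure_induction with
    | mem x hx =>
      obtain ⟨a, ha, b, hb, rfl⟩ := hx
      obtain ⟨S, hS, hSa⟩ := ih ha
      obtain ⟨T, hT, hTb⟩ := ih hb
      refine ⟨S ∪ T, by simp [hS, hT], ?_⟩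
      rw [map_subtype_derivedSeries_succ]
      exact Subgroup.commutator_mem_commutator
        (map_subtype_derivedSeries_mono (Subgroup.closure_mono (by simp)) d hSa)
        (map_subtype_derivedSeries_mono (Subgroup.closure_mono (by simp)) d hTb)
    | one => exact ⟨∅, by simp, one_mem _⟩
    | mul x y _ _ hx hy =>
      obtain ⟨S, hS, hSa⟩ := hx
      obtain ⟨T, hT, hTb⟩ := hy
      refine ⟨S ∪ T, by simp [hS, hT], mul_mem
        (map_subtype_derivedSeries_mono (Subgroup.closure_mono (by simp)) _ hSa)
        (map_subtype_derivedSeries_mono (Subgroup.closure_mono (by simp)) _ hTb)⟩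
    | inv x _ hx =>
      obtain ⟨S, hS, hSa⟩ := hx
      exact ⟨S, hS, inv_mem hSa⟩

theorem isSolvable_map (f : A →* B) (K : Subgroup A) [Group.IsSolvable K] :
    Group.IsSolvable (K.map f) :=
  Group.isSolvable_of_surjective (f.subgroupMap_surjective K)

theorem isSolvable_of_map_injective {f : A →* B} (hf : Function.Injective f) {K : Subgroup A}
    (h : Group.IsSolvable (K.map f)) : Group.IsSolvable K :=
  Group.isSolvable_of_isSolvable_injective (K.equivMapOfInjective f hf).injective
    (f := (K.equivMapOfInjective f hf).toMonoidHom)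

end DerivedSeriesOfSubgroups

section Linear

variable {n : ℕ}

theorem mem_derivedSeries_zassenhausBound_eq_one {F : Type*} [Field F]
    (Q : Subgroup (GL (Fin n) F)) [Group.IsSolvable Q] {g : Q}
    (hg : g ∈ derivedSeries Q (zassenhausBound n)) : g = 1 := by
  let k := AlgebraicClosure F
  let ρ : Representation k Q (Fin n → k) :=
    ((Matrix.toLinAlgEquiv' : Matrix (Fin n) (Fin n) k ≃ₐ[k] _).toAlgHom : _ →* _).comp
      ((Units.coeHom _).comp ((Matrix.GeneralLinearGroup.map (algebraMap F k)).comp Q.subtype))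
  have h1 : ρ g = 1 :=
    apply_eq_one_of_mem_derivedSeries_zassenhausBound n ρ (by simp) hg
  have h2 : ((Matrix.GeneralLinearGroup.map (algebraMap F k) (g : GL (Fin n) F) : GL (Fin n) k) :
      Matrix (Fin n) (Fin n) k) = 1 := by
    refine (Matrix.toLinAlgEquiv' : Matrix (Fin n) (Fin n) k ≃ₐ[k] _).injective ?_
    rw [map_one]
    exact h1
  apply Subtype.ext
  apply Units.ext
  apply Matrix.map_injective (algebraMap F k).injective
  change _ = (1 : Matrix (Fin n) (Fin n) F).map (algebraMap F k)
  rw [Matrix.map_one _ (map_zero _) (map_one _), ← h2]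
  rfl

universe u

theorem derivedSeries_zassenhausBound_eq_bot_of_field
    (hfin : ∀ (Q : Type u) [Group Q] [Finite Q],
      (∀ a b : Q, Group.IsSolvable (Subgroup.closure ({a, b} : Set Q))) → Group.IsSolvable Q)
    {F : Type u} [Field F] (H : Subgroup (GL (Fin n) F))
    (hH : ∀ a ∈ H, ∀ b ∈ H, Group.IsSolvable (Subgroup.closure ({a, b} : Set (GL (Fin n) F))))
    {g : GL (Fin n) F} (hg : g ∈ (derivedSeries H (zassenhausBound n)).map H.subtype) :
    g = 1 := by
  classical
  obtain ⟨S, hSH, hgS⟩ := exists_finset_mem_derivedSeries_closure H _ hg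
  let E : Set F := ⋃ s ∈ S, ⋃ i, ⋃ j, {s.1 i j, s⁻¹.1 i j}
  have hE : E.Finite := Set.Finite.biUnion S.finite_toSet fun s _ =>
    Set.finite_iUnion fun i => Set.finite_iUnion fun j => by simp
  let R := Algebra.adjoin ℤ E
  have hEs : ∀ s ∈ S, ∀ i j, s.1 i j ∈ R ∧ s⁻¹.1 i j ∈ R := fun s hs i j =>
    ⟨Algebra.subset_adjoin (Set.mem_biUnion hs (Set.mem_iUnion.mpr ⟨i, Set.mem_iUnion.mpr
      ⟨j, by simp⟩⟩)), Algebra.subset_adjoin (Set.mem_biUnion hs (Set.mem_iUnion.mpr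
      ⟨i, Set.mem_iUnion.mpr ⟨j, by simp⟩⟩))⟩
  have hRft : Algebra.FiniteType ℤ R :=
    (Subalgebra.fg_iff_finiteType _).mp ⟨hE.toFinset, by simp [R]⟩
  have := int_isJacobsonRing
  have hRJ : IsJacobsonRing R := isJacobsonRing_of_finiteType (A := ℤ)
  let φ : R →+* F := R.val.toRingHom
  have hφ : Function.Injective φ := Subtype.val_injective
  let ι : GL (Fin n) R →* GL (Fin n) F := Matrix.GeneralLinearGroup.map φ
  have hι : Function.Injective ι := by
    intro a b hab
    apply Units.ext
    apply Matrix.map_injective hφ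
    exact congrArg Units.val hab
  have hlift : ∀ s ∈ S, ∃ t, ι t = s := by
    intro s hs
    let a : Matrix (Fin n) (Fin n) R := fun i j => ⟨s.1 i j, (hEs s hs i j).1⟩
    let b : Matrix (Fin n) (Fin n) R := fun i j => ⟨s⁻¹.1 i j, (hEs s hs i j).2⟩
    have ha : a.map φ = s.1 := rfl
    have hb : b.map φ = s⁻¹.1 := rfl
    refine ⟨⟨a, b, ?_, ?_⟩, Units.ext rfl⟩ <;> apply Matrix.map_injective hφ
    · change (a * b).map φ = (1 : Matrix _ _ R).map φ
      rw [Matrix.map_mul, ha, hb, Matrix.map_one _ (map_zero _) (map_one _)]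
      exact s.mul_inv
    · change (b * a).map φ = (1 : Matrix _ _ R).map φ
      rw [Matrix.map_mul, ha, hb, Matrix.map_one _ (map_zero _) (map_one _)]
      exact s.inv_mul
  let Γ : Subgroup (GL (Fin n) R) := Subgroup.closure (ι ⁻¹' (S : Set _))
  have hΓ : Γ.map ι = Subgroup.closure (S : Set _) := by
    rw [MonoidHom.map_closure, Set.image_preimage_eq_of_subset]
    exact fun s hs => hlift s hs
  have hΓH : ∀ a ∈ Γ, ι a ∈ H := fun a ha => by
    have : ι a ∈ Γ.map ι := Subgroup.mem_map_of_mem ι ha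
    rw [hΓ] at this
    exact (Subgroup.closure_le H).mpr hSH this
  rw [← hΓ, ← map_map_subtype_derivedSeries, Subgroup.mem_map] at hgS
  obtain ⟨g', hg', rfl⟩ := hgS
  by_contra hne
  have hg1 : g' ≠ 1 := fun h => hne (by rw [h, map_one])
  obtain ⟨i, j, hij⟩ : ∃ i j, g'.1 i j ≠ (1 : Matrix (Fin n) (Fin n) R) i j := by
    by_contra hcon
    push Not at hcon
    exact hg1 (Units.ext (Matrix.ext hcon))
  have hjac : (⊥ : Ideal R).jacobson = ⊥ := hRJ.out (Ideal.isPrime_bot).isRadical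
  have hnot : g'.1 i j - (1 : Matrix (Fin n) (Fin n) R) i j ∉ (⊥ : Ideal R).jacobson := by
    rw [hjac, Ideal.mem_bot, sub_eq_zero]
    exact hij
  rw [Ideal.jacobson, Submodule.mem_sInf] at hnot
  push Not at hnot
  obtain ⟨m, ⟨-, hm⟩, hnm⟩ := hnot
  have hft : Algebra.FiniteType ℤ (R ⧸ m) :=
    Algebra.FiniteType.of_surjective (Ideal.Quotient.mkₐ ℤ m) Ideal.Quotient.mk_surjective
  let _ := Ideal.Quotient.field m
  have : Finite (R ⧸ m) := @finite_of_finiteType_int (R ⧸ m) _ hft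
  let π : GL (Fin n) R →* GL (Fin n) (R ⧸ m) :=
    Matrix.GeneralLinearGroup.map (Ideal.Quotient.mk m)
  have hsol : Group.IsSolvable (Γ.map π) := by
    refine hfin _ fun a b => ?_
    obtain ⟨a', ha', ha⟩ := a.2
    obtain ⟨b', hb', hb⟩ := b.2
    have h1 : Group.IsSolvable (Subgroup.closure ({a', b'} : Set (GL (Fin n) R))) := by
      refine isSolvable_of_map_injective hι ?_
      rw [MonoidHom.map_closure, Set.image_pair]
      exact hH _ (hΓH a' ha') _ (hΓH b' hb')
    refine isSolvable_of_map_injective (f := (Γ.map π).subtype) Subtype.val_injective ?_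
    rw [MonoidHom.map_closure, Set.image_pair, Subgroup.coe_subtype, ← ha, ← hb, ← Set.image_pair,
      ← MonoidHom.map_closure]
    exact isSolvable_map π _
  have hπ : π g' ∈ (derivedSeries (Γ.map π) (zassenhausBound n)).map (Γ.map π).subtype := by
    rw [← map_map_subtype_derivedSeries]
    exact Subgroup.mem_map_of_mem π hg'
  obtain ⟨q, hq, hqg⟩ := hπ
  have hq1 := mem_derivedSeries_zassenhausBound_eq_one (Γ.map π) hq
  rw [hq1, map_one] at hqg
  have h3 : (Ideal.Quotient.mk m) (g'.1 i j) = (1 : Matrix (Fin n) (Fin n) (R ⧸ m)) i j :=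
    (congrArg (fun M : GL (Fin n) (R ⧸ m) => M.1 i j) hqg).symm
  refine hnm (Ideal.Quotient.eq.mp ?_)
  rw [h3, Matrix.one_apply, Matrix.one_apply]
  split <;> simp

theorem isSolvable_of_two_generated_isSolvable
    (hfin : ∀ (Q : Type u) [Group Q] [Finite Q],
      (∀ a b : Q, Group.IsSolvable (Subgroup.closure ({a, b} : Set Q))) → Group.IsSolvable Q)
    {I : Type*} (P : I → Type u) [∀ α, Field (P α)]
    (G : Subgroup (GL (Fin n) (∀ α, P α)))
    (hG : ∀ a b : G, Group.IsSolvable (Subgroup.closure ({a, b} : Set G))) :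
    Group.IsSolvable G := by
  refine ⟨zassenhausBound n, ?_⟩
  rw [eq_bot_iff]
  intro g hg
  rw [Subgroup.mem_bot]
  have key : ∀ α, Matrix.GeneralLinearGroup.map (Pi.evalRingHom P α) (g : GL (Fin n) _) = 1 := by
    intro α
    set f := Matrix.GeneralLinearGroup.map (n := Fin n) (Pi.evalRingHom P α)
    refine derivedSeries_zassenhausBound_eq_bot_of_field hfin (G.map f) ?_ ?_
    · rintro _ ⟨a, ha, rfl⟩ _ ⟨b, hb, rfl⟩
      have := hG ⟨a, ha⟩ ⟨b, hb⟩
      have h := isSolvable_map (f.comp G.subtype)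
        (Subgroup.closure ({⟨a, ha⟩, ⟨b, hb⟩} : Set G))
      rwa [MonoidHom.map_closure, Set.image_pair] at h
    · rw [← map_map_subtype_derivedSeries]
      exact Subgroup.mem_map_of_mem f (Subgroup.mem_map_of_mem G.subtype hg)
  apply Subtype.ext
  apply Units.ext
  ext i j α
  have := congrArg (fun M : GL (Fin n) (P α) => M.1 i j) (key α)
  refine this.trans ?_
  simp only [Units.val_one, OneMemClass.coe_one, Matrix.one_apply]
  split <;> rfl

end Linear

section Burnside

open Finset MonoidAlgebra

theorem eq_zero_or_eq_of_isIntegral_average {ι : Type*} [Fintype ι] [Nonempty ι] {m : ℕ}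
    (hm : 0 < m)
    (f : ι → ℂ) (hf : ∀ i, f i ^ m = 1)
    (hInt : IsIntegral ℤ ((∑ i, f i) / Fintype.card ι)) :
    ∑ i, f i = 0 ∨ ∃ c, ∀ i, f i = c := by
  rw [or_iff_not_imp_left]
  intro h0
  set α := (∑ i, f i) / Fintype.card ι with hα
  have hcard : (Fintype.card ι : ℂ) ≠ 0 := Nat.cast_ne_zero.mpr Fintype.card_ne_zero
  have hα0 : α ≠ 0 := div_ne_zero h0 hcard
  have hfint : ∀ i, IsIntegral ℚ (f i) := fun i =>
    IsIntegral.of_pow hm (by rw [hf i]; exact isIntegral_one)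
  let L := IntermediateField.adjoin ℚ (Set.range f)
  have hfd : FiniteDimensional ℚ L :=
    IntermediateField.finiteDimensional_adjoin (by rintro _ ⟨i, rfl⟩; exact hfint i)
  have : NumberField L := ⟨⟩
  let f' : ι → L := fun i => ⟨f i, IntermediateField.subset_adjoin _ _ ⟨i, rfl⟩⟩
  let β : L := (∑ i, f' i) / Fintype.card ι
  have hβ : algebraMap L ℂ β = α := by
    simp only [β, map_div₀, map_sum, map_natCast, hα]
    rfl
  have hβint : IsIntegral ℤ β := by
    rw [← hβ] at hInt
    exact (isIntegral_algebraMap_iff (algebraMap L ℂ).injective).mp hInt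
  have hβ0 : β ≠ 0 := by rintro h; rw [h, map_zero] at hβ; exact hα0 hβ.symm
  have hbound : ∀ φ : L →+* ℂ, ‖φ β‖ ≤ 1 := by
    intro φ
    simp only [β, map_div₀, map_sum, map_natCast, norm_div, Complex.norm_natCast]
    have hpos : (0 : ℝ) < Fintype.card ι := by exact_mod_cast Fintype.card_pos
    rw [div_le_one hpos]
    calc ‖∑ i, φ (f' i)‖ ≤ ∑ i, ‖φ (f' i)‖ := norm_sum_le _ _
      _ = ∑ i : ι, (1 : ℝ) := by
        refine Finset.sum_congr rfl fun i _ => ?_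
        refine Complex.norm_eq_one_of_pow_eq_one (n := m) ?_ hm.ne'
        rw [← map_pow]
        have : f' i ^ m = 1 := Subtype.ext (hf i)
        rw [this, map_one]
      _ = _ := by simp
  obtain ⟨N, hN, h1⟩ := NumberField.Embeddings.pow_eq_one_of_norm_le_one L ℂ hβ0 hβint hbound
  have hα1 : ‖α‖ = 1 := by
    refine Complex.norm_eq_one_of_pow_eq_one (n := N) ?_ (by omega)
    rw [← hβ, ← map_pow, h1, map_one]
  have hnf : ∀ i, ‖f i‖ = 1 := fun i => Complex.norm_eq_one_of_pow_eq_one (hf i) hm.ne'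
  have hconj : α * (starRingEnd ℂ) α = 1 := by
    rw [Complex.mul_conj, Complex.normSq_eq_norm_sq, hα1]; simp
  have hle : ∀ i ∈ univ, (f i * (starRingEnd ℂ) α).re ≤ 1 := by
    intro i _
    refine (Complex.re_le_norm _).trans ?_
    rw [norm_mul, hnf, RCLike.norm_conj, hα1, one_mul]
  have hsum : ∑ i, (f i * (starRingEnd ℂ) α).re = ∑ i : ι, (1 : ℝ) := by
    rw [← Complex.re_sum, ← Finset.sum_mul]
    have : ∑ i, f i = Fintype.card ι * α := by rw [hα]; field_simp
    rw [this, mul_assoc, hconj]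
    simp
  refine ⟨α, fun i => ?_⟩
  have hre := (Finset.sum_eq_sum_iff_of_le hle).mp hsum i (mem_univ i)
  have hn : ‖f i * (starRingEnd ℂ) α‖ = 1 := by
    rw [norm_mul, hnf, RCLike.norm_conj, hα1, one_mul]
  have h2 : f i * (starRingEnd ℂ) α = 1 := by
    have h3 : Complex.normSq (f i * (starRingEnd ℂ) α) = 1 := by
      rw [Complex.normSq_eq_norm_sq, hn, one_pow]
    rw [Complex.normSq_apply, hre] at h3
    apply Complex.ext
    · exact hre
    · have : (f i * (starRingEnd ℂ) α).im * (f i * (starRingEnd ℂ) α).im = 0 := by linarith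
      simpa using this
  calc f i = f i * (α * (starRingEnd ℂ) α) := by rw [hconj, mul_one]
    _ = (f i * (starRingEnd ℂ) α) * α := by ring
    _ = α := by rw [h2, one_mul]

theorem pow_eq_one_of_mem_roots_charpoly {d m : ℕ} (A : Matrix (Fin d) (Fin d) ℂ) (hd : d ≠ 0)
    (hA : A ^ m = 1) {x : ℂ} (hx : x ∈ A.charpoly.roots) : x ^ m = 1 := by
  have : NeZero d := ⟨hd⟩
  have h1 := Matrix.mem_spectrum_iff_isRoot_charpoly.mpr (Polynomial.isRoot_of_mem_roots hx)
  have h2 := spectrum.pow_mem_pow A m h1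
  rw [hA, spectrum.one_eq] at h2
  exact h2

theorem isIntegral_trace_of_pow_eq_one {d m : ℕ} (hm : 0 < m) (hd : d ≠ 0)
    (A : Matrix (Fin d) (Fin d) ℂ) (hA : A ^ m = 1) : IsIntegral ℤ A.trace := by
  rw [Matrix.trace_eq_sum_roots_charpoly]
  refine IsIntegral.multiset_sum fun x hx => IsIntegral.of_pow hm ?_
  rw [pow_eq_one_of_mem_roots_charpoly A hd hA hx]
  exact isIntegral_one

theorem trace_eq_zero_or_eq_scalar {d m : ℕ} (hm : 0 < m) (hd : d ≠ 0)
    (A : Matrix (Fin d) (Fin d) ℂ) (hA : A ^ m = 1) (hInt : IsIntegral ℤ (A.trace / d)) :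
    A.trace = 0 ∨ ∃ c : ℂ, A = Matrix.scalar (Fin d) c := by
  classical
  have : NeZero d := ⟨hd⟩
  set s := A.charpoly.roots with hs
  have hsplit := IsAlgClosed.splits A.charpoly
  have hcard : Multiset.card s = d := by
    rw [← hsplit.natDegree_eq_card_roots, Matrix.charpoly_natDegree_eq_dim, Fintype.card_fin]
  have htr : A.trace = ∑ i : s, (i : ℂ) := by
    rw [Matrix.trace_eq_sum_roots_charpoly, ← hs, Finset.sum_eq_multiset_sum, Multiset.map_univ_coe]
  have hct : Fintype.card s = d := by rw [Multiset.card_coe, hcard]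
  have : Nonempty s := Fintype.card_pos_iff.mp (by omega)
  rw [htr, ← hct] at hInt
  rcases eq_zero_or_eq_of_isIntegral_average hm (fun i : s => (i : ℂ))
    (fun i => pow_eq_one_of_mem_roots_charpoly A hd hA (Multiset.coe_mem)) hInt with h | ⟨c, hc⟩
  · exact Or.inl (htr.trans h)
  · right
    refine ⟨c, ?_⟩
    have hrep : s = Multiset.replicate d c := by
      rw [Multiset.eq_replicate]
      refine ⟨hcard, fun b hb => ?_⟩
      have := hc (⟨b, ⟨0, Multiset.count_pos.mpr hb⟩⟩)
      simpa using this
    have hchar : A.charpoly = (Polynomial.X - Polynomial.C c) ^ d := by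
      rw [hsplit.eq_prod_roots_of_monic (Matrix.charpoly_monic A), ← hs, hrep]
      simp
    have h1 : minpoly ℂ A ∣ (Polynomial.X - Polynomial.C c) ^ d := by
      rw [← hchar]; exact Matrix.minpoly_dvd_charpoly A
    have h2 : minpoly ℂ A ∣ Polynomial.X ^ m - 1 := minpoly.dvd _ _ (by simp [hA])
    have hsep : (Polynomial.X ^ m - 1 : Polynomial ℂ).Separable :=
      Polynomial.separable_X_pow_sub_C (F := ℂ) 1 (Nat.cast_ne_zero.mpr hm.ne') one_ne_zero
    have hsq : Squarefree (minpoly ℂ A) := hsep.squarefree.squarefree_of_dvd h2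
    have h3 := (hsq.dvd_pow_iff_dvd hd).mp h1
    have h4 := Polynomial.aeval_eq_zero_of_dvd_aeval_eq_zero h3 (minpoly.aeval ℂ A)
    simp only [map_sub, Polynomial.aeval_X, Polynomial.aeval_C, sub_eq_zero] at h4
    rw [h4, Matrix.scalar_apply, Matrix.algebraMap_eq_diagonal]
    rfl

theorem trace_mulLeft_pi_matrix {r : ℕ} (d : Fin r → ℕ)
    (a : Π i, Matrix (Fin (d i)) (Fin (d i)) ℂ) :
    LinearMap.trace ℂ _ (LinearMap.mulLeft ℂ a) = ∑ i, d i * (a i).trace := by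
  classical
  rw [LinearMap.trace_eq_matrix_trace ℂ (Pi.basis fun i => Matrix.stdBasis ℂ (Fin (d i))
    (Fin (d i))),
    Matrix.trace, Fintype.sum_sigma]
  refine Finset.sum_congr rfl fun i _ => ?_
  rw [Fintype.sum_prod_type]
  have : ∀ x y : Fin (d i), ((LinearMap.toMatrix
      (Pi.basis fun i => Matrix.stdBasis ℂ (Fin (d i)) (Fin (d i)))
      (Pi.basis fun i => Matrix.stdBasis ℂ (Fin (d i)) (Fin (d i)))) (LinearMap.mulLeft ℂ a)).diag
      ⟨i, (x, y)⟩ = a i x x := by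
    intro x y
    rw [Matrix.diag_apply, LinearMap.toMatrix_apply, Pi.basis_repr, Pi.basis_apply,
      LinearMap.mulLeft_apply, Pi.mul_apply, Pi.single_eq_same, Matrix.stdBasis_eq_single]
    have : ∀ A : Matrix (Fin (d i)) (Fin (d i)) ℂ, (Matrix.stdBasis ℂ (Fin (d i)) (Fin (d i))).repr
      A (x, y) = A x y := by
      intro A
      simp [Matrix.stdBasis, Module.Basis.map_repr, Module.Basis.reindex]
    rw [this, Matrix.mul_single_apply_same, mul_one]
  simp_rw [this]
  simp [Matrix.trace, Finset.mul_sum]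

theorem trace_mulLeft_monoidAlgebra {G : Type*} [Group G] [Fintype G] [DecidableEq G]
    {g : G} (hg : g ≠ 1) :
    LinearMap.trace ℂ _ (LinearMap.mulLeft ℂ (single g 1 : MonoidAlgebra ℂ G)) = 0 := by
  rw [LinearMap.trace_eq_matrix_trace ℂ (MonoidAlgebra.basis G ℂ), Matrix.trace]
  refine Finset.sum_eq_zero fun h _ => ?_
  rw [Matrix.diag_apply, LinearMap.toMatrix_apply, LinearMap.mulLeft_apply]
  simp only [basis, Module.Basis.coe_ofRepr, coeffLinearEquiv_symm_apply]
  simp [hg]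

theorem class_sum_commute {G : Type*} [Group G] [Fintype G] [DecidableEq G] (R : Type*)
    [CommRing R] (z : G)
    [DecidablePred (IsConj z)]
    (a : MonoidAlgebra R G) :
    Commute (∑ x with IsConj z x, (single x 1 : MonoidAlgebra R G)) a := by
  induction a using MonoidAlgebra.induction_on with
  | of g =>
    rw [commute_iff_eq, of_apply, Finset.sum_mul, Finset.mul_sum]
    refine Finset.sum_nbij' (fun x => g⁻¹ * x * g) (fun x => g * x * g⁻¹) ?_ ?_ ?_ ?_ ?_
    · intro x hx
      rw [mem_filter] at hx ⊢
      exact ⟨mem_univ _, hx.2.trans (isConj_iff.mpr ⟨g⁻¹, by group⟩)⟩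
    · intro x hx
      rw [mem_filter] at hx ⊢
      exact ⟨mem_univ _, hx.2.trans (isConj_iff.mpr ⟨g, by group⟩)⟩
    · intro x _; group
    · intro x _; group
    · intro x _
      rw [single_mul_single, single_mul_single]
      congr 1
      group
  | add f g hf hg => exact hf.add_right hg
  | smul r f hf => exact hf.smul_right r

theorem not_isSimpleGroup_of_card_isConj_eq_prime_pow {G : Type*} [Group G] [Fintype G]
    [DecidableEq G] [IsSimpleGroup G] (hcen : Subgroup.center G = ⊥) {z : G} (hz : z ≠ 1)
    [DecidablePred (IsConj z)] {q b : ℕ} (hq : q.Prime)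
    (hcard : #{x | IsConj z x} = q ^ b) : False := by
  obtain ⟨r, d, hd, ⟨Φ⟩⟩ := IsSemisimpleRing.exists_algEquiv_pi_matrix_of_isAlgClosed ℂ
    (MonoidAlgebra ℂ G)
  let ρ : ∀ i, G →* Matrix (Fin (d i)) (Fin (d i)) ℂ := fun i =>
    ((Pi.evalMonoidHom (fun i => Matrix (Fin (d i)) (Fin (d i)) ℂ) i).comp
      (Φ : MonoidAlgebra ℂ G →* Π i, Matrix (Fin (d i)) (Fin (d i)) ℂ)).comp (MonoidAlgebra.of ℂ G)
  have hρ : ∀ i g, ρ i g = Φ (single g 1) i := fun i g => rfl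
  have hN : 0 < Fintype.card G := Fintype.card_pos
  have hpow : ∀ i g, ρ i g ^ Fintype.card G = 1 := by
    intro i g
    rw [← map_pow, pow_card_eq_one, map_one]
  have hcentral : ∀ (c : MonoidAlgebra ℂ G), (∀ a, Commute c a) → ∀ i, ∃ ω : ℂ,
      Φ c i = Matrix.scalar (Fin (d i)) ω := by
    intro c hc i
    have : Φ c i ∈ Set.range (Matrix.scalar (Fin (d i))) := by
      rw [← Matrix.center_eq_range, Semigroup.mem_center_iff]
      intro A
      have h := (hc (Φ.symm (Pi.single i A))).eq
      have h2 := congrFun (congrArg Φ h) i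
      simp only [map_mul, AlgEquiv.apply_symm_apply, Pi.mul_apply, Pi.single_eq_same] at h2
      exact h2.symm
    obtain ⟨ω, hω⟩ := this
    exact ⟨ω, hω.symm⟩
  have hker : ∀ i, (∀ g, ρ i g = 1) ∨ (∀ g, ρ i g = 1 → g = 1) := by
    intro i
    rcases (inferInstance : (ρ i).ker.Normal).eq_bot_or_eq_top with h | h
    · right
      intro g hg
      have : g ∈ (ρ i).ker := MonoidHom.mem_ker.mpr hg
      rw [h] at this
      exact Subgroup.mem_bot.mp this
    · left
      intro g
      have : g ∈ (ρ i).ker := h ▸ Subgroup.mem_top g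
      exact MonoidHom.mem_ker.mp this
  have hΦ : ∀ i, (∀ g, ρ i g = 1) → ∀ a : MonoidAlgebra ℂ G, ∃ ε : ℂ,
      ∀ j, (∀ g, ρ j g = 1) → Φ a j = ε • 1 := by
    intro i hi a
    induction a using MonoidAlgebra.induction_on with
    | of g => exact ⟨1, fun j hj => by rw [one_smul]; exact hj g⟩
    | add f g hf hg =>
      obtain ⟨e1, h1⟩ := hf
      obtain ⟨e2, h2⟩ := hg
      exact ⟨e1 + e2, fun j hj => by rw [map_add, Pi.add_apply, h1 j hj, h2 j hj, add_smul]⟩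
    | smul c f hf =>
      obtain ⟨e1, h1⟩ := hf
      exact ⟨c * e1, fun j hj => by rw [map_smul, Pi.smul_apply, h1 j hj, mul_smul]⟩
  have hdim : ∀ i, (∀ g, ρ i g = 1) → d i = 1 := by
    intro i hi
    by_contra hne
    have h2 : 1 < d i := by have := (hd i).out; omega
    obtain ⟨ε, hε⟩ := hΦ i hi (Φ.symm (Pi.single i (Matrix.single ⟨0, by omega⟩ ⟨1, h2⟩ 1)))
    have h3 := hε i hi
    rw [AlgEquiv.apply_symm_apply, Pi.single_eq_same] at h3
    have h4 := congrFun (congrFun h3 ⟨0, by omega⟩) ⟨1, h2⟩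
    simp at h4
  have huniq : ∀ i j, (∀ g, ρ i g = 1) → (∀ g, ρ j g = 1) → i = j := by
    intro i j hi hj
    by_contra hne
    obtain ⟨ε, hε⟩ := hΦ i hi (Φ.symm (Pi.single i 1))
    have h3 := hε i hi
    have h4 := hε j hj
    rw [AlgEquiv.apply_symm_apply, Pi.single_eq_same] at h3
    rw [AlgEquiv.apply_symm_apply, Pi.single_eq_of_ne (Ne.symm hne)] at h4
    have : NeZero (d i) := hd i
    have : NeZero (d j) := hd j
    have h5 : ε = 0 := by
      have := congrFun (congrFun h4 0) 0
      simpa using this.symm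
    rw [h5, zero_smul] at h3
    exact one_ne_zero h3
  obtain ⟨i₀, hi₀⟩ : ∃ i, ∀ g, ρ i g = 1 := by
    let e : MonoidAlgebra ℂ G := ∑ g : G, single g 1
    have hge : ∀ g : G, (single g 1 : MonoidAlgebra ℂ G) * e = e := by
      intro g
      simp only [e, Finset.mul_sum, single_mul_single, mul_one]
      exact Fintype.sum_equiv (Equiv.mulLeft g) _ _ (fun _ => rfl)
    have heg : ∀ g : G, e * (single g 1 : MonoidAlgebra ℂ G) = e := by
      intro g
      simp only [e, Finset.sum_mul, single_mul_single, mul_one]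
      exact Fintype.sum_equiv (Equiv.mulRight g) _ _ (fun _ => rfl)
    have hcomm : ∀ a, Commute e a := by
      intro a
      induction a using MonoidAlgebra.induction_on with
      | of g => exact (heg g).trans (hge g).symm
      | add f g hf hg => exact hf.add_right hg
      | smul r f hf => exact hf.smul_right r
    have he : e ≠ 0 := by
      intro h0
      have h1 := congrArg (fun f : MonoidAlgebra ℂ G => MonoidAlgebra.lift ℂ ℂ G 1 f) h0
      simp [e] at h1
    have : Φ e ≠ 0 := by simpa using he
    obtain ⟨i, hi⟩ := Function.ne_iff.mp this
    refine ⟨i, fun g => ?_⟩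
    obtain ⟨ω, hω⟩ := hcentral e hcomm i
    have h1 := congrFun (congrArg Φ (hge g)) i
    rw [map_mul, Pi.mul_apply, hω] at h1
    have hω0 : ω ≠ 0 := by rintro rfl; rw [hω] at hi; simp at hi
    rw [hρ]
    have h2 : ω • Φ (single g 1) i = ω • (1 : Matrix (Fin (d i)) (Fin (d i)) ℂ) := by
      rw [Matrix.scalar_apply, ← Matrix.smul_one_eq_diagonal, mul_smul_comm, mul_one] at h1
      exact h1
    exact smul_right_injective _ hω0 h2
  have hsum : ∑ i, d i * (ρ i z).trace = 0 := by
    rw [← trace_mulLeft_monoidAlgebra hz, ← trace_mulLeft_pi_matrix d (fun i => ρ i z)]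
    rw [← LinearMap.trace_conj' (LinearMap.mulLeft ℂ (single z 1 : MonoidAlgebra ℂ G))
      Φ.toLinearEquiv]
    congr 1
    refine LinearMap.ext fun x => ?_
    rw [LinearEquiv.conj_apply_apply, LinearMap.mulLeft_apply, LinearMap.mulLeft_apply]
    change _ = Φ (_ * Φ.symm x)
    rw [map_mul, AlgEquiv.apply_symm_apply]
    rfl
  have hInt : ∀ i, IsIntegral ℤ (ρ i z).trace := fun i =>
    isIntegral_trace_of_pow_eq_one hN (hd i).out _ (hpow i z)
  have hcomp : ∀ i, i ≠ i₀ → (ρ i z).trace = 0 ∨ q ∣ d i := by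
    intro i hi
    rw [or_iff_not_imp_right]
    intro hqd
    obtain ⟨ω, hω⟩ := hcentral _ (class_sum_commute ℂ z) i
    have hωint : IsIntegral ℤ ω := by
      have h0 : IsIntegral ℤ (∑ x with IsConj z x, (single x 1 : MonoidAlgebra ℤ G)) :=
        IsIntegral.of_finite ℤ _
      have h1 := h0.map (MonoidAlgebra.mapRingHom G (Int.castRingHom ℂ)).toIntAlgHom
      have h2 := h1.map (((Pi.evalRingHom (fun i => Matrix (Fin (d i)) (Fin (d i)) ℂ) i).comp
        (Φ : MonoidAlgebra ℂ G →+* Π i, Matrix (Fin (d i)) (Fin (d i)) ℂ))).toIntAlgHom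
      have h3 : ((Pi.evalRingHom (fun i => Matrix (Fin (d i)) (Fin (d i)) ℂ) i).comp
        (Φ : MonoidAlgebra ℂ G →+* Π i, Matrix (Fin (d i)) (Fin (d i)) ℂ)).toIntAlgHom
        ((MonoidAlgebra.mapRingHom G (Int.castRingHom ℂ)).toIntAlgHom
          (∑ x with IsConj z x, (single x 1 : MonoidAlgebra ℤ G))) =
          Matrix.scalar (Fin (d i)) ω := by
        rw [← hω]
        simp
      rw [h3] at h2
      have : NeZero (d i) := hd i
      have h4 : Matrix.scalar (Fin (d i)) ω =
        algebraMap ℂ (Matrix (Fin (d i)) (Fin (d i)) ℂ) ω := by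
        rw [Matrix.scalar_apply, Matrix.algebraMap_eq_diagonal]
        rfl
      rw [h4] at h2
      exact (isIntegral_algebraMap_iff (algebraMap ℂ (Matrix (Fin (d i)) (Fin (d i)) ℂ)).injective).mp
        h2
    have htr : (q : ℂ) ^ b * (ρ i z).trace = d i * ω := by
      have h1 := congrArg Matrix.trace hω
      rw [map_sum, Finset.sum_apply, Matrix.trace_sum] at h1
      have h2 : ∀ x ∈ ({x | IsConj z x} : Finset G), (Φ (single x 1) i).trace = (ρ i z).trace := by
        intro x hx
        rw [mem_filter] at hx
        obtain ⟨c, rfl⟩ := isConj_iff.mp hx.2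
        rw [← hρ, map_mul, Matrix.trace_mul_comm, ← map_mul]
        congr 2
        group
      rw [Finset.sum_congr rfl h2, Finset.sum_const, hcard] at h1
      simpa [nsmul_eq_mul] using h1
    have hdi : (d i : ℂ) ≠ 0 := Nat.cast_ne_zero.mpr (hd i).out
    have hαint : IsIntegral ℤ ((ρ i z).trace / d i) := by
      have hcop : IsCoprime ((q : ℤ) ^ b) (d i : ℤ) := by
        apply IsCoprime.pow_left
        exact Nat.isCoprime_iff_coprime.mpr ((Nat.Prime.coprime_iff_not_dvd hq).mpr hqd)
      obtain ⟨u, v, huv⟩ := hcop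
      have huv' : (u : ℂ) * (q : ℂ) ^ b + v * d i = 1 := by
        exact_mod_cast congrArg (Int.cast : ℤ → ℂ) huv
      have : (ρ i z).trace / d i = u * ω + v * (ρ i z).trace := by
        rw [div_eq_iff hdi]
        linear_combination (-(ρ i z).trace) * huv' + u * htr
      rw [this]
      exact ((isIntegral_algebraMap (R := ℤ) (A := ℂ) (x := u)).mul hωint).add
        ((isIntegral_algebraMap (R := ℤ) (A := ℂ) (x := v)).mul (hInt i))
    rcases trace_eq_zero_or_eq_scalar hN (hd i).out _ (hpow i z) hαint with h | ⟨c, hc⟩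
    · exact h
    · exfalso
      rcases hker i with h1 | h1
      · exact hi (huniq _ _ h1 hi₀)
      · have : z ∈ Subgroup.center G := by
          rw [Subgroup.mem_center_iff]
          intro g
          have h2 : ρ i (g * z * g⁻¹ * z⁻¹) = 1 := by
            have h3 : ρ i g * ρ i z = ρ i z * ρ i g := by
              rw [hc]
              exact (Matrix.scalar_commute c (fun r' => Commute.all _ _) _).eq.symm
            rw [map_mul, map_mul, map_mul, h3, mul_assoc (ρ i z), ← map_mul (ρ i) g, mul_inv_cancel,
              map_one, mul_one, ← map_mul, mul_inv_cancel, map_one]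
          have h4 := h1 _ h2
          rw [mul_inv_eq_one, mul_inv_eq_iff_eq_mul] at h4
          exact h4
        rw [hcen] at this
        exact hz (Subgroup.mem_bot.mp this)
  have hfirst : (d i₀ : ℂ) * (ρ i₀ z).trace = 1 := by
    rw [hi₀, Matrix.trace_one, Fintype.card_fin, hdim i₀ hi₀, Nat.cast_one, one_mul]
  rw [← Finset.add_sum_erase _ _ (mem_univ i₀), hfirst] at hsum
  have hrest : ∃ t, IsIntegral ℤ t ∧ ∑ i ∈ univ.erase i₀, (d i : ℂ) * (ρ i z).trace = q * t := by
    have : ∀ i ∈ univ.erase i₀, ∃ t, IsIntegral ℤ t ∧ (d i : ℂ) * (ρ i z).trace = q * t := by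
      intro i hi
      rcases hcomp i (ne_of_mem_erase hi) with h | ⟨c, hc⟩
      · exact ⟨0, isIntegral_zero, by rw [h]; simp⟩
      · refine ⟨c * (ρ i z).trace, ?_, ?_⟩
        · exact (isIntegral_algebraMap (R := ℤ) (A := ℂ) (x := c)).mul (hInt i)
        · have : (d i : ℂ) = q * c := by rw [hc, Nat.cast_mul]
          rw [this, mul_assoc]
    choose! t ht using this
    refine ⟨∑ i ∈ univ.erase i₀, t i, IsIntegral.sum _ fun i hi => (ht i hi).1, ?_⟩
    rw [Finset.mul_sum]
    exact Finset.sum_congr rfl fun i hi => (ht i hi).2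
  obtain ⟨t, ht, ht2⟩ := hrest
  rw [ht2] at hsum
  have hq0 : (q : ℂ) ≠ 0 := Nat.cast_ne_zero.mpr hq.ne_zero
  have ht3 : t = algebraMap ℚ ℂ (-1 / q) := by
    rw [map_div₀, map_neg, map_one, map_natCast, eq_div_iff hq0]
    linear_combination hsum
  rw [ht3, isIntegral_algebraMap_iff (algebraMap ℚ ℂ).injective] at ht
  obtain ⟨y, hy⟩ := IsIntegrallyClosed.isIntegral_iff.mp ht
  have hq0' : (q : ℚ) ≠ 0 := Nat.cast_ne_zero.mpr hq.ne_zero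
  rw [eq_div_iff hq0'] at hy
  have hy' : y * q = -1 := by
    rw [eq_intCast] at hy
    exact_mod_cast hy
  have : (q : ℤ) ∣ 1 := ⟨-y, by linarith⟩
  exact hq.one_lt.ne' (by exact_mod_cast Int.eq_one_of_dvd_one (by positivity) this)

theorem center_eq_top_of_isSimpleGroup_of_two_primes {G : Type*} [Group G] [Finite G]
    [IsSimpleGroup G] {p q : ℕ} [hp : Fact p.Prime] [hq : Fact q.Prime]
    (hpq : ∀ r : ℕ, r.Prime → r ∣ Nat.card G → r = p ∨ r = q) : Subgroup.center G = ⊤ := by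
  classical
  have := Fintype.ofFinite G
  refine (inferInstance : (Subgroup.center G).Normal).eq_bot_or_eq_top.resolve_left fun hcen => ?_
  obtain ⟨P⟩ : Nonempty (Sylow p G) := inferInstance
  rcases eq_or_ne (P : Subgroup G) ⊥ with h | h
  · have hpn : ¬ p ∣ Nat.card G := by
      have := P.not_dvd_index
      rwa [h, Subgroup.index_bot] at this
    have hG : IsPGroup q G := IsPGroup.of_card
      (Nat.eq_prime_pow_of_unique_prime_dvd Nat.card_pos.ne'
        fun {d} hd hdvd => (hpq d hd hdvd).resolve_left (by rintro rfl; exact hpn hdvd))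
    have := hG.center_nontrivial
    rw [hcen] at this
    exact not_nontrivial _ this
  · have : Nontrivial P := (Subgroup.nontrivial_iff_ne_bot _).mpr h
    have := P.isPGroup'.center_nontrivial
    obtain ⟨⟨z, hz⟩, hz1⟩ := exists_ne (1 : Subgroup.center P)
    have hz0 : (z : G) ≠ 1 := by
      intro h0
      exact hz1 (Subtype.ext (Subtype.ext h0))
    have hle : (P : Subgroup G) ≤ Subgroup.centralizer {(z : G)} := by
      intro y hy
      rw [Subgroup.mem_centralizer_singleton_iff]
      exact congrArg Subtype.val (Subgroup.mem_center_iff.mp hz ⟨y, hy⟩)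
    have hdvd := Subgroup.index_dvd_of_le hle
    have hpi : ¬ p ∣ (P : Subgroup G).index := P.not_dvd_index
    have hcl : (Subgroup.centralizer {(z : G)}).index = 
        (Finset.univ.filter fun x => IsConj (z : G) x).card := by
      have h1 : (MulAction.stabilizer (ConjAct G) (z : G)).index =
          (Subgroup.centralizer {(z : G)}).index := by
        have h2 := Subgroup.index_mul_card (MulAction.stabilizer (ConjAct G) (z : G))
        have h3 := Subgroup.index_mul_card (Subgroup.centralizer {(z : G)})
        rw [Subgroup.nat_card_centralizer_nat_card_stabilizer] at h3
        exact Nat.eq_of_mul_eq_mul_right Nat.card_pos (h2.trans h3.symm)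
      rw [← h1, MulAction.index_stabilizer, Set.ncard_eq_toFinset_card']
      congr 1
      ext y
      rw [Set.mem_toFinset, ConjAct.mem_orbit_conjAct, isConj_comm, Finset.mem_filter]
      simp
    refine not_isSimpleGroup_of_card_isConj_eq_prime_pow hcen hz0 hq.out (hcl.symm.trans
      (Nat.eq_prime_pow_of_unique_prime_dvd Subgroup.index_ne_zero_of_finite
        fun {d} hd hdd => (hpq d hd (hdd.trans (Subgroup.index_dvd_card _))).resolve_left ?_))
    rintro rfl
    exact hpi (hdd.trans hdvd)

end Burnside

section PiSubgroup

variable {G G' : Type*} [Group G] [Group G'] {π : Set ℕ} {p : ℕ}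

/-- A subgroup all of whose prime divisors of the order lie in `π`. -/
def IsPiSubgroup (π : Set ℕ) (N : Subgroup G) : Prop :=
  ∀ r : ℕ, r.Prime → r ∣ Nat.card N → r ∈ π

theorem isPiSubgroup_compl_singleton (hp : p.Prime) {N : Subgroup G} :
    IsPiSubgroup {p}ᶜ N ↔ ¬ p ∣ Nat.card N := by
  constructor
  · exact fun h hd => h p hp hd rfl
  · rintro h r _ hd rfl
    exact h hd

theorem isPiSubgroup_singleton [Finite G] [hp : Fact p.Prime] {N : Subgroup G} :
    IsPiSubgroup {p} N ↔ IsPGroup p N := by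
  rw [IsPGroup.iff_card]
  constructor
  · exact fun h => ⟨_, Nat.eq_prime_pow_of_unique_prime_dvd Nat.card_pos.ne' fun hd => h _ hd⟩
  · rintro ⟨n, hn⟩ r hr hd
    rw [hn] at hd
    exact (Nat.prime_dvd_prime_iff_eq hr hp.out).mp (hr.dvd_of_dvd_pow hd)

theorem IsPiSubgroup.bot : IsPiSubgroup π (⊥ : Subgroup G) := by
  intro r hr hd
  rw [Subgroup.card_bot] at hd
  exact absurd hd hr.not_dvd_one

theorem IsPiSubgroup.mono {N K : Subgroup G} (h : IsPiSubgroup π K) (hNK : N ≤ K) :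
    IsPiSubgroup π N :=
  fun r hr hd => h r hr (hd.trans (Subgroup.card_dvd_of_le hNK))

theorem IsPiSubgroup.map {N : Subgroup G} (h : IsPiSubgroup π N) (f : G →* G') :
    IsPiSubgroup π (N.map f) :=
  fun r hr hd => h r hr (hd.trans (Subgroup.card_map_dvd N f))

theorem isPiSubgroup_map_iff {N : Subgroup G} {f : G →* G'} (hf : Function.Injective f) :
    IsPiSubgroup π (N.map f) ↔ IsPiSubgroup π N := by
  rw [IsPiSubgroup, IsPiSubgroup, Subgroup.card_map_of_injective hf]

theorem IsPiSubgroup.of_map {N : Subgroup G} {f : G →* G'} (h : IsPiSubgroup π (N.map f))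
    (hk : IsPiSubgroup π f.ker) : IsPiSubgroup π N := by
  intro r hr hd
  have h1 : Nat.card N ∣ Nat.card (N.map f) * Nat.card f.ker := by
    rw [← Subgroup.relIndex_ker, ← Subgroup.inf_relIndex_right, mul_comm]
    have h2 := Subgroup.relIndex_mul_relIndex ⊥ (f.ker ⊓ N) N bot_le inf_le_right
    rw [Subgroup.relIndex_bot_left, Subgroup.relIndex_bot_left] at h2
    rw [← h2]
    exact mul_dvd_mul_right (Subgroup.card_dvd_of_le inf_le_left) _
  rcases (hr.dvd_mul).mp (hd.trans h1) with h2 | h2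
  · exact h r hr h2
  · exact hk r hr h2

theorem IsPiSubgroup.sup {N K : Subgroup G} [K.Normal] (hN : IsPiSubgroup π N)
    (hK : IsPiSubgroup π K) : IsPiSubgroup π (N ⊔ K) := by
  refine IsPiSubgroup.of_map (f := QuotientGroup.mk' K) ?_ (by rwa [QuotientGroup.ker_mk'])
  rw [Subgroup.map_sup, (Subgroup.map_eq_bot_iff K).mpr (by simp), sup_bot_eq]
  exact hN.map _

/-- The largest normal `π`-subgroup. -/
def piCore (π : Set ℕ) (G : Type*) [Group G] : Subgroup G :=
  sSup {N | N.Normal ∧ IsPiSubgroup π N}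

theorem le_piCore {N : Subgroup G} (hN : N.Normal) (h : IsPiSubgroup π N) : N ≤ piCore π G :=
  le_sSup ⟨hN, h⟩

theorem piCore_normal_and_isPiSubgroup [Finite G] (π : Set ℕ) :
    (piCore π G).Normal ∧ IsPiSubgroup π (piCore π G) := by
  obtain ⟨N, hN⟩ := (Set.toFinite {N : Subgroup G | N.Normal ∧ IsPiSubgroup π N}).exists_maximal
    ⟨⊥, inferInstance, IsPiSubgroup.bot⟩
  have hNn : N.Normal := hN.prop.1
  have : piCore π G = N := by
    refine le_antisymm (sSup_le fun K hK => ?_) (le_sSup hN.prop)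
    have : K.Normal := hK.1
    have := hN.le_of_ge (y := K ⊔ N) ⟨Subgroup.sup_normal K N, hK.2.sup hN.prop.2⟩ le_sup_right
    exact le_sup_left.trans this
  rw [this]
  exact hN.prop

instance piCore_normal [Finite G] (π : Set ℕ) : (piCore π G).Normal :=
  (piCore_normal_and_isPiSubgroup π).1

theorem isPiSubgroup_piCore [Finite G] (π : Set ℕ) : IsPiSubgroup π (piCore π G) :=
  (piCore_normal_and_isPiSubgroup π).2

theorem piCore_quotient_eq_bot [Finite G] (π : Set ℕ) : piCore π (G ⧸ piCore π G) = ⊥ := by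
  rw [eq_bot_iff, ← Subgroup.comap_le_comap_of_surjective
    (QuotientGroup.mk'_surjective (piCore π G)),
    MonoidHom.comap_bot, QuotientGroup.ker_mk']
  refine le_piCore inferInstance (IsPiSubgroup.of_map (f := QuotientGroup.mk' (piCore π G)) ?_ ?_)
  · exact (isPiSubgroup_piCore π).mono (Subgroup.map_comap_le _ _)
  · rw [QuotientGroup.ker_mk']
    exact isPiSubgroup_piCore π

theorem sylow_normal_of_commutator_le_center [Finite G] (h : commutator G ≤ Subgroup.center G)
    {r : ℕ} [Fact r.Prime] (P : Sylow r G) : (P : Subgroup G).Normal := by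
  have hnil : Group.IsNilpotent G := Subgroup.isNilpotent_of_ker_le_center
    (Abelianization.of (G := G)) (by rwa [Abelianization.ker_of])
  have h : Group.IsNilpotent G ↔ ∀ (p : ℕ) (_ : Fact p.Prime) (P : Sylow p G),
      (P : Subgroup G).Normal := (Group.isNilpotent_of_finite_tfae (G := G)).out 0 3
  exact h.mp hnil r inferInstance P

theorem centralizer_piCore_le [Finite G] [Group.IsSolvable G] (h : piCore πᶜ G = ⊥) :
    Subgroup.centralizer (piCore π G : Set G) ≤ piCore π G := by
  by_contra hne
  obtain ⟨B, hB⟩ := (Set.toFinite {B : Subgroup G | B.Normal ∧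
    B ≤ Subgroup.centralizer (piCore π G : Set G) ∧ ¬ B ≤ piCore π G}).exists_minimal
    ⟨_, inferInstance, le_rfl, hne⟩
  obtain ⟨hBn, hBC, hBO⟩ := hB.prop
  have hB1 : B ≠ ⊥ := by rintro rfl; exact hBO bot_le
  have hlt : ⁅B, B⁆ < B := Group.IsSolvable.commutator_lt_of_ne_bot hB1
  have hcomm : ⁅B, B⁆ ≤ piCore π G := by
    by_contra hc
    exact hlt.not_ge (hB.le_of_le ⟨Subgroup.commutator_normal B B, hlt.le.trans hBC, hc⟩ hlt.le)
  have hcen : commutator B ≤ Subgroup.center B := by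
    intro x hx
    rw [Subgroup.mem_center_iff]
    intro g
    have hx' : (x : G) ∈ ⁅B, B⁆ := by
      have : (commutator B).map B.subtype = ⁅B, B⁆ := by
        rw [commutator_def, Subgroup.map_commutator, ← MonoidHom.range_eq_map,
          Subgroup.range_subtype]
      rw [← this]
      exact ⟨x, hx, rfl⟩
    exact Subtype.ext (Subgroup.mem_centralizer_iff.mp (hBC g.2) x (hcomm hx')).symm
  apply hBO
  rw [← Subgroup.relIndex_eq_one]
  by_contra hidx
  obtain ⟨r, hr, hd⟩ := Nat.exists_prime_and_dvd hidx
  have : Fact r.Prime := ⟨hr⟩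
  obtain ⟨P⟩ : Nonempty (Sylow r B) := inferInstance
  have hPn : ((P : Subgroup B).map B.subtype).Normal := by
    have := P.characteristic_of_normal (sylow_normal_of_commutator_le_center hcen P)
    exact ConjAct.normal_of_characteristic_of_normal
  have hPπ : IsPiSubgroup {r} ((P : Subgroup B).map B.subtype) :=
    (isPiSubgroup_singleton.mpr P.isPGroup').map _
  have hle : (P : Subgroup B).map B.subtype ≤ piCore π G := by
    by_cases hrπ : r ∈ π
    · exact le_piCore hPn fun s hs hd => by rw [hPπ s hs hd]; exact hrπ
    · refine (le_piCore (π := πᶜ) hPn fun s hs hd => by rw [hPπ s hs hd]; exact hrπ).trans ?_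
      rw [h]; exact bot_le
  refine P.not_dvd_index (hd.trans ?_)
  exact Subgroup.index_dvd_of_le (Subgroup.map_le_iff_le_comap.mp hle)

end PiSubgroup

section PiCoreOf

variable {G G' : Type*} [Group G] [Group G'] {π : Set ℕ} {p : ℕ}

/-- The largest normal `π`-subgroup of a subgroup. -/
def piCoreOf (π : Set ℕ) (H : Subgroup G) : Subgroup G :=
  (piCore π H).map H.subtype

theorem piCoreOf_le (π : Set ℕ) (H : Subgroup G) : piCoreOf π H ≤ H :=
  Subgroup.map_subtype_le _

theorem le_piCoreOf {N H : Subgroup G} (hN : N ≤ H) (hH : H ≤ Subgroup.normalizer (N : Set G))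
    (h : IsPiSubgroup π N) : N ≤ piCoreOf π H := by
  have h1 : N.subgroupOf H ≤ piCore π H := by
    refine le_piCore ((Subgroup.normal_subgroupOf_iff_le_normalizer hN).mpr hH) ?_
    rw [← isPiSubgroup_map_iff H.subtype_injective, Subgroup.map_subgroupOf_eq_of_le hN]
    exact h
  have := Subgroup.map_mono (f := H.subtype) h1
  rwa [Subgroup.map_subgroupOf_eq_of_le hN] at this

variable [Finite G]

theorem isPiSubgroup_piCoreOf (π : Set ℕ) (H : Subgroup G) : IsPiSubgroup π (piCoreOf π H) :=
  (isPiSubgroup_piCore π).map _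

theorem le_normalizer_piCoreOf (π : Set ℕ) (H : Subgroup G) :
    H ≤ Subgroup.normalizer (piCoreOf π H : Set G) := by
  have := Subgroup.le_normalizer_map (H := piCore π H) H.subtype
  rwa [Subgroup.normalizer_eq_top, ← MonoidHom.range_eq_map, Subgroup.range_subtype] at this

theorem map_piCoreOf [Finite G'] {f : G →* G'} (hf : Function.Injective f) (H : Subgroup G) :
    (piCoreOf π H).map f = piCoreOf π (H.map f) := by
  apply le_antisymm
  · refine le_piCoreOf (Subgroup.map_mono (piCoreOf_le π H)) ?_ ((isPiSubgroup_piCoreOf π H).map f)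
    exact (Subgroup.map_mono (le_normalizer_piCoreOf π H)).trans (Subgroup.le_normalizer_map f)
  · have h1 : piCoreOf π (H.map f) ≤ f.range := (piCoreOf_le _ _).trans (Subgroup.map_le_range f H)
    rw [← Subgroup.map_comap_eq_self h1]
    apply Subgroup.map_mono
    refine le_piCoreOf ?_ ?_ ?_
    · exact (Subgroup.comap_mono (piCoreOf_le _ _)).trans
        (Subgroup.comap_map_eq_self_of_injective hf H).le
    · intro x hx
      rw [Subgroup.mem_normalizer_iff]
      intro y
      have := Subgroup.mem_normalizer_iff.mp
        (le_normalizer_piCoreOf π (H.map f) (Subgroup.mem_map_of_mem f hx)) (f y)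
      simpa [Subgroup.mem_comap] using this
    · rw [← isPiSubgroup_map_iff hf, Subgroup.map_comap_eq_self h1]
      exact isPiSubgroup_piCoreOf _ _

theorem normalizer_le_normalizer_piCoreOf (π : Set ℕ) (H : Subgroup G) :
    Subgroup.normalizer (H : Set G) ≤ Subgroup.normalizer (piCoreOf π H : Set G) := by
  intro g hg
  rw [Subgroup.mem_normalizer_iff_map_conj_eq] at hg ⊢
  rw [map_piCoreOf (MulAut.conj g).injective, hg]

end PiCoreOf

section Coprime

variable {G : Type*} [Group G] {p : ℕ}

/-- If `φ` is an action of a `p`-group by automorphisms, `K` is an invariant subgroup of order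
prime to `p`, then a coset of `K` fixed by the action contains a fixed point. -/
theorem exists_fixed_mul_of_not_dvd_card [Fact p.Prime] {P : Type*} [Group P] (hP : IsPGroup p P)
    (φ : P →* MulAut G) {K : Subgroup G} (hK : ∀ r, ∀ k ∈ K, φ r k ∈ K)
    (hp : ¬ p ∣ Nat.card K) {g : G} (hg : ∀ r, g⁻¹ * φ r g ∈ K) :
    ∃ k ∈ K, ∀ r, φ r (g * k) = g * k := by
  let _ : MulAction P {y : G // g⁻¹ * y ∈ K} :=
    { smul := fun r y => ⟨φ r y, by
        have := K.mul_mem (hg r) (hK r _ y.2)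
        rwa [map_mul, map_inv, mul_assoc, mul_inv_cancel_left] at this⟩
      one_smul := fun y => Subtype.ext (by change φ 1 y.1 = y.1; simp)
      mul_smul := fun r s y => Subtype.ext (by change φ (r * s) y.1 = φ r (φ s y.1); simp) }
  have e : {y : G // g⁻¹ * y ∈ K} ≃ K :=
    { toFun := fun y => ⟨g⁻¹ * y, y.2⟩
      invFun := fun k => ⟨g * k, by simp⟩
      left_inv := fun y => by simp
      right_inv := fun y => by simp }
  obtain ⟨y, hy⟩ := hP.nonempty_fixed_point_of_prime_not_dvd_card {y : G // g⁻¹ * y ∈ K}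
    (by rwa [Nat.card_congr e])
  refine ⟨g⁻¹ * y, y.2, fun r => ?_⟩
  rw [mul_inv_cancel_left]
  exact congrArg Subtype.val (hy r)

theorem exists_mem_centralizer_of_not_dvd_card [Fact p.Prime] {R K : Subgroup G} (hR : IsPGroup p R)
    [K.Normal] (hp : ¬ p ∣ Nat.card K) {g : G} (hg : ∀ r ∈ R, ⁅g, r⁆ ∈ K) :
    ∃ k ∈ K, g * k ∈ Subgroup.centralizer (R : Set G) := by
  obtain ⟨k, hk, h⟩ := exists_fixed_mul_of_not_dvd_card hR ((MulAut.conj).comp R.subtype)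
    (K := K) (g := g) (fun r k hk => Subgroup.Normal.conj_mem inferInstance k hk _) hp (by
      intro r
      have := Subgroup.Normal.conj_mem (H := K) inferInstance _ (K.inv_mem (hg r r.2)) g⁻¹
      simpa [commutatorElement_def, mul_assoc] using this)
  refine ⟨k, hk, ?_⟩
  rw [Subgroup.mem_centralizer_iff]
  intro r hr
  have := h ⟨r, hr⟩
  simp only [MonoidHom.comp_apply, Subgroup.coe_subtype, MulAut.conj_apply] at this
  rw [mul_inv_eq_iff_eq_mul] at this
  exact this

/-- Two commuting elements of coprime orders are powers of their product. -/
theorem left_mem_zpowers_mul {e s : G} (h : Commute e s) (hc : (orderOf e).Coprime (orderOf s)) :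
    e ∈ Subgroup.zpowers (e * s) := by
  have h1 : (e * s) ^ orderOf s ∈ Subgroup.zpowers (e * s) :=
    Subgroup.npow_mem_zpowers _ _
  rw [h.mul_pow, pow_orderOf_eq_one, mul_one] at h1
  have h2 : Subgroup.zpowers (e ^ orderOf s) ≤ Subgroup.zpowers (e * s) := by
    rwa [Subgroup.zpowers_le]
  exact h2 ((mem_zpowers_pow_iff (g := e)).mpr hc.symm)

theorem right_mem_zpowers_mul {e s : G} (h : Commute e s) (hc : (orderOf e).Coprime (orderOf s)) :
    s ∈ Subgroup.zpowers (e * s) := by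
  rw [h.eq]
  exact left_mem_zpowers_mul h.symm hc.symm

theorem orderOf_mul_dvd_of_mem_normalizer [Finite G] {N : Subgroup G} {g w : G} (hg : g ∈ N)
    (hw : w ∈ Subgroup.normalizer (N : Set G)) : orderOf (g * w) ∣ orderOf w * Nat.card N := by
  have h1 : ∀ m : ℕ, (g * w) ^ m * (w ^ m)⁻¹ ∈ N := by
    intro m
    induction m with
    | zero => simp
    | succ m ih =>
      have h2 := N.mul_mem hg ((Subgroup.mem_normalizer_iff.mp hw _).mp ih)
      convert h2 using 1
      rw [pow_succ' (g * w), pow_succ' w]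
      group
  rw [orderOf_dvd_iff_pow_eq_one, pow_mul]
  have h2 := h1 (orderOf w)
  rw [pow_orderOf_eq_one, inv_one, mul_one] at h2
  have h3 := pow_card_eq_one' (x := (⟨_, h2⟩ : N))
  exact congrArg Subtype.val h3

/-- In a finite simple group of order divisible by `p`, an element which, for each `w`, lies in a
subgroup of order prime to `p` normalised by `w` is trivial. -/
theorem eq_one_of_forall_exists_mem_normalizer [Finite G] [IsSimpleGroup G] [hp : Fact p.Prime]
    (hpG : p ∣ Nat.card G) {g : G} (hg : ∀ w : G, ∃ N : Subgroup G, g ∈ N ∧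
      w ∈ Subgroup.normalizer (N : Set G) ∧ ¬ p ∣ Nat.card N) : g = 1 := by
  let S : Subgroup G :=
    { carrier := {g | ∀ w, p ∣ orderOf (g * w) ↔ p ∣ orderOf w}
      one_mem' := fun w => by rw [one_mul]
      mul_mem' := fun {a b} ha hb w => by rw [mul_assoc, ha, hb]
      inv_mem' := fun {a} ha w => by rw [← ha (a⁻¹ * w), mul_inv_cancel_left] }
  have hconj : ∀ a b : G, orderOf (b * a * b⁻¹) = orderOf a := fun a b =>
    orderOf_injective (MulAut.conj b).toMonoidHom (MulAut.conj b).injective a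
  have hS : S.Normal := ⟨fun a ha k w => by
    have h1 := ha (k⁻¹ * w * k)
    rw [← hconj _ k, ← hconj (k⁻¹ * w * k) k] at h1
    simpa [mul_assoc] using h1⟩
  have hgS : g ∈ S := by
    intro w
    obtain ⟨N, hgN, hw, hpN⟩ := hg w
    constructor
    · intro h
      exact ((hp.out.dvd_mul).mp (h.trans (orderOf_mul_dvd_of_mem_normalizer hgN hw))).resolve_right
        hpN
    · intro h
      have h2 := orderOf_mul_dvd_of_mem_normalizer (N.inv_mem hgN) (w := g * w)
        (Subgroup.mul_mem _ (Subgroup.le_normalizer hgN) hw)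
      rw [inv_mul_cancel_left] at h2
      exact ((hp.out.dvd_mul).mp (h.trans h2)).resolve_right hpN
  rcases hS.eq_bot_or_eq_top with h | h
  · rwa [h, Subgroup.mem_bot] at hgS
  · obtain ⟨w, hw⟩ := exists_prime_orderOf_dvd_card' p hpG
    have h1 : w⁻¹ ∈ S := by rw [h]; trivial
    have h2 := (h1 w).mpr (by rw [hw])
    rw [inv_mul_cancel, orderOf_one] at h2
    exact absurd h2 hp.out.not_dvd_one

end Coprime

section CentralizerCore

variable {G : Type*} [Group G] {p : ℕ}

theorem disjoint_of_isPGroup_of_not_dvd [Finite G] [hp : Fact p.Prime] {R B : Subgroup G}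
    (hR : IsPGroup p R) (hB : ¬ p ∣ Nat.card B) : Disjoint R B := by
  apply Subgroup.disjoint_of_coprime_natCard
  obtain ⟨n, hn⟩ := IsPGroup.iff_card.mp hR
  rw [hn]
  exact Nat.Coprime.pow_left n ((Nat.Prime.coprime_iff_not_dvd hp.out).mpr hB)

/-- A nontrivial subgroup `U` of a nilpotent group `T` is not contained in `⁅U, T⁆`. -/
theorem eq_bot_of_le_commutator {U T : Subgroup G} (hT : Group.IsNilpotent T) (hUT : U ≤ T)
    (h : U ≤ ⁅U, T⁆) : U = ⊥ := by
  obtain ⟨n, hn⟩ := (Subgroup.isNilpotent_iff_lowerCentralSeries T).mp hT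
  have key : ∀ n, U ≤ T.lowerCentralSeries n := by
    intro n
    induction n with
    | zero => exact hUT
    | succ n ih => exact h.trans (Subgroup.commutator_mono ih le_rfl)
  exact eq_bot_iff.mpr (hn ▸ key n)

theorem le_normalizer_commutator {K H₁ H₂ : Subgroup G}
    (h1 : K ≤ Subgroup.normalizer (H₁ : Set G)) (h2 : K ≤ Subgroup.normalizer (H₂ : Set G)) :
    K ≤ Subgroup.normalizer ((⁅H₁, H₂⁆ : Subgroup G) : Set G) := by
  intro k hk
  have e1 := Subgroup.mem_normalizer_iff_map_conj_eq.mp (h1 hk)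
  have e2 := Subgroup.mem_normalizer_iff_map_conj_eq.mp (h2 hk)
  rw [Subgroup.mem_normalizer_iff_map_conj_eq, Subgroup.map_commutator, e1, e2]

theorem commutator_le_of_le_normalizer {K H : Subgroup G}
    (h : K ≤ Subgroup.normalizer (H : Set G)) : ⁅H, K⁆ ≤ H := by
  rw [Subgroup.commutator_le]
  intro a ha b hb
  rw [commutatorElement_def, mul_assoc, mul_assoc]
  refine H.mul_mem ha ?_
  rw [← mul_assoc]
  exact (Subgroup.mem_normalizer_iff.mp (h hb) _).mp (H.inv_mem ha)

theorem conj_pow_eq_of_commute {b u c : G} (h : b * u * b⁻¹ = c * u) (hc : Commute b c) (n : ℕ) :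
    b ^ n * u * (b ^ n)⁻¹ = c ^ n * u := by
  induction n with
  | zero => simp
  | succ n ih =>
    calc b ^ (n + 1) * u * (b ^ (n + 1))⁻¹ = b * (b ^ n * u * (b ^ n)⁻¹) * b⁻¹ := by
          rw [pow_succ']; group
      _ = (b * c ^ n) * u * b⁻¹ := by rw [ih]; group
      _ = c ^ n * (b * u * b⁻¹) := by rw [(hc.pow_right n).eq]; group
      _ = c ^ (n + 1) * u := by rw [h, pow_succ]; group

/-- **Thompson's `A × B` lemma**. -/
theorem le_centralizer_of_centralizer_inf_le [Finite G] [hp : Fact p.Prime]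
    {R B U : Subgroup G} (hR : IsPGroup p R) (hB : ¬ p ∣ Nat.card B)
    (hBR : B ≤ Subgroup.centralizer (R : Set G)) (hU : IsPGroup p U)
    (hcen : ∀ u ∈ U, u ∈ Subgroup.centralizer (R : Set G) → ∀ b ∈ B, Commute b u)
    (hRU : R ≤ Subgroup.normalizer (U : Set G)) (hBU : B ≤ Subgroup.normalizer (U : Set G)) :
    B ≤ Subgroup.centralizer (U : Set G) := by
  induction hn : Nat.card U using Nat.strong_induction_on generalizing U with
  | _ n ih =>
  by_cases hU1 : U = ⊥
  · subst hU1
    intro b _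
    rw [Subgroup.mem_centralizer_iff]
    rintro u hu
    rw [SetLike.mem_coe, Subgroup.mem_bot] at hu
    simp [hu]
  have hWU : ⁅U, R⁆ ≤ U := commutator_le_of_le_normalizer hRU
  have hT : IsPGroup p (R ⊔ U : Subgroup G) := IsPGroup.to_sup_of_normal_right' hR hU hRU
  have hlt : ⁅U, R⁆ < U := by
    refine lt_of_le_of_ne hWU fun he => hU1 ?_
    refine eq_bot_of_le_commutator hT.isNilpotent (le_sup_right (a := R)) ?_
    calc U = ⁅U, R⁆ := he.symm
      _ ≤ _ := Subgroup.commutator_mono le_rfl le_sup_left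
  have hBnR : B ≤ Subgroup.normalizer (R : Set G) :=
    hBR.trans (Subgroup.centralizer_le_normalizer _)
  have hBW : B ≤ Subgroup.centralizer ((⁅U, R⁆ : Subgroup G) : Set G) := by
    refine ih _ ?_ (hU.to_le hWU) (fun u hu => hcen u (hWU hu)) ?_ ?_ rfl
    · rw [← hn]
      exact Set.ncard_lt_ncard hlt
    · exact le_normalizer_commutator hRU Subgroup.le_normalizer
    · exact le_normalizer_commutator hBU hBnR
  have h3 : ⁅⁅B, U⁆, R⁆ = ⊥ := by
    apply Subgroup.commutator_commutator_eq_bot_of_rotate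
    · rw [Subgroup.commutator_comm, Subgroup.commutator_eq_bot_iff_le_centralizer]
      exact hBW
    · rw [Subgroup.commutator_comm R B, Subgroup.commutator_eq_bot_iff_le_centralizer.mpr hBR,
        Subgroup.commutator_bot_left]
  rw [Subgroup.commutator_eq_bot_iff_le_centralizer] at h3
  intro b hb
  rw [Subgroup.mem_centralizer_iff]
  intro u hu
  have hc := h3 (Subgroup.commutator_mem_commutator hb hu)
  have hcU : ⁅b, u⁆ ∈ U := by
    rw [commutatorElement_def]
    exact U.mul_mem ((Subgroup.mem_normalizer_iff.mp (hBU hb) _).mp hu) (U.inv_mem hu)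
  have hcomm := hcen _ hcU hc b hb
  have h4 := conj_pow_eq_of_commute (c := ⁅b, u⁆) (u := u)
    (by rw [commutatorElement_def]; group) hcomm (orderOf b)
  rw [pow_orderOf_eq_one, one_mul, inv_one, mul_one, eq_comm, mul_eq_right] at h4
  have hc1 : ⁅b, u⁆ = 1 := by
    by_contra hne
    have h5 : p ∣ orderOf (⟨_, hcU⟩ : U) := hU.dvd_orderOf fun h => hne (congrArg Subtype.val h)
    rw [Subgroup.orderOf_mk] at h5
    exact hB ((h5.trans (orderOf_dvd_of_pow_eq_one h4)).trans (Subgroup.orderOf_dvd_natCard B hb))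
  exact (commutatorElement_eq_one_iff_mul_comm.mp hc1).symm

/-- If `B` is a `p'`-subgroup centralising a `p`-subgroup `R` and normalised by `C(R)` in a finite
solvable group, then `B` lies in the largest normal `p'`-subgroup. -/
theorem le_piCore_of_le_centralizer [Finite G] [Group.IsSolvable G] [hp : Fact p.Prime]
    {R B : Subgroup G} (hR : IsPGroup p R) (hB : ¬ p ∣ Nat.card B)
    (hBR : B ≤ Subgroup.centralizer (R : Set G))
    (hRB : Subgroup.centralizer (R : Set G) ≤ Subgroup.normalizer (B : Set G)) :
    B ≤ piCore {p}ᶜ G := by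
  wlog hcore : piCore {p}ᶜ G = ⊥ generalizing G
  · set K := piCore {p}ᶜ G with hK
    have hpK : ¬ p ∣ Nat.card K :=
      (isPiSubgroup_compl_singleton hp.out).mp (isPiSubgroup_piCore _)
    have hsolv : Group.IsSolvable (G ⧸ K) := inferInstance
    have hq := this (G := G ⧸ K) (R := R.map (QuotientGroup.mk' K))
      (B := B.map (QuotientGroup.mk' K))
      (hR.map _) (fun h => hB (h.trans (Subgroup.card_map_dvd B _))) ?_ ?_
      (piCore_quotient_eq_bot _)
    · rw [piCore_quotient_eq_bot, le_bot_iff, Subgroup.map_eq_bot_iff, QuotientGroup.ker_mk'] at hq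
      exact hq
    · exact (Subgroup.map_mono hBR).trans (Subgroup.map_centralizer_le_centralizer_image _ _)
    · intro x hx
      obtain ⟨g, rfl⟩ := QuotientGroup.mk'_surjective K x
      obtain ⟨k, hk, h⟩ := exists_mem_centralizer_of_not_dvd_card hR hpK (g := g) (by
        intro r hr
        have h1 := Subgroup.mem_centralizer_iff.mp hx _ (Subgroup.mem_map_of_mem _ hr)
        have h2 := commutatorElement_eq_one_iff_mul_comm.mpr h1.symm
        rw [← map_commutatorElement, ← MonoidHom.mem_ker, QuotientGroup.ker_mk'] at h2
        exact h2)
      have h3 : QuotientGroup.mk' K g = QuotientGroup.mk' K (g * k) := by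
        rw [map_mul, (by simpa using hk : QuotientGroup.mk' K k = 1), mul_one]
      rw [h3]
      exact Subgroup.le_normalizer_map _ (Subgroup.mem_map_of_mem _ (hRB h))
  · rw [hcore]
    have hU : IsPGroup p (piCore {p} G) := isPiSubgroup_singleton.mp (isPiSubgroup_piCore _)
    have hUn : ∀ H : Subgroup G, H ≤ Subgroup.normalizer (piCore {p} G : Set G) := fun H => by
      rw [Subgroup.normalizer_eq_top]; exact le_top
    have h1 := le_centralizer_of_centralizer_inf_le hR hB hBR hU (fun u hu huR b hb => by
      have h2 : ⁅b, u⁆ ∈ (⊥ : Subgroup G) := by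
        rw [← (disjoint_of_isPGroup_of_not_dvd hU hB).eq_bot, commutatorElement_def]
        refine ⟨?_, ?_⟩
        · exact Subgroup.mul_mem _ (Subgroup.Normal.conj_mem inferInstance u hu b)
            (Subgroup.inv_mem _ hu)
        · rw [mul_assoc, mul_assoc, ← mul_assoc u]
          exact B.mul_mem hb ((Subgroup.mem_normalizer_iff.mp (hRB huR) _).mp (B.inv_mem hb))
      exact commutatorElement_eq_one_iff_commute.mp h2) (hUn R) (hUn B)
    exact ((disjoint_of_isPGroup_of_not_dvd hU hB).eq_bot_of_ge
      (h1.trans (centralizer_piCore_le hcore))).le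

end CentralizerCore

section TwoGenerated

variable {G : Type*} [Group G] [Finite G] {p : ℕ} [hp : Fact p.Prime]

theorem eq_bot_of_centralizer_le_normalizer [IsSimpleGroup G]
    (hsol : ∀ a b : G, Group.IsSolvable (Subgroup.closure ({a, b} : Set G)))
    (hpG : p ∣ Nat.card G) {B : Subgroup G} {e : G} (he : IsPGroup p (Subgroup.zpowers e))
    (hB : ¬ p ∣ Nat.card B) (hBe : B ≤ Subgroup.centralizer {e})
    (hRB : Subgroup.centralizer {e} ≤ Subgroup.normalizer (B : Set G)) : B = ⊥ := by
  rw [eq_bot_iff]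
  intro s hs
  rw [Subgroup.mem_bot]
  have hcomm : Commute e s := Subgroup.mem_centralizer_iff.mp (hBe hs) e rfl
  have hco : (orderOf e).Coprime (orderOf s) := by
    obtain ⟨n, hn⟩ := IsPGroup.iff_card.mp he
    rw [← Nat.card_zpowers, hn]
    exact Nat.Coprime.pow_left n ((Nat.Prime.coprime_iff_not_dvd hp.out).mpr fun h =>
      hB (h.trans (Subgroup.orderOf_dvd_natCard B hs)))
  refine eq_one_of_forall_exists_mem_normalizer hpG fun w => ?_
  set L := Subgroup.closure ({e * s, w} : Set G) with hL
  have := hsol (e * s) w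
  have h1 : Subgroup.zpowers (e * s) ≤ L := by
    rw [Subgroup.zpowers_le]
    exact Subgroup.subset_closure (by simp)
  have heL : e ∈ L := h1 (left_mem_zpowers_mul hcomm hco)
  have hsL : s ∈ L := h1 (right_mem_zpowers_mul hcomm hco)
  have hwL : w ∈ L := Subgroup.subset_closure (by simp)
  have key := le_piCore_of_le_centralizer (G := L) (p := p) (R := (Subgroup.zpowers e).subgroupOf L)
    (B := B.subgroupOf L) he.comap_subtype
    (fun h => hB (h.trans (Subgroup.card_comap_dvd_of_injective B L.subtype L.subtype_injective)))
    ?_ ?_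
  · have hs' : (⟨s, hsL⟩ : L) ∈ piCore {p}ᶜ L := key hs
    refine ⟨piCoreOf {p}ᶜ L, Subgroup.mem_map_of_mem L.subtype hs',
      le_normalizer_piCoreOf _ L hwL,
      (isPiSubgroup_compl_singleton hp.out).mp (isPiSubgroup_piCoreOf _ _)⟩
  · intro b hb
    rw [Subgroup.mem_centralizer_iff]
    rintro r hr
    obtain ⟨n, hn⟩ := Subgroup.mem_zpowers_iff.mp (Subgroup.mem_subgroupOf.mp hr)
    have h2 : Commute e b := Subgroup.mem_centralizer_iff.mp (hBe hb) e rfl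
    refine Subtype.ext ?_
    rw [Subgroup.coe_mul, Subgroup.coe_mul, ← hn]
    exact (h2.zpow_left n).eq
  · intro c hc
    have h2 : (c : G) ∈ Subgroup.centralizer {e} := by
      rw [Subgroup.mem_centralizer_singleton_iff]
      exact (congrArg Subtype.val (Subgroup.mem_centralizer_iff.mp hc ⟨e, heL⟩
        (Subgroup.mem_zpowers e))).symm
    rw [Subgroup.mem_normalizer_iff]
    intro x
    exact Subgroup.mem_normalizer_iff.mp (hRB h2) x

theorem eq_bot_of_normalizer_le_normalizer [IsSimpleGroup G]
    (hsol : ∀ a b : G, Group.IsSolvable (Subgroup.closure ({a, b} : Set G)))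
    (hproper : ∀ H : Subgroup G, H ≠ ⊤ → Group.IsSolvable H) (hG : ¬ Group.IsSolvable G)
    (hpG : p ∣ Nat.card G) {R N : Subgroup G} (hR : IsPGroup p R) (hR1 : R ≠ ⊥)
    (hN : ¬ p ∣ Nat.card N) (hNR : N ≤ Subgroup.normalizer (R : Set G))
    (hRN : Subgroup.normalizer (R : Set G) ≤ Subgroup.normalizer (N : Set G)) : N = ⊥ := by
  have hcR : N ≤ Subgroup.centralizer (R : Set G) := by
    rw [← Subgroup.commutator_eq_bot_iff_le_centralizer, eq_bot_iff,
      ← (disjoint_of_isPGroup_of_not_dvd hR hN).eq_bot, Subgroup.commutator_comm]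
    refine le_inf (commutator_le_of_le_normalizer hNR) ?_
    rw [Subgroup.commutator_comm]
    exact commutator_le_of_le_normalizer (Subgroup.le_normalizer.trans hRN)
  have : Nontrivial R := (Subgroup.nontrivial_iff_ne_bot R).mpr hR1
  obtain ⟨⟨e, he⟩, he1⟩ := (Subgroup.nontrivial_iff_exists_ne_one _).mp hR.center_nontrivial
  obtain ⟨hez, he1⟩ := he1
  have he1' : e ≠ 1 := fun h => he1 (Subtype.ext h)
  have hecomm : ∀ r ∈ R, Commute r e := fun r hr =>
    congrArg Subtype.val (Subgroup.mem_center_iff.mp hez ⟨r, hr⟩)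
  have heR : IsPGroup p (Subgroup.zpowers e) := hR.to_le (by rwa [Subgroup.zpowers_le])
  set X := Subgroup.centralizer ({e} : Set G) with hX
  have hXtop : X ≠ ⊤ := by
    intro h
    have hec : e ∈ Subgroup.center G := by
      rw [Subgroup.mem_center_iff]
      intro g
      have : g ∈ X := by rw [h]; trivial
      exact (Subgroup.mem_centralizer_singleton_iff.mp this)
    rcases (inferInstance : (Subgroup.center G).Normal).eq_bot_or_eq_top with h' | h'
    · rw [h', Subgroup.mem_bot] at hec
      exact he1' hec
    · exact hG (Group.isSolvable_of_comm fun a b => by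
        have : b ∈ Subgroup.center G := by rw [h']; trivial
        exact Subgroup.mem_center_iff.mp this a)
  have hXs := hproper X hXtop
  have hRX : R ≤ X := fun r hr => Subgroup.mem_centralizer_singleton_iff.mpr (hecomm r hr).eq
  have hcen : Subgroup.centralizer (R : Set G) ≤ X :=
    Subgroup.centralizer_le (Set.singleton_subset_iff.mpr he)
  have hB : piCoreOf {p}ᶜ X = ⊥ := eq_bot_of_centralizer_le_normalizer hsol hpG heR
    ((isPiSubgroup_compl_singleton hp.out).mp (isPiSubgroup_piCoreOf _ _)) (piCoreOf_le _ _)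
    (le_normalizer_piCoreOf _ _)
  have key := le_piCore_of_le_centralizer (G := X) (p := p) (R := R.subgroupOf X)
    (B := N.subgroupOf X) hR.comap_subtype
    (fun h => hN (h.trans (Subgroup.card_comap_dvd_of_injective N X.subtype X.subtype_injective)))
    (fun b hb => Subgroup.mem_centralizer_iff.mpr fun r hr =>
      Subtype.ext (Subgroup.mem_centralizer_iff.mp (hcR hb) r hr))
    (fun c hc => by
      have h2 : (c : G) ∈ Subgroup.centralizer (R : Set G) :=
        Subgroup.mem_centralizer_iff.mpr fun r hr =>
          congrArg Subtype.val (Subgroup.mem_centralizer_iff.mp hc ⟨r, hRX hr⟩ hr)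
      rw [Subgroup.mem_normalizer_iff]
      intro x
      exact Subgroup.mem_normalizer_iff.mp
        (hRN (Subgroup.centralizer_le_normalizer _ h2)) x)
  have h3 := Subgroup.map_mono (f := X.subtype) key
  rw [Subgroup.map_subgroupOf_eq_of_le (hcR.trans hcen)] at h3
  exact eq_bot_iff.mpr (h3.trans hB.le)

end TwoGenerated

section EndAction

variable {Y V : Type*} [Group Y] [Group V]

/-- The action on an invariant subgroup. -/
def endRestrict (φ : Y →* Monoid.End V) (W : Subgroup V) (hW : ∀ y, W ≤ W.comap (φ y)) :
    Y →* Monoid.End W where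
  toFun y := ((φ y).comp W.subtype).codRestrict W fun w => hW y w.2
  map_one' := MonoidHom.ext fun w => Subtype.ext (by change φ 1 w.1 = w.1; rw [map_one]; rfl)
  map_mul' a b := MonoidHom.ext fun w =>
    Subtype.ext (by change φ (a * b) w.1 = φ a (φ b w.1); rw [map_mul]; rfl)

/-- The action on the quotient by an invariant normal subgroup. -/
def endQuotient (φ : Y →* Monoid.End V) (W : Subgroup V) [W.Normal] (hW : ∀ y, W ≤ W.comap (φ y)) :
    Y →* Monoid.End (V ⧸ W) where
  toFun y := QuotientGroup.map W W (φ y) (hW y)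
  map_one' := QuotientGroup.monoidHom_ext W (MonoidHom.ext fun w => by
    change (QuotientGroup.mk (φ 1 w) : V ⧸ W) = QuotientGroup.mk w
    rw [map_one]; rfl)
  map_mul' a b := QuotientGroup.monoidHom_ext W (MonoidHom.ext fun w => by
    change (QuotientGroup.mk (φ (a * b) w) : V ⧸ W) = QuotientGroup.mk (φ a (φ b w))
    rw [map_mul]; rfl)

end EndAction

section QuadraticAction

variable {p : ℕ} [hp : Fact p.Prime]

theorem exists_pow_eq_one_of_sub_one_pow_eq_zero {A : Type*} [Ring A] [Algebra (ZMod p) A] {a : A}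
    {N : ℕ} (h : (a - 1) ^ N = 0) : ∃ k, a ^ p ^ k = 1 := by
  refine ⟨N, ?_⟩
  have h1 : (a - 1) ^ p ^ N = 0 := pow_eq_zero_of_le (Nat.lt_pow_self hp.out.one_lt).le h
  have h2 : (Polynomial.X - 1 : Polynomial (ZMod p)) ^ p ^ N = Polynomial.X ^ p ^ N - 1 := by
    rw [sub_pow_char_pow, one_pow]
  have h3 := congrArg (Polynomial.aeval a) h2
  simp only [map_pow, map_sub, Polynomial.aeval_X, map_one, h1] at h3
  exact (sub_eq_zero.mp h3.symm)

theorem Representation.exists_pow_eq_one_of_closure_quadratic (hp5 : 5 ≤ p) {Y : Type*} [Group Y]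
    [Group.IsSolvable Y] {X : Set Y} (hX : Subgroup.closure X = ⊤) {V : Type*} [AddCommGroup V]
    [Module (ZMod p) V] [Finite V] (ρ : Representation (ZMod p) Y V)
    (hq : ∀ x ∈ X, (ρ x - 1) ^ 2 = 0) (y : Y) : ∃ k, ρ y ^ p ^ k = 1 := by
  let F := AlgebraicClosure (ZMod p)
  let b := Module.End.baseChangeHom (ZMod p) F V
  have hb : Function.Injective b :=
    LinearMap.baseChangeHom_injective (R := ZMod p) (M := V) (S := F)
  have : CharP F p := inferInstance
  obtain ⟨N, hN⟩ := exists_sub_one_pow_eq_zero_of_closure_quadratic (k := F) p hp5 X hX _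
    ((b : Module.End (ZMod p) V →* Module.End F (TensorProduct (ZMod p) F V)).comp ρ) le_rfl
    (fun x hx => by
      change (b (ρ x) - 1) ^ 2 = 0
      have h1 : b (ρ x - 1) = b (ρ x) - 1 := by rw [map_sub, map_one]
      rw [← h1, ← map_pow, hq x hx, map_zero]) y
  refine exists_pow_eq_one_of_sub_one_pow_eq_zero (N := N) (hb ?_)
  rw [map_pow, map_sub, map_one, map_zero]
  exact hN

theorem MonoidHom.exists_pow_eq_one_of_closure_quadratic_of_comm (hp5 : 5 ≤ p) {Y : Type*} [Group Y]
    [Group.IsSolvable Y] {X : Set Y} (hX : Subgroup.closure X = ⊤) {V : Type*} [CommGroup V]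
    [Finite V] (hV : ∀ v : V, v ^ p = 1) (φ : Y →* Monoid.End V)
    (hq : ∀ x ∈ X, ∀ v, φ x (v⁻¹ * φ x v) = v⁻¹ * φ x v) (y : Y) : ∃ k, φ y ^ p ^ k = 1 := by
  let _ : Module (ZMod p) (Additive V) := AddCommGroup.zmodModule (n := p) fun v => hV v.toMul
  let ρ : Representation (ZMod p) Y (Additive V) :=
    { toFun := fun y => (MonoidHom.toAdditive (φ y)).toZModLinearMap p
      map_one' := by rw [map_one]; rfl
      map_mul' := fun a b => by rw [map_mul]; rfl }
  obtain ⟨k, hk⟩ := Representation.exists_pow_eq_one_of_closure_quadratic hp5 hX ρ (fun x hx => by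
    refine LinearMap.ext fun v => ?_
    have h := hq x hx v.toMul
    have h2 : ρ x (-v + ρ x v) = -v + ρ x v := congrArg Additive.ofMul h
    have h3 : ρ x (-v) = -ρ x v := _root_.map_neg (ρ x) v
    rw [map_add, h3] at h2
    rw [pow_two, Module.End.mul_apply]
    simp only [LinearMap.sub_apply, Module.End.one_apply, map_sub, LinearMap.zero_apply]
    rw [neg_add_eq_sub, neg_add_eq_sub] at h2
    rw [h2, sub_self]) y
  refine ⟨k, ?_⟩
  rw [← map_pow] at hk ⊢
  ext v
  exact congrArg Additive.toMul (LinearMap.congr_fun hk (Additive.ofMul v))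

/-- A finite solvable group acting on a finite `p`-group, `p ≥ 5`, and generated by elements acting
quadratically acts as a `p`-group. -/
theorem MonoidHom.exists_pow_eq_one_of_closure_quadratic (hp5 : 5 ≤ p) {Y : Type*} [Group Y]
    [Group.IsSolvable Y] {X : Set Y} (hX : Subgroup.closure X = ⊤) {V : Type*} [Group V]
    [Finite V] (hV : IsPGroup p V) (φ : Y →* Monoid.End V)
    (hq : ∀ x ∈ X, ∀ v, φ x (v⁻¹ * φ x v) = v⁻¹ * φ x v) (y : Y) : ∃ k, φ y ^ p ^ k = 1 := by
  induction hn : Nat.card V using Nat.strong_induction_on generalizing V with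
  | _ n ih =>
  by_cases hW : ∃ W : Subgroup V, W.Normal ∧ W ≠ ⊥ ∧ W ≠ ⊤ ∧ ∀ f : V →* V, W ≤ W.comap f
  · obtain ⟨W, hWn, hW1, hW2, hWf⟩ := hW
    let φW := endRestrict φ W fun y => hWf (φ y)
    let φQ := endQuotient φ W fun y => hWf (φ y)
    obtain ⟨a, ha⟩ := ih (Nat.card W) (by
      rw [← hn]
      exact lt_of_le_of_ne (Subgroup.card_le_card_group W) fun h => hW2
        (Subgroup.card_eq_iff_eq_top W |>.mp h))
      (hV.to_subgroup W) φW (fun x hx v => Subtype.ext (hq x hx v)) rfl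
    obtain ⟨b, hb⟩ := ih (Nat.card (V ⧸ W)) (by
      rw [← hn, W.card_eq_card_quotient_mul_card_subgroup]
      exact lt_mul_of_one_lt_right Nat.card_pos
        (Subgroup.one_lt_card_iff_ne_bot W |>.mpr hW1))
      (hV.to_quotient W) φQ (fun x hx v => by
        obtain ⟨v, rfl⟩ := QuotientGroup.mk_surjective v
        exact congrArg (QuotientGroup.mk (s := W)) (hq x hx v)) rfl
    obtain ⟨c, hc⟩ := IsPGroup.iff_card.mp (hV.to_subgroup W)
    refine ⟨a + b + c, ?_⟩
    set f := φ y ^ p ^ (a + b) with hf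
    have hfW : ∀ w ∈ W, f w = w := by
      intro w hw
      have h1 : φW (y ^ p ^ (a + b)) = 1 := by
        rw [map_pow, pow_add, pow_mul, ha, one_pow]
      have h2 := congrArg Subtype.val (DFunLike.congr_fun h1 (⟨w, hw⟩ : W))
      rw [hf, ← map_pow]
      exact h2
    have hfQ : ∀ v, v⁻¹ * f v ∈ W := by
      intro v
      have h1 : φQ (y ^ p ^ (a + b)) = 1 := by
        rw [map_pow, add_comm, pow_add, pow_mul, hb, one_pow]
      have h2 := DFunLike.congr_fun h1 (QuotientGroup.mk v : V ⧸ W)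
      rw [hf, ← map_pow]
      exact QuotientGroup.eq.mp h2.symm
    have hfm : ∀ (m : ℕ) v, (f ^ m) v = v * (v⁻¹ * f v) ^ m := by
      intro m v
      induction m with
      | zero => simp
      | succ m ihm =>
        rw [pow_succ', Monoid.End.coe_mul, Function.comp_apply, ihm, map_mul,
          hfW _ (W.pow_mem (hfQ v) m), pow_succ', ← mul_assoc, mul_inv_cancel_left]
    rw [pow_add, pow_mul, ← hf]
    refine MonoidHom.ext fun v => ?_
    refine (hfm (p ^ c) v).trans ?_
    rw [← hc]
    have h3 := pow_card_eq_one' (x := (⟨_, hfQ v⟩ : W))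
    have h4 : (v⁻¹ * f v) ^ Nat.card W = 1 := congrArg Subtype.val h3
    rw [h4, mul_one]
    rfl
  · push Not at hW
    rcases subsingleton_or_nontrivial V with hs | hnt
    · exact ⟨0, by ext v; exact Subsingleton.elim _ _⟩
    have hsol : Group.IsSolvable V := by
      have := hV.isNilpotent
      infer_instance
    have hcomm : ∀ a b : V, a * b = b * a := by
      have h1 : commutator V = ⊥ := by
        by_contra hne
        obtain ⟨f, hf⟩ := hW (commutator V) inferInstance hne
          (Group.IsSolvable.commutator_lt_top_of_nontrivial V).ne
        rw [← Subgroup.map_le_iff_le_comap, commutator_def, Subgroup.map_commutator] at hf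
        exact hf (Subgroup.commutator_mono le_top le_top)
      intro a b
      rw [← commutatorElement_eq_one_iff_mul_comm, ← Subgroup.mem_bot, ← h1]
      exact Subgroup.commutator_mem_commutator trivial trivial
    let _ : CommGroup V := { ‹Group V› with mul_comm := hcomm }
    refine MonoidHom.exists_pow_eq_one_of_closure_quadratic_of_comm hp5 hX ?_ φ hq y
    have h1 : (powMonoidHom p : V →* V).range = ⊥ := by
      by_contra hne
      obtain ⟨f, hf⟩ := hW (powMonoidHom p : V →* V).range inferInstance hne (by
        intro h
        have hinj := Finite.injective_iff_surjective.mpr (MonoidHom.range_eq_top.mp h)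
        obtain ⟨v, hv⟩ := exists_prime_orderOf_dvd_card' (G := V) p
          ((hV.card_eq_or_dvd).resolve_left (Finite.one_lt_card (α := V)).ne')
        have h2 : v = 1 := hinj (by
          simp only [powMonoidHom_apply, one_pow]
          rw [← hv, pow_orderOf_eq_one])
        rw [h2, orderOf_one] at hv
        exact hp.out.one_lt.ne hv)
      apply hf
      rintro _ ⟨v, rfl⟩
      exact ⟨f v, (map_pow f v p).symm⟩
    intro v
    have h2 : v ^ p ∈ (powMonoidHom p : V →* V).range := ⟨v, rfl⟩
    rwa [h1, Subgroup.mem_bot] at h2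

end QuadraticAction

section Dstar

variable {G G' : Type*} [Group G] [Group G'] {p : ℕ}

/-- The normal abelian subgroups `D` of `S` on which no element of `S` acts quadratically and
nontrivially. -/
structure IsDstarMem (S D : Subgroup G) : Prop where
  le : D ≤ S
  le_normalizer : S ≤ Subgroup.normalizer (D : Set G)
  comm : D ≤ Subgroup.centralizer (D : Set G)
  quadratic : ∀ x ∈ S, (∀ d ∈ D, Commute ⁅d, x⁆ x) → ∀ d ∈ D, Commute d x

theorem commutatorElement_mem_of_mem_normalizer {D : Subgroup G} {d x : G} (hd : d ∈ D)
    (hx : x ∈ Subgroup.normalizer (D : Set G)) : ⁅d, x⁆ ∈ D := by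
  rw [commutatorElement_def, mul_assoc, mul_assoc, ← mul_assoc x]
  exact D.mul_mem hd ((Subgroup.mem_normalizer_iff.mp hx _).mp (D.inv_mem hd))

theorem commutatorElement_mem_of_mem_normalizer' {D : Subgroup G} {d x : G} (hd : d ∈ D)
    (hx : x ∈ Subgroup.normalizer (D : Set G)) : ⁅x, d⁆ ∈ D := by
  rw [commutatorElement_def]
  exact D.mul_mem ((Subgroup.mem_normalizer_iff.mp hx _).mp hd) (D.inv_mem hd)

theorem IsDstarMem.le_centralizer {S D E : Subgroup G} (hD : IsDstarMem S D)
    (hE : IsDstarMem S E) : D ≤ Subgroup.centralizer (E : Set G) := by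
  intro d hd
  rw [Subgroup.mem_centralizer_iff]
  intro x hx
  refine (hD.quadratic x (hE.le hx) (fun d hd => ?_) d hd).symm.eq
  have h1 : ⁅d, x⁆ ∈ E := commutatorElement_mem_of_mem_normalizer' hx (hE.le_normalizer (hD.le hd))
  exact (Subgroup.mem_centralizer_iff.mp (hE.comm h1) x hx).symm

theorem le_normalizer_sSup {S : Subgroup G} {C : Set (Subgroup G)}
    (h : ∀ D ∈ C, S ≤ Subgroup.normalizer (D : Set G)) :
    S ≤ Subgroup.normalizer ((sSup C : Subgroup G) : Set G) := by
  intro g hg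
  rw [Subgroup.mem_normalizer_iff_map_conj_eq, sSup_eq_iSup', Subgroup.map_iSup]
  exact iSup_congr fun D => Subgroup.mem_normalizer_iff_map_conj_eq.mp (h D D.2 hg)

theorem isDstarMem_sSup {S : Subgroup G} {C : Set (Subgroup G)} (h : ∀ D ∈ C, IsDstarMem S D) :
    IsDstarMem S (sSup C) where
  le := sSup_le fun D hD => (h D hD).le
  le_normalizer := le_normalizer_sSup fun D hD => (h D hD).le_normalizer
  comm := sSup_le fun D hD => by
    rw [Subgroup.le_centralizer_iff]
    exact sSup_le fun E hE => (h E hE).le_centralizer (h D hD)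
  quadratic x hx hq := by
    have : (sSup C : Subgroup G) ≤ Subgroup.centralizer {x} := by
      refine sSup_le fun D hD d hd => Subgroup.mem_centralizer_singleton_iff.mpr ?_
      exact ((h D hD).quadratic x hx (fun d hd => hq d (le_sSup hD hd)) d hd).eq
    exact fun d hd => Subgroup.mem_centralizer_singleton_iff.mp (this hd)

/-- The largest normal abelian subgroup of `S` on which no element of `S` acts quadratically and
nontrivially. -/
def Dstar (S : Subgroup G) : Subgroup G :=
  sSup {D | IsDstarMem S D}

theorem isDstarMem_Dstar (S : Subgroup G) : IsDstarMem S (Dstar S) :=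
  isDstarMem_sSup fun _ h => h

theorem IsDstarMem.le_Dstar {S D : Subgroup G} (h : IsDstarMem S D) : D ≤ Dstar S :=
  le_sSup h

theorem mem_Dstar_of_forall_commute {S : Subgroup G} {z : G} (hz : z ∈ S)
    (h : ∀ s ∈ S, Commute z s) : z ∈ Dstar S := by
  have hc : ∀ d ∈ Subgroup.zpowers z, ∀ s ∈ S, Commute d s := by
    intro d hd s hs
    obtain ⟨n, rfl⟩ := Subgroup.mem_zpowers_iff.mp hd
    exact (h s hs).zpow_left n
  have hle : Subgroup.zpowers z ≤ S := by rwa [Subgroup.zpowers_le]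
  have : IsDstarMem S (Subgroup.zpowers z) :=
    { le := hle
      le_normalizer := fun s hs => Subgroup.centralizer_le_normalizer _
        (Subgroup.mem_centralizer_iff.mpr fun d hd => (hc d hd s hs).eq)
      comm := fun s hs => Subgroup.mem_centralizer_iff.mpr fun d hd => (hc d hd s (hle hs)).eq
      quadratic := fun x hx _ d hd => hc d hd x hx }
  exact this.le_Dstar (Subgroup.mem_zpowers z)

theorem IsDstarMem.map {S D : Subgroup G} (h : IsDstarMem S D) {f : G →* G'}
    (hf : Function.Injective f) : IsDstarMem (S.map f) (D.map f) where
  le := Subgroup.map_mono h.le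
  le_normalizer := (Subgroup.map_mono h.le_normalizer).trans (Subgroup.le_normalizer_map f)
  comm := (Subgroup.map_mono h.comm).trans (Subgroup.map_centralizer_le_centralizer_image _ _)
  quadratic := by
    rintro _ ⟨x, hx, rfl⟩ hq _ ⟨d, hd, rfl⟩
    refine (h.quadratic x hx (fun d hd => ?_) d hd).map f
    have := (hq (f d) (Subgroup.mem_map_of_mem f hd)).eq
    rw [← map_commutatorElement, ← map_mul, ← map_mul] at this
    exact hf this

theorem IsDstarMem.comap {S : Subgroup G} {D : Subgroup G'} {f : G →* G'}
    (hf : Function.Injective f) (h : IsDstarMem (S.map f) D) : IsDstarMem S (D.comap f) where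
  le := (Subgroup.comap_mono h.le).trans (Subgroup.comap_map_eq_self_of_injective hf S).le
  le_normalizer x hx := by
    rw [Subgroup.mem_normalizer_iff]
    intro y
    have := Subgroup.mem_normalizer_iff.mp (h.le_normalizer (Subgroup.mem_map_of_mem f hx)) (f y)
    simpa [Subgroup.mem_comap] using this
  comm x hx := Subgroup.mem_centralizer_iff.mpr fun y hy => hf (by
    rw [map_mul, map_mul]
    exact Subgroup.mem_centralizer_iff.mp (h.comm hx) _ hy)
  quadratic x hx hq d hd := by
    refine hf ?_
    rw [map_mul, map_mul]
    refine h.quadratic (f x) (Subgroup.mem_map_of_mem f hx) (fun e he => ?_) (f d) hd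
    obtain ⟨e, -, rfl⟩ := h.le he
    rw [← map_commutatorElement]
    exact (hq e he).map f

theorem map_Dstar {f : G →* G'} (hf : Function.Injective f) (S : Subgroup G) :
    (Dstar S).map f = Dstar (S.map f) := by
  apply le_antisymm ((isDstarMem_Dstar S).map hf).le_Dstar
  have h := isDstarMem_Dstar (S.map f)
  rw [← Subgroup.map_comap_eq_self (h.le.trans (Subgroup.map_le_range f S))]
  exact Subgroup.map_mono (h.comap hf).le_Dstar

theorem normalizer_le_normalizer_Dstar (S : Subgroup G) :
    Subgroup.normalizer (S : Set G) ≤ Subgroup.normalizer (Dstar S : Set G) := by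
  intro g hg
  rw [Subgroup.mem_normalizer_iff_map_conj_eq] at hg ⊢
  rw [map_Dstar (MulAut.conj g).injective, hg]

/-- The conjugation action of a subgroup on a normal subgroup. -/
def conjEnd (Y V : Subgroup G) [V.Normal] : Y →* Monoid.End V where
  toFun y := ((MulAut.conj (y : G)).toMonoidHom.comp V.subtype).codRestrict V
    fun v => Subgroup.Normal.conj_mem inferInstance _ v.2 _
  map_one' := MonoidHom.ext fun v => Subtype.ext (by
    change (1 : G) * v * (1 : G)⁻¹ = v
    simp)
  map_mul' a b := MonoidHom.ext fun v => Subtype.ext (by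
    change (a * b : G) * v * (a * b : G)⁻¹ = a * (b * v * (b : G)⁻¹) * (a : G)⁻¹
    group)

theorem conjEnd_eq_one_iff {Y V : Subgroup G} [V.Normal] {y : Y} :
    conjEnd Y V y = 1 ↔ (y : G) ∈ Subgroup.centralizer (V : Set G) := by
  rw [Subgroup.mem_centralizer_iff]
  constructor
  · intro h v hv
    have h1 : (y : G) * v * (y : G)⁻¹ = v :=
      congrArg Subtype.val (DFunLike.congr_fun h (⟨v, hv⟩ : V))
    exact (mul_inv_eq_iff_eq_mul.mp h1).symm
  · intro h
    refine MonoidHom.ext fun v => Subtype.ext ?_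
    change (y : G) * v * (y : G)⁻¹ = v
    rw [mul_inv_eq_iff_eq_mul, h v v.2]

/-- If the elements of `T` act quadratically on a normal `p`-subgroup `V`, `p ≥ 5`, in a solvable
group then the normal closure of `T` acts on `V` as a `p`-group. -/
theorem exists_pow_mem_centralizer_of_quadratic [Finite G] [Group.IsSolvable G] [Fact p.Prime]
    (hp5 : 5 ≤ p) {V : Subgroup G} [V.Normal] (hV : IsPGroup p V) {T : Set G}
    (hT : ∀ t ∈ T, ∀ v ∈ V, Commute ⁅v, t⁆ t) {y : G} (hy : y ∈ Subgroup.normalClosure T) :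
    ∃ k, y ^ p ^ k ∈ Subgroup.centralizer (V : Set G) := by
  obtain ⟨k, hk⟩ := MonoidHom.exists_pow_eq_one_of_closure_quadratic hp5
    (Subgroup.closure_closure_coe_preimage (k := Group.conjugatesOfSet T)) hV
    (conjEnd (Subgroup.normalClosure T) V) (by
      rintro ⟨x, hx'⟩ hx ⟨v, hv⟩
      obtain ⟨t, ht, hc⟩ := Group.mem_conjugatesOfSet_iff.mp hx
      obtain ⟨h, rfl⟩ := isConj_iff.mp hc
      have h1 : h⁻¹ * v⁻¹ * h ∈ V := by
        simpa using Subgroup.Normal.conj_mem (H := V) inferInstance _ (V.inv_mem hv) h⁻¹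
      have h2 := (hT t ht _ h1).map (MulAut.conj h)
      rw [map_commutatorElement] at h2
      have h3 : MulAut.conj h (h⁻¹ * v⁻¹ * h) = v⁻¹ := by
        rw [MulAut.conj_apply]; group
      rw [h3, MulAut.conj_apply, commutatorElement_def, inv_inv] at h2
      refine Subtype.ext ?_
      change h * t * h⁻¹ * (v⁻¹ * (h * t * h⁻¹ * v * (h * t * h⁻¹)⁻¹)) * (h * t * h⁻¹)⁻¹
        = v⁻¹ * (h * t * h⁻¹ * v * (h * t * h⁻¹)⁻¹)
      rw [mul_inv_eq_iff_eq_mul]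
      simpa only [mul_assoc] using h2.symm.eq) ⟨y, hy⟩
  refine ⟨k, ?_⟩
  exact conjEnd_eq_one_iff.mp ((map_pow (conjEnd (Subgroup.normalClosure T) V) ⟨y, hy⟩ _).trans hk)

/-- A theorem of Glauberman--Thompson type for the subgroup `Dstar`. -/
theorem Dstar_normal [Finite G] [Group.IsSolvable G] [Fact p.Prime] (hp5 : 5 ≤ p)
    (h : piCore {p}ᶜ G = ⊥) (S : Sylow p G) : (Dstar (S : Subgroup G)).Normal := by
  set V := piCore {p} G with hV
  have hVp : IsPGroup p V := isPiSubgroup_singleton.mp (isPiSubgroup_piCore _)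
  have hVS : V ≤ S := hVp.le_sylow_of_normal S
  have hD := isDstarMem_Dstar (S : Subgroup G)
  have hDV : Dstar (S : Subgroup G) ≤ V := by
    refine Subgroup.le_normalClosure.trans (le_piCore inferInstance (isPiSubgroup_singleton.mpr ?_))
    rintro ⟨y, hy⟩
    obtain ⟨k, hk⟩ := exists_pow_mem_centralizer_of_quadratic hp5 hVp (fun t ht v hv => by
      have h1 := commutatorElement_mem_of_mem_normalizer' ht (hD.le_normalizer (hVS hv))
      exact (Subgroup.mem_centralizer_iff.mp (hD.comm h1) t ht).symm) hy
    obtain ⟨l, hl⟩ := hVp ⟨_, centralizer_piCore_le h hk⟩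
    have hl' : (y ^ p ^ k) ^ p ^ l = 1 := congrArg Subtype.val hl
    refine ⟨k + l, Subtype.ext ?_⟩
    change y ^ p ^ (k + l) = 1
    rw [pow_add, pow_mul]
    exact hl'
  have hDV' : IsDstarMem V (Dstar (S : Subgroup G)) :=
    { le := hDV
      le_normalizer := hVS.trans hD.le_normalizer
      comm := hD.comm
      quadratic := fun x hx => hD.quadratic x (hVS hx) }
  set C : Set (Subgroup G) := Set.range fun g : G =>
    (Dstar (S : Subgroup G)).map (MulAut.conj g).toMonoidHom with hC
  have hE : IsDstarMem V (sSup C) := isDstarMem_sSup (by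
    rintro _ ⟨g, rfl⟩
    have := hDV'.map (f := (MulAut.conj g).toMonoidHom) (MulAut.conj g).injective
    rwa [show V.map (MulAut.conj g).toMonoidHom = V from
      Subgroup.mem_normalizer_iff_map_conj_eq.mp (by rw [Subgroup.normalizer_eq_top]; trivial)]
      at this)
  have hDE : Dstar (S : Subgroup G) ≤ sSup C := by
    refine le_sSup ⟨1, ?_⟩
    change Subgroup.map (MulAut.conj (1 : G)).toMonoidHom _ = _
    rw [map_one]
    exact Subgroup.map_id _
  have hEn : (sSup C).Normal := by
    refine ⟨fun n hn g => ?_⟩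
    have h1 : (sSup C).map (MulAut.conj g).toMonoidHom ≤ sSup C := by
      rw [Subgroup.map_le_iff_le_comap]
      refine sSup_le ?_
      rintro _ ⟨k, rfl⟩
      rw [← Subgroup.map_le_iff_le_comap]
      refine le_sSup ⟨g * k, ?_⟩
      change Subgroup.map _ _ = Subgroup.map _ (Subgroup.map _ _)
      rw [Subgroup.map_map, map_mul]
      rfl
    exact h1 (Subgroup.mem_map_of_mem _ hn)
  have hES : IsDstarMem (S : Subgroup G) (sSup C) :=
    { le := hE.le.trans hVS
      le_normalizer := fun s _ => by rw [Subgroup.normalizer_eq_top]; trivial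
      comm := hE.comm
      quadratic := fun x hx hq => by
        set Z := Subgroup.centralizer ((sSup C : Subgroup G) : Set G) with hZ
        have hZn : Z.Normal := inferInstance
        have hEp : IsPGroup p (sSup C : Subgroup G) := hVp.to_le hE.le
        have hY : Subgroup.normalClosure {x} ≤ (S : Subgroup G) ⊔ Z := by
          have h1 : IsPGroup p ((Subgroup.normalClosure {x}).map (QuotientGroup.mk' Z)) := by
            rintro ⟨_, y, hy, rfl⟩
            obtain ⟨k, hk⟩ := exists_pow_mem_centralizer_of_quadratic hp5 hEp
              (T := {x}) (by rintro _ rfl v hv; exact hq v hv) hy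
            refine ⟨k, Subtype.ext ?_⟩
            change (QuotientGroup.mk' Z y) ^ p ^ k = 1
            rw [← map_pow]
            exact (QuotientGroup.eq_one_iff _).mpr hk
          have h2 : ((Subgroup.normalClosure {x}).map (QuotientGroup.mk' Z)).Normal :=
            Subgroup.Normal.map inferInstance _ (QuotientGroup.mk'_surjective Z)
          have h3 := h1.le_sylow_of_normal (S.mapSurjective (QuotientGroup.mk'_surjective Z))
          rw [Sylow.coe_mapSurjective, Subgroup.map_le_map_iff, QuotientGroup.ker_mk'] at h3
          exact h3
        suffices hs : sSup C ≤ Subgroup.centralizer {x} from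
          fun d hd => Subgroup.mem_centralizer_singleton_iff.mp (hs hd)
        refine sSup_le ?_
        rintro _ ⟨g, rfl⟩ _ ⟨d, hd, rfl⟩
        rw [Subgroup.mem_centralizer_singleton_iff]
        have hx1 : g⁻¹ * x * g ∈ Subgroup.normalClosure {x} := by
          have := Subgroup.normalClosure_normal.conj_mem x
            (Subgroup.subset_normalClosure (Set.mem_singleton x)) g⁻¹
          rwa [inv_inv] at this
        obtain ⟨s, hs, c, hc, hsc⟩ := Subgroup.mem_sup_of_normal_right.mp (hY hx1)
        have hcomm : ∀ e ∈ sSup C, ⁅e, g⁻¹ * x * g⁆ = ⁅e, s⁆ := fun e he => by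
          have : e * c = c * e := Subgroup.mem_centralizer_iff.mp hc e he
          have h1 : c * e⁻¹ * c⁻¹ = e⁻¹ := by
            rw [mul_inv_eq_iff_eq_mul]
            exact (show Commute e c from this).inv_left.eq.symm
          rw [← hsc, commutatorElement_def, commutatorElement_def, mul_inv_rev]
          calc e * (s * c) * e⁻¹ * (c⁻¹ * s⁻¹) = e * s * (c * e⁻¹ * c⁻¹) * s⁻¹ := by group
            _ = _ := by rw [h1]
        have hds : Commute d s := by
          refine hD.quadratic s hs (fun e he => ?_) d hd
          have heE := hDE he
          have h1 : g * e * g⁻¹ ∈ sSup C := hEn.conj_mem e heE g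
          have h2 := (hq _ h1).map (MulAut.conj g⁻¹)
          rw [map_commutatorElement, MulAut.conj_apply, MulAut.conj_apply, inv_inv,
            show g⁻¹ * (g * e * g⁻¹) * g = e by group, hcomm e heE] at h2
          have h3 : Commute ⁅e, s⁆ c := Subgroup.mem_centralizer_iff.mp hc _ (by
            rw [← hcomm e heE]
            exact commutatorElement_mem_of_mem_normalizer heE
              (by rw [Subgroup.normalizer_eq_top]; trivial))
          have h4 := h2.mul_right h3.inv_right
          rwa [← hsc, mul_inv_cancel_right] at h4
        have hdc : Commute d c := Subgroup.mem_centralizer_iff.mp hc d (hDE hd)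
        have h5 := ((hds.mul_right hdc).map (MulAut.conj g)).eq
        rw [hsc, MulAut.conj_apply g (g⁻¹ * x * g),
          show g * (g⁻¹ * x * g) * g⁻¹ = x by group] at h5
        exact h5 }
  rw [le_antisymm hDE hES.le_Dstar]
  exact hEn

/-- A version of `Dstar_normal` for a subgroup. -/
theorem le_normalizer_Dstar [Finite G] [Fact p.Prime] (hp5 : 5 ≤ p) {H : Subgroup G}
    [Group.IsSolvable H] (h : piCore {p}ᶜ H = ⊥) (S : Sylow p H) :
    H ≤ Subgroup.normalizer (Dstar ((S : Subgroup H).map H.subtype) : Set G) := by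
  rw [← map_Dstar H.subtype_injective]
  have := Dstar_normal hp5 h S
  have h2 := Subgroup.le_normalizer_map (H := Dstar (S : Subgroup H)) H.subtype
  rw [Subgroup.normalizer_eq_top, ← MonoidHom.range_eq_map, Subgroup.range_subtype] at h2
  exact h2

end Dstar

section IsSyl

variable {G : Type*} [Group G] {p : ℕ}

theorem IsPGroup.map_conj {S : Subgroup G} (hS : IsPGroup p S) (g : G) :
    IsPGroup p (S.map (MulAut.conj g).toMonoidHom) :=
  hS.map _

theorem map_conj_map_conj (a b : G) (S : Subgroup G) :
    (S.map (MulAut.conj b).toMonoidHom).map (MulAut.conj a).toMonoidHom =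
      S.map (MulAut.conj (a * b)).toMonoidHom := by
  rw [Subgroup.map_map, map_mul]
  rfl

theorem map_conj_one (S : Subgroup G) : S.map (MulAut.conj (1 : G)).toMonoidHom = S := by
  rw [map_one]
  exact Subgroup.map_id _

theorem map_conj_eq_of_mem_normalizer {S : Subgroup G} {g : G}
    (hg : g ∈ Subgroup.normalizer (S : Set G)) : S.map (MulAut.conj g).toMonoidHom = S :=
  Subgroup.mem_normalizer_iff_map_conj_eq.mp hg

theorem map_conj_le_iff {g : G} {S T : Subgroup G} :
    S.map (MulAut.conj g).toMonoidHom ≤ T ↔ S ≤ T.map (MulAut.conj g⁻¹).toMonoidHom := by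
  constructor
  · intro h
    have := Subgroup.map_mono (f := (MulAut.conj g⁻¹).toMonoidHom) h
    rwa [map_conj_map_conj, inv_mul_cancel, map_conj_one] at this
  · intro h
    have := Subgroup.map_mono (f := (MulAut.conj g).toMonoidHom) h
    rwa [map_conj_map_conj, mul_inv_cancel, map_conj_one] at this

theorem map_conj_normalizer (S : Subgroup G) (g : G) :
    (Subgroup.normalizer (S : Set G)).map (MulAut.conj g).toMonoidHom =
      Subgroup.normalizer ((S.map (MulAut.conj g).toMonoidHom : Subgroup G) : Set G) := by
  have key : ∀ (S : Subgroup G) (g : G),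
      (Subgroup.normalizer (S : Set G)).map (MulAut.conj g).toMonoidHom ≤
        Subgroup.normalizer ((S.map (MulAut.conj g).toMonoidHom : Subgroup G) : Set G) :=
    fun S g => Subgroup.le_normalizer_map _
  refine (key S g).antisymm ?_
  rw [← inv_inv g, ← map_conj_le_iff, inv_inv]
  refine (key _ _).trans ?_
  rw [map_conj_map_conj, inv_mul_cancel, map_conj_one]

theorem mem_normalizer_inf {x : G} {H K : Subgroup G} (hH : x ∈ Subgroup.normalizer (H : Set G))
    (hK : x ∈ Subgroup.normalizer (K : Set G)) :
    x ∈ Subgroup.normalizer ((H ⊓ K : Subgroup G) : Set G) := by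
  rw [Subgroup.mem_normalizer_iff]
  intro y
  rw [Subgroup.mem_inf, Subgroup.mem_inf, ← Subgroup.mem_normalizer_iff.mp hH,
    ← Subgroup.mem_normalizer_iff.mp hK]

theorem lt_inf_normalizer_of_lt {P T : Subgroup G} (hP : Group.IsNilpotent P) (h : T < P) :
    T < P ⊓ Subgroup.normalizer (T : Set G) := by
  have h1 := Group.normalizerCondition_of_isNilpotent (G := P) (T.subgroupOf P) (by
    refine lt_top_iff_ne_top.mpr fun h2 => h.not_ge (Subgroup.subgroupOf_eq_top.mp h2))
  obtain ⟨⟨g, hgP⟩, hg, hgT⟩ := SetLike.exists_of_lt h1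
  refine lt_of_le_of_ne (le_inf h.le Subgroup.le_normalizer) fun h2 => hgT ?_
  have : g ∈ P ⊓ Subgroup.normalizer (T : Set G) := by
    refine ⟨hgP, ?_⟩
    rw [← Subgroup.map_subgroupOf_eq_of_le h.le]
    exact Subgroup.le_normalizer_map P.subtype ⟨_, hg, rfl⟩
  rw [← h2] at this
  exact this

/-- `S` is a Sylow `p`-subgroup of the subgroup `H`. -/
structure IsSyl (p : ℕ) (S H : Subgroup G) : Prop where
  le : S ≤ H
  isPGroup : IsPGroup p S
  max : ∀ T : Subgroup G, S ≤ T → T ≤ H → IsPGroup p T → T ≤ S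

theorem exists_isSyl [Finite G] {R H : Subgroup G} (hR : IsPGroup p R) (hRH : R ≤ H) :
    ∃ S, IsSyl p S H ∧ R ≤ S := by
  obtain ⟨S, ⟨hS, hRS, hSH⟩, hmax⟩ := (Set.toFinite
    {S : Subgroup G | IsPGroup p S ∧ R ≤ S ∧ S ≤ H}).exists_maximal ⟨R, hR, le_rfl, hRH⟩
  exact ⟨S, ⟨hSH, hS, fun T h1 h2 h3 => hmax ⟨h3, hRS.trans h1, h2⟩ h1⟩, hRS⟩

theorem IsSyl.mono {S H K : Subgroup G} (h : IsSyl p S H) (hS : S ≤ K) (hK : K ≤ H) :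
    IsSyl p S K :=
  ⟨hS, h.isPGroup, fun T h1 h2 h3 => h.max T h1 (h2.trans hK) h3⟩

theorem IsSyl.map_conj {S H : Subgroup G} (h : IsSyl p S H) (g : G) :
    IsSyl p (S.map (MulAut.conj g).toMonoidHom) (H.map (MulAut.conj g).toMonoidHom) := by
  refine ⟨Subgroup.map_mono h.le, h.isPGroup.map_conj g, fun T h1 h2 h3 => ?_⟩
  rw [map_conj_le_iff] at h1
  rw [← inv_inv g, ← map_conj_le_iff] at h2 ⊢
  exact h.max _ h1 h2 (h3.map_conj _)

/-- The bundled Sylow subgroup attached to `IsSyl p S H`. -/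
def IsSyl.toSylow {S H : Subgroup G} (h : IsSyl p S H) : Sylow p H :=
  { S.subgroupOf H with
    isPGroup' := h.isPGroup.comap_subtype
    is_maximal' := fun {Q} hQ hle => by
      refine le_antisymm (fun q hq => ?_) hle
      refine h.max (Q.map H.subtype) ?_ (Subgroup.map_subtype_le Q) (hQ.map _)
        (Subgroup.mem_map_of_mem H.subtype hq)
      rw [← Subgroup.map_subgroupOf_eq_of_le h.le]
      exact Subgroup.map_mono hle }

theorem IsSyl.map_toSylow {S H : Subgroup G} (h : IsSyl p S H) :
    (h.toSylow : Subgroup H).map H.subtype = S :=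
  Subgroup.map_subgroupOf_eq_of_le h.le

theorem IsSyl.exists_map_conj_le [Finite G] [Fact p.Prime] {S H T : Subgroup G} (h : IsSyl p S H)
    (hT : IsPGroup p T) (hTH : T ≤ H) :
    ∃ g ∈ H, T.map (MulAut.conj g).toMonoidHom ≤ S := by
  obtain ⟨T', hT', hTT'⟩ := exists_isSyl hT hTH
  obtain ⟨⟨g, hg⟩, hgT⟩ := MulAction.exists_smul_eq H hT'.toSylow h.toSylow
  refine ⟨g, hg, ?_⟩
  rintro _ ⟨t, ht, rfl⟩
  have h1 : (⟨g, hg⟩ : H) * ⟨t, hTH ht⟩ * (⟨g, hg⟩ : H)⁻¹ ∈ (h.toSylow : Subgroup H) := by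
    rw [← hgT]
    exact ⟨⟨t, hTH ht⟩, hTT' ht, rfl⟩
  exact h1

theorem isSyl_of_sylow (P : Sylow p G) : IsSyl p (P : Subgroup G) ⊤ :=
  ⟨le_top, P.isPGroup', fun _ h1 _ h3 => (P.is_maximal' h3 h1).le⟩

theorem IsSyl.ne_bot [Finite G] [hp : Fact p.Prime] {S H : Subgroup G} (h : IsSyl p S H)
    (hpH : p ∣ Nat.card H) : S ≠ ⊥ := by
  rintro rfl
  obtain ⟨g, hg⟩ := exists_prime_orderOf_dvd_card' p hpH
  have h1 : IsPGroup p (Subgroup.zpowers (g : G)) :=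
    IsPGroup.of_card (n := 1) (by rw [Nat.card_zpowers, Subgroup.orderOf_coe, hg, pow_one])
  have := h.max _ bot_le (by rw [Subgroup.zpowers_le]; exact g.2) h1
  rw [Subgroup.zpowers_le, Subgroup.mem_bot] at this
  rw [← Subgroup.orderOf_coe, this, orderOf_one] at hg
  exact hp.out.one_lt.ne hg

/-- A nontrivial normal subgroup of a finite `p`-group contains a central element of order `p`. -/
theorem IsPGroup.exists_orderOf_eq_commute [Finite G] [hp : Fact p.Prime] {S J : Subgroup G}
    (hS : IsPGroup p S) (hJ : IsPGroup p J) (hSJ : S ≤ Subgroup.normalizer (J : Set G))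
    (hJ1 : J ≠ ⊥) : ∃ z ∈ J, orderOf z = p ∧ ∀ s ∈ S, Commute z s := by
  let _ : MulAction S J :=
    { smul := fun s j => ⟨s * j * (s : G)⁻¹, (Subgroup.mem_normalizer_iff.mp (hSJ s.2) _).mp j.2⟩
      one_smul := fun j => Subtype.ext (by change (1 : G) * j * (1 : G)⁻¹ = j; simp)
      mul_smul := fun a b j => Subtype.ext (by
        change (a * b : G) * j * (a * b : G)⁻¹ = a * (b * j * (b : G)⁻¹) * (a : G)⁻¹
        group) }
  have : Nontrivial J := (Subgroup.nontrivial_iff_ne_bot J).mpr hJ1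
  have hpJ : p ∣ Nat.card J := hJ.card_eq_or_dvd.resolve_left Finite.one_lt_card.ne'
  obtain ⟨z, hz, hz1⟩ := hS.exists_fixed_point_of_prime_dvd_card_of_fixed_point J hpJ
    (a := 1) (fun s => Subtype.ext (by change (s : G) * (1 : G) * (s : G)⁻¹ = 1; simp))
  have hzc : ∀ s ∈ S, Commute (z : G) s := fun s hs => by
    have h1 : s * z * s⁻¹ = (z : G) := congrArg Subtype.val (hz ⟨s, hs⟩)
    exact (mul_inv_eq_iff_eq_mul.mp h1).symm
  obtain ⟨k, hk⟩ := IsPGroup.iff_orderOf.mp hJ z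
  have hk0 : k ≠ 0 := by
    rintro rfl
    rw [pow_zero, orderOf_eq_one_iff] at hk
    exact hz1 hk.symm
  obtain ⟨m, rfl⟩ := Nat.exists_eq_succ_of_ne_zero hk0
  refine ⟨(z : G) ^ p ^ m, J.pow_mem z.2 _, ?_, fun s hs => (hzc s hs).pow_left _⟩
  rw [orderOf_pow_of_dvd (pow_ne_zero _ hp.out.ne_zero)
    (by rw [Subgroup.orderOf_coe, hk]; exact pow_dvd_pow _ m.le_succ), Subgroup.orderOf_coe, hk,
    pow_succ, Nat.mul_div_cancel_left _ (pow_pos hp.out.pos _)]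

theorem IsPGroup.Dstar_ne_bot [Finite G] [hp : Fact p.Prime] {S : Subgroup G}
    (hS : IsPGroup p S) (h : S ≠ ⊥) : Dstar S ≠ ⊥ := by
  obtain ⟨z, hz, hzp, hc⟩ := hS.exists_orderOf_eq_commute hS Subgroup.le_normalizer h
  intro h1
  have := mem_Dstar_of_forall_commute hz hc
  rw [h1, Subgroup.mem_bot] at this
  rw [this, orderOf_one] at hzp
  exact hp.out.one_lt.ne hzp

end IsSyl

/-- The properties of a minimal counterexample to the solvability of a finite group all of whose
two-generated subgroups are solvable. -/
structure IsMinimalNonsolvable (G : Type*) [Group G] : Prop where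
  simple : IsSimpleGroup G
  proper : ∀ H : Subgroup G, H ≠ ⊤ → Group.IsSolvable H
  two_generated : ∀ a b : G, Group.IsSolvable (Subgroup.closure ({a, b} : Set G))
  not_solvable : ¬ Group.IsSolvable G

namespace IsMinimalNonsolvable

variable {G : Type*} [Group G] {p : ℕ}

theorem normalizer_ne_top (hG : IsMinimalNonsolvable G) {H : Subgroup G} (h1 : H ≠ ⊥)
    (h : Group.IsSolvable H) : Subgroup.normalizer (H : Set G) ≠ ⊤ := by
  intro h2
  have := hG.simple
  rcases (Subgroup.normalizer_eq_top_iff.mp h2).eq_bot_or_eq_top with h3 | h3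
  · exact h1 h3
  · subst h3
    exact hG.not_solvable (Group.isSolvable_of_surjective
      (f := (Subgroup.topEquiv (G := G)).toMonoidHom)
      Subgroup.topEquiv.surjective)

theorem _root_.IsPGroup.isSolvable' [Finite G] [Fact p.Prime] {H : Subgroup G}
    (h : IsPGroup p H) : Group.IsSolvable H := by
  have := h.isNilpotent
  infer_instance

theorem piCore_normalizer_eq_bot [Finite G] [hp : Fact p.Prime] (hG : IsMinimalNonsolvable G)
    (hpG : p ∣ Nat.card G) {R : Subgroup G} (hR : IsPGroup p R) (hR1 : R ≠ ⊥) :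
    piCore {p}ᶜ (Subgroup.normalizer (R : Set G)) = ⊥ := by
  have := hG.simple
  have h := eq_bot_of_normalizer_le_normalizer hG.two_generated hG.proper hG.not_solvable hpG hR hR1
    ((isPiSubgroup_compl_singleton hp.out).mp (isPiSubgroup_piCoreOf {p}ᶜ _))
    (piCoreOf_le _ _) (le_normalizer_piCoreOf _ _)
  exact (Subgroup.map_eq_bot_iff_of_injective _ (Subgroup.subtype_injective _)).mp h

theorem normalizer_le_normalizer_Dstar [Finite G] [hp : Fact p.Prime] (hp5 : 5 ≤ p)
    (hG : IsMinimalNonsolvable G) (hpG : p ∣ Nat.card G) {P R : Subgroup G} (hP : IsSyl p P ⊤)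
    (hR : IsPGroup p R) (hR1 : R ≠ ⊥) (hRM : R ≤ Subgroup.normalizer (Dstar P : Set G)) :
    Subgroup.normalizer (R : Set G) ≤ Subgroup.normalizer (Dstar P : Set G) := by
  set M := Subgroup.normalizer (Dstar P : Set G) with hM
  by_contra hbad
  obtain ⟨⟨R, T⟩, ⟨hR, hR1, hRM, hbad, hT⟩, hmax⟩ := (Set.toFinite {x : Subgroup G × Subgroup G |
    IsPGroup p x.1 ∧ x.1 ≠ ⊥ ∧ x.1 ≤ M ∧ ¬ Subgroup.normalizer (x.1 : Set G) ≤ M ∧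
      IsSyl p x.2 (M ⊓ Subgroup.normalizer (x.1 : Set G))}).exists_maximalFor
        (fun x => Nat.card x.2) _ (by
          obtain ⟨T, hT, -⟩ := exists_isSyl hR (le_inf hRM Subgroup.le_normalizer)
          exact ⟨(R, T), hR, hR1, hRM, hbad, hT⟩)
  dsimp only at hR hR1 hRM hbad hT hmax
  have hRT : R ≤ T := by
    obtain ⟨g, hg, hgR⟩ := hT.exists_map_conj_le hR (le_inf hRM Subgroup.le_normalizer)
    rwa [map_conj_eq_of_mem_normalizer hg.2] at hgR
  have hT1 : T ≠ ⊥ := fun h => hR1 (le_bot_iff.mp (h ▸ hRT))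
  have hPM : P ≤ M := Subgroup.le_normalizer.trans (_root_.normalizer_le_normalizer_Dstar P)
  obtain ⟨m, hm, hmT⟩ := (hP.mono hPM le_top).exists_map_conj_le hT.isPGroup
    (hT.le.trans inf_le_left)
  rw [map_conj_le_iff] at hmT
  set P' := P.map (MulAut.conj m⁻¹).toMonoidHom with hP'
  have hP'p : IsPGroup p P' := hP.isPGroup.map_conj _
  have hDP' : Dstar P' = Dstar P := by
    rw [hP', ← map_Dstar (MulAut.conj m⁻¹).injective]
    exact Subgroup.mem_normalizer_iff_map_conj_eq.mp (inv_mem hm)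
  have hP'M : P' ≤ M := by
    rw [hM, ← hDP']
    exact Subgroup.le_normalizer.trans (_root_.normalizer_le_normalizer_Dstar P')
  have key : ∀ R' : Subgroup G, IsPGroup p R' → R' ≠ ⊥ → R' ≤ M →
      Subgroup.normalizer (T : Set G) ≤ Subgroup.normalizer (R' : Set G) →
      (T = P' → Subgroup.normalizer (R' : Set G) ≤ M) →
      Subgroup.normalizer (R' : Set G) ≤ M := by
    intro R' h1 h2 h3 h4 h5
    by_contra h6
    have h7 := lt_inf_normalizer_of_lt hP'p.isNilpotent (lt_of_le_of_ne hmT fun h => h6 (h5 h))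
    obtain ⟨T', hT', hle⟩ := exists_isSyl (p := p) (hP'p.to_le inf_le_left)
      (inf_le_inf hP'M h4)
    have h8 := hmax (j := (R', T')) ⟨h1, h2, h3, h6, hT'⟩ (Subgroup.card_le_of_le (h7.le.trans hle))
    exact absurd h8 (not_le.mpr (Set.ncard_lt_ncard (h7.trans_le hle)))
  have hNT : Subgroup.normalizer (T : Set G) ≤ M :=
    key T hT.isPGroup hT1 (hT.le.trans inf_le_left) le_rfl (by
      intro h
      rw [h, hM, ← hDP']
      exact _root_.normalizer_le_normalizer_Dstar P')
  obtain ⟨S, hS, hTS⟩ := exists_isSyl hT.isPGroup (hT.le.trans inf_le_right)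
  have hST : S = T := by
    by_contra h
    have h7 := lt_inf_normalizer_of_lt hS.isPGroup.isNilpotent (lt_of_le_of_ne hTS (Ne.symm h))
    exact h7.not_ge (hT.max _ h7.le (le_inf (inf_le_right.trans hNT) (inf_le_left.trans hS.le))
      (hS.isPGroup.to_le inf_le_left))
  subst hST
  have : Group.IsSolvable (Subgroup.normalizer (R : Set G)) :=
    hG.proper _ (hG.normalizer_ne_top hR1 hR.isSolvable')
  have h9 := le_normalizer_Dstar hp5 (hG.piCore_normalizer_eq_bot hpG hR hR1) hS.toSylow
  rw [hS.map_toSylow] at h9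
  have hDS : Dstar S ≤ S := (isDstarMem_Dstar S).le
  exact hbad (h9.trans (key _ (hS.isPGroup.to_le hDS) (hS.isPGroup.Dstar_ne_bot hT1)
    (hDS.trans (hT.le.trans inf_le_left)) (_root_.normalizer_le_normalizer_Dstar S)
    (by intro h; rw [h, hDP'])))

end IsMinimalNonsolvable

section Coprime

variable {G : Type*} [Group G] {p : ℕ}

theorem isPGroup_zpowers_of_pow_eq_one [Fact p.Prime] {e : G} (he : e ^ p = 1) :
    IsPGroup p (Subgroup.zpowers e) := by
  rintro ⟨_, n, rfl⟩
  refine ⟨1, Subtype.ext ?_⟩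
  change (e ^ n) ^ p ^ 1 = 1
  rw [pow_one, ← zpow_natCast, ← zpow_mul, mul_comm, zpow_mul, zpow_natCast, he, one_zpow]

theorem exists_commute_mul_of_not_dvd_card [Finite G] [Fact p.Prime] {K : Subgroup G}
    (hK : ¬ p ∣ Nat.card K) {e v : G} (he : e ∈ Subgroup.normalizer (K : Set G))
    (hep : IsPGroup p (Subgroup.zpowers e)) (hv : v⁻¹ * (e * v * e⁻¹) ∈ K) :
    ∃ k ∈ K, Commute (v * k) e := by
  have hN : Subgroup.zpowers e ≤ Subgroup.normalizer (K : Set G) := by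
    rwa [Subgroup.zpowers_le]
  obtain ⟨k, hk, h⟩ := exists_fixed_mul_of_not_dvd_card hep
    ((MulAut.conj).comp (Subgroup.zpowers e).subtype) (K := K) (g := v)
    (fun r k hk => (Subgroup.mem_normalizer_iff.mp (hN r.2) k).mp hk) hK (by
      rintro ⟨r, hr⟩
      obtain ⟨n, rfl⟩ := (mem_powers_iff_mem_zpowers.mpr hr)
      change v⁻¹ * (e ^ n * v * (e ^ n)⁻¹) ∈ K
      clear hr
      induction n with
      | zero => simp
      | succ n ih =>
        have := K.mul_mem hv ((Subgroup.mem_normalizer_iff.mp he _).mp ih)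
        convert this using 1
        rw [pow_succ']
        group)
  refine ⟨k, hk, ?_⟩
  have h1 : e * (v * k) * e⁻¹ = v * k := h ⟨e, Subgroup.mem_zpowers e⟩
  exact (mul_inv_eq_iff_eq_mul.mp h1).symm

theorem mul_natCast_eq_of_forall_mul_eq {R : Type*} [Ring R] [hp : Fact p.Prime] {X C : R}
    (hXC : Commute X C) (hX : X ^ p = 1) (hC : C ^ p = 1)
    (h : ∀ (i : ℕ) (r : R), X ^ i * C * r = r → X * r = r) : X * (p : R) = p := by
  have hsum : ∀ Y : R, Y ^ p = 1 →
      Y * ∑ i ∈ Finset.range p, Y ^ i = ∑ i ∈ Finset.range p, Y ^ i := fun Y hY => by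
    have := mul_geom_sum Y p
    rwa [hY, sub_self, sub_mul, one_mul, sub_eq_zero] at this
  have h1 : X * ∑ i ∈ Finset.range p, ∑ l ∈ Finset.range p, (X ^ i * C) ^ l =
      ∑ i ∈ Finset.range p, ∑ l ∈ Finset.range p, (X ^ i * C) ^ l := by
    rw [Finset.mul_sum]
    refine Finset.sum_congr rfl fun i _ => h i _ (hsum _ ?_)
    rw [(hXC.pow_left i).mul_pow, hC, mul_one, ← pow_mul, mul_comm, pow_mul, hX, one_pow]
  obtain ⟨m, hm⟩ : ∃ m, p = m + 1 := ⟨p - 1, (Nat.succ_pred_prime hp.out).symm⟩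
  have h2 : ∑ i ∈ Finset.range p, ∑ l ∈ Finset.range p, (X ^ i * C) ^ l =
      ∑ l ∈ Finset.range m, (∑ i ∈ Finset.range p, (X ^ (l + 1)) ^ i) * C ^ (l + 1) + p := by
    rw [Finset.sum_comm, show Finset.range p = Finset.range (m + 1) by rw [← hm],
      Finset.sum_range_succ', ← hm]
    congr 1
    · refine Finset.sum_congr rfl fun l _ => ?_
      rw [Finset.sum_mul]
      refine Finset.sum_congr rfl fun i _ => ?_
      rw [(hXC.pow_left i).mul_pow, ← pow_mul, ← pow_mul, mul_comm i]
    · simp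
  have h3 : X * ∑ l ∈ Finset.range m, (∑ i ∈ Finset.range p, (X ^ (l + 1)) ^ i) * C ^ (l + 1) =
      ∑ l ∈ Finset.range m, (∑ i ∈ Finset.range p, (X ^ (l + 1)) ^ i) * C ^ (l + 1) := by
    rw [Finset.mul_sum]
    refine Finset.sum_congr rfl fun l hl => ?_
    rw [← mul_assoc]
    congr 1
    have hco : (l + 1).Coprime p := ((Nat.Prime.coprime_iff_not_dvd hp.out).mpr
      (Nat.not_dvd_of_pos_of_lt l.succ_pos (by have := Finset.mem_range.mp hl; omega))).symm
    obtain ⟨k, -, hk⟩ := Nat.exists_mul_mod_eq_one_of_coprime hco hp.out.one_lt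
    have hXl : X = (X ^ (l + 1)) ^ k := by
      rw [← pow_mul, ← Nat.div_add_mod ((l + 1) * k) p, hk, pow_add, pow_mul, hX, one_pow, one_mul,
        pow_one]
    have hs := hsum (X ^ (l + 1)) (by rw [← pow_mul, mul_comm, pow_mul, hX, one_pow])
    generalize hS : ∑ i ∈ Finset.range p, (X ^ (l + 1)) ^ i = S at hs ⊢
    have hind : ∀ k : ℕ, (X ^ (l + 1)) ^ k * S = S := fun k => by
      induction k with
      | zero => simp
      | succ k ih => rw [pow_succ, mul_assoc, hs, ih]
    rw [hXl]
    simpa only [← pow_mul, ← hXl] using hind k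
  rw [h2, mul_add, h3] at h1
  exact add_left_cancel h1

/-- The action of automorphisms on the abelianization. -/
def abelianizationEnd (U : Type*) [Group U] :
    MulAut U →* AddMonoid.End (Additive (Abelianization U)) where
  toFun a := MonoidHom.toAdditive (Abelianization.map a.toMonoidHom)
  map_one' := by
    change MonoidHom.toAdditive (Abelianization.map (MonoidHom.id U)) = _
    rw [Abelianization.map_id]
    rfl
  map_mul' a b := by
    change MonoidHom.toAdditive (Abelianization.map (a.toMonoidHom.comp b.toMonoidHom)) = _
    rw [← Abelianization.map_comp]
    rfl

/-- The action of the normalizer of `U` on the abelianization of `U`. -/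
def Subgroup.normalizerEnd (U : Subgroup G) :
    Subgroup.normalizer (U : Set G) →* AddMonoid.End (Additive (Abelianization U)) :=
  (abelianizationEnd U).comp U.normalizerMonoidHom

theorem Subgroup.normalizerEnd_apply_of (U : Subgroup G) (g : Subgroup.normalizer (U : Set G))
    (u : U) : U.normalizerEnd g (Additive.ofMul (Abelianization.of u)) =
      Additive.ofMul (Abelianization.of (U.normalizerMonoidHom g u)) :=
  rfl

theorem Subgroup.ofMul_of_eq_iff {U : Subgroup G} {u v : U} :
    Additive.ofMul (Abelianization.of u) = Additive.ofMul (Abelianization.of v) ↔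
      (u⁻¹ * v : G) ∈ ⁅U, U⁆ := by
  rw [Additive.ofMul.injective.eq_iff, ← inv_mul_eq_one, ← map_inv, ← map_mul, ← MonoidHom.mem_ker,
    Abelianization.ker_of, ← Subgroup.map_subtype_commutator]
  exact (Subgroup.mem_map_iff_mem U.subtype_injective).symm

theorem exists_commute_mul_of_normalizerEnd_eq [Finite G] [Fact p.Prime] {U : Subgroup G}
    (hU : ¬ p ∣ Nat.card U) {e : Subgroup.normalizer (U : Set G)}
    (hep : IsPGroup p (Subgroup.zpowers (e : G))) {v : U}
    (hv : U.normalizerEnd e (Additive.ofMul (Abelianization.of v)) =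
      Additive.ofMul (Abelianization.of v)) :
    ∃ k ∈ ⁅U, U⁆, Commute ((v : G) * k) e := by
  rw [Subgroup.normalizerEnd_apply_of] at hv
  exact exists_commute_mul_of_not_dvd_card
    (fun h => hU (h.trans (Subgroup.card_dvd_of_le (Subgroup.commutator_le_self U))))
    (le_normalizer_commutator le_rfl le_rfl e.2) hep (Subgroup.ofMul_of_eq_iff.mp hv.symm)

theorem commute_of_forall_commute_pow_mul [Finite G] [hp : Fact p.Prime] {U : Subgroup G}
    (hs : Group.IsSolvable U) (hU : ¬ p ∣ Nat.card U) {x c : G}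
    (hx : x ∈ Subgroup.normalizer (U : Set G)) (hc : c ∈ Subgroup.normalizer (U : Set G))
    (hxc : Commute x c) (hxp : x ^ p = 1) (hcp : c ^ p = 1)
    (h : ∀ i : ℕ, ∀ k ∈ U, Commute k (x ^ i * c) → Commute k x) : ∀ k ∈ U, Commute k x := by
  induction hn : Nat.card U using Nat.strong_induction_on generalizing U with
  | _ n ih =>
  subst hn
  rcases eq_or_ne U ⊥ with rfl | hU1
  · rintro k hk
    rw [Subgroup.mem_bot.mp hk]
    exact Commute.one_left x
  have hlt : ⁅U, U⁆ < U := by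
    have hU' : Nontrivial U := (Subgroup.nontrivial_iff_ne_bot U).mpr hU1
    have h1 := Group.IsSolvable.commutator_lt_top_of_nontrivial U
    rw [← Subgroup.map_subtype_commutator]
    have h2 := (Subgroup.map_lt_map_iff_of_injective U.subtype_injective).mpr h1
    rwa [← MonoidHom.range_eq_map, Subgroup.range_subtype] at h2
  have hN : Subgroup.normalizer (U : Set G) ≤
      Subgroup.normalizer ((⁅U, U⁆ : Subgroup G) : Set G) := le_normalizer_commutator le_rfl le_rfl
  have hder : ∀ k ∈ ⁅U, U⁆, Commute k x := by
    refine ih _ (Set.ncard_lt_ncard hlt) ?_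
      (fun h => hU (h.trans (Subgroup.card_dvd_of_le hlt.le))) (hN hx) (hN hc)
      (fun i k hk => h i k (hlt.le hk)) rfl
    exact Group.isSolvable_of_isSolvable_injective (Subgroup.inclusion_injective hlt.le)
  have hcomm : ∀ {v : U} {k : G}, k ∈ ⁅U, U⁆ → Commute ((v : G) * k) x → Commute (v : G) x := by
    intro v k hk hvk
    simpa using hvk.mul_left (hder k hk).inv_left
  have key := mul_natCast_eq_of_forall_mul_eq (p := p) (X := U.normalizerEnd ⟨x, hx⟩)
    (C := U.normalizerEnd ⟨c, hc⟩) ((show Commute (⟨x, hx⟩ : Subgroup.normalizer (U : Set G))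
      ⟨c, hc⟩ from Subtype.ext hxc.eq).map _)
    (by rw [← map_pow, ← map_one U.normalizerEnd]; congr 1; exact Subtype.ext hxp)
    (by rw [← map_pow, ← map_one U.normalizerEnd]; congr 1; exact Subtype.ext hcp) (by
      intro i r hr
      ext w
      obtain ⟨v, hv⟩ : ∃ v : U, Additive.ofMul (Abelianization.of v) = r w :=
        QuotientGroup.mk_surjective (s := commutator U) (Additive.toMul (r w))
      have h1 := DFunLike.congr_fun hr w
      rw [← map_pow, ← map_mul] at h1
      change U.normalizerEnd _ (r w) = r w at h1
      change U.normalizerEnd _ (r w) = r w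
      rw [← hv] at h1 ⊢
      obtain ⟨k, hk, hvk⟩ := exists_commute_mul_of_normalizerEnd_eq hU
        (isPGroup_zpowers_of_pow_eq_one (by
          change (x ^ i * c) ^ p = 1
          rw [(hxc.pow_left i).mul_pow, hcp, mul_one, ← pow_mul, mul_comm, pow_mul, hxp,
            one_pow])) h1
      have h2 := hcomm hk (h i _ (U.mul_mem v.2 (hlt.le hk)) hvk)
      rw [Subgroup.normalizerEnd_apply_of]
      congr 2
      refine Subtype.ext ?_
      change x * v * x⁻¹ = v
      rw [mul_inv_eq_iff_eq_mul, h2.eq])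
  intro v hv
  have hp1 := DFunLike.congr_fun key (Additive.ofMul (Abelianization.of ⟨v, hv⟩))
  have h3 : U.normalizerEnd ⟨x, hx⟩ (Additive.ofMul (Abelianization.of ⟨v, hv⟩)) =
      Additive.ofMul (Abelianization.of ⟨v, hv⟩) := by
    set w := Additive.ofMul (Abelianization.of (⟨v, hv⟩ : U)) with hw
    have h4 : p • (U.normalizerEnd ⟨x, hx⟩ w - w) = 0 := by
      rw [smul_sub, ← map_nsmul, sub_eq_zero]
      simpa using hp1
    have hco : (Nat.card (Additive (Abelianization U))).Coprime p := by
      refine ((Nat.Prime.coprime_iff_not_dvd hp.out).mpr fun h => hU (h.trans ?_)).symm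
      exact Subgroup.card_quotient_dvd_card (commutator U)
    have h5 : addOrderOf (U.normalizerEnd ⟨x, hx⟩ w - w) ∣ 1 := by
      rw [← hco]
      exact Nat.dvd_gcd (addOrderOf_dvd_natCard _) (addOrderOf_dvd_of_nsmul_eq_zero h4)
    exact sub_eq_zero.mp (AddMonoid.addOrderOf_eq_one_iff.mp (Nat.dvd_one.mp h5))
  obtain ⟨k, hk, hvk⟩ := exists_commute_mul_of_normalizerEnd_eq hU
    (isPGroup_zpowers_of_pow_eq_one hxp) h3
  exact hcomm (v := ⟨v, hv⟩) hk hvk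

end Coprime

section UniqueSubgroup

theorem mul_pow_of_commute_commutatorElement {U : Type*} [Group U] {x y : U}
    (hx : Commute ⁅y, x⁆ x) (hy : Commute ⁅y, x⁆ y) (n : ℕ) :
    (x * y) ^ n = x ^ n * y ^ n * ⁅y, x⁆ ^ n.choose 2 := by
  set z := ⁅y, x⁆ with hz
  have hyx : y * x = x * y * z := by
    have h1 : z * (x * y) = y * x := by rw [hz, commutatorElement_def]; group
    rw [← h1, (hx.mul_right hy).eq]
  have h1 : ∀ n : ℕ, y ^ n * x = x * y ^ n * z ^ n := by
    intro n
    induction n with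
    | zero => simp
    | succ n ih =>
      rw [pow_succ', mul_assoc, ih, ← mul_assoc, ← mul_assoc, hyx, mul_assoc (x * y) z,
        (hy.pow_right n).eq, pow_succ' z]
      simp only [mul_assoc]
  induction n with
  | zero => simp
  | succ n ih =>
    rw [pow_succ, ih, Nat.choose_succ_succ, Nat.choose_one_right, pow_add z]
    have h2 : z ^ n.choose 2 * (x * y) = x * y * z ^ n.choose 2 := ((hx.mul_right hy).pow_left _).eq
    have h3 : z ^ n * y = y * z ^ n := (hy.pow_left n).eq
    calc x ^ n * y ^ n * z ^ n.choose 2 * (x * y) = x ^ n * (y ^ n * x) * y * z ^ n.choose 2 := by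
          rw [mul_assoc _ (z ^ _), h2]; simp only [mul_assoc]
      _ = x ^ n * x * y ^ n * (z ^ n * y) * z ^ n.choose 2 := by
          rw [h1]; simp only [mul_assoc]
      _ = _ := by rw [h3, pow_succ, pow_succ]; simp only [mul_assoc]

theorem exists_index_eq_prime_of_mem {U : Type*} [Group U] [Finite U] {p : ℕ} [hp : Fact p.Prime]
    (hU : IsPGroup p U) {a : U} (ha : Subgroup.zpowers a ≠ ⊤) :
    ∃ N : Subgroup U, a ∈ N ∧ N ≠ ⊤ ∧ p * Nat.card N = Nat.card U ∧
      (∀ u v : U, ⁅u, v⁆ ∈ N) ∧ ∀ u : U, u ^ p ∈ N := by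
  obtain ⟨n, hn⟩ := IsPGroup.iff_card.mp hU
  obtain ⟨m, hm⟩ := IsPGroup.iff_card.mp (hU.to_subgroup (Subgroup.zpowers a))
  have hmn : m < n := by
    rw [← Nat.pow_lt_pow_iff_right hp.out.one_lt, ← hn, ← hm]
    exact lt_of_le_of_ne (Subgroup.card_le_card_group _) fun h =>
      ha ((Subgroup.card_eq_iff_eq_top _).mp h)
  obtain ⟨k, rfl⟩ := Nat.exists_eq_succ_of_ne_zero (Nat.ne_zero_of_lt hmn)
  obtain ⟨N, hN, hle⟩ := Sylow.exists_subgroup_card_pow_prime_le (p := p) (m := k)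
    (by rw [hn]; exact pow_dvd_pow _ k.le_succ) (Subgroup.zpowers a) hm (Nat.lt_succ_iff.mp hmn)
  have hcard : p * Nat.card N = Nat.card U := by rw [hN, hn, pow_succ']
  have hidx : N.index = p := by
    have := N.index_mul_card
    rw [← hcard] at this
    exact Nat.eq_of_mul_eq_mul_right Nat.card_pos this
  have hNn : N.Normal := Subgroup.normal_of_index_eq_minFac_card (by
    rw [hidx, hn, hp.out.pow_minFac k.succ_ne_zero])
  have hq : Nat.card (U ⧸ N) = p := hidx
  have hcyc : IsCyclic (U ⧸ N) := isCyclic_of_prime_card hq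
  refine ⟨N, hle (Subgroup.mem_zpowers a), ?_, hcard, fun u v => ?_, fun u => ?_⟩
  · rintro rfl
    rw [Subgroup.index_top] at hidx
    exact hp.out.one_lt.ne hidx
  · rw [← QuotientGroup.eq_one_iff]
    have h1 := (IsCyclic.isMulCommutative : IsMulCommutative (U ⧸ N)).is_comm.comm
      (QuotientGroup.mk' N u) (QuotientGroup.mk' N v)
    rw [← commutatorElement_eq_one_iff_mul_comm, ← map_commutatorElement] at h1
    exact h1
  · rw [← QuotientGroup.eq_one_iff]
    change (QuotientGroup.mk' N u) ^ p = 1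
    rw [← hq, pow_card_eq_one']

/-- For odd `p`, a finite `p`-group with at most one subgroup of order `p` is abelian. -/
theorem IsPGroup.mul_comm_of_forall_pow_eq_one {U : Type*} [Group U] [Finite U] {p : ℕ}
    [hp : Fact p.Prime] (hp2 : 2 < p) (hU : IsPGroup p U) {A : Subgroup U} (hA : Nat.card A ≤ p)
    (h : ∀ u : U, u ^ p = 1 → u ∈ A) (a b : U) : a * b = b * a := by
  induction hn : Nat.card U using Nat.strong_induction_on generalizing U with
  | _ n ih =>
  subst hn
  by_contra hab
  have hsub : ∀ N : Subgroup U, N ≠ ⊤ → ∀ u ∈ N, ∀ v ∈ N, u * v = v * u := by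
    intro N hN u hu v hv
    have hlt : Nat.card N < Nat.card U := lt_of_le_of_ne (Subgroup.card_le_card_group _) fun h1 =>
      hN ((Subgroup.card_eq_iff_eq_top _).mp h1)
    have := ih _ hlt (hU.to_subgroup N) (A := A.subgroupOf N)
      ((Nat.le_of_dvd Nat.card_pos (Subgroup.card_comap_dvd_of_injective A _
        N.subtype_injective)).trans hA)
      (fun w hw => h w (by rw [← Subgroup.coe_pow, hw, Subgroup.coe_one])) ⟨u, hu⟩ ⟨v, hv⟩ rfl
    exact congrArg Subtype.val this
  have hz : ∀ u : U, (∃ v, ¬ u * v = v * u) → Subgroup.zpowers u ≠ ⊤ := by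
    rintro u ⟨v, hv⟩ h1
    have h2 : v ∈ Subgroup.zpowers u := h1 ▸ Subgroup.mem_top v
    obtain ⟨m, rfl⟩ := h2
    exact hv ((Commute.refl u).zpow_right m).eq
  obtain ⟨N₁, ha, hN₁, hc₁, hcomm₁, hpow₁⟩ := exists_index_eq_prime_of_mem hU (hz a ⟨b, hab⟩)
  obtain ⟨N₂, hb, hN₂, hc₂, hcomm₂, hpow₂⟩ :=
    exists_index_eq_prime_of_mem hU (hz b ⟨a, fun h => hab h.symm⟩)
  have hlt : N₁ ⊓ N₂ < N₁ := lt_of_le_of_ne inf_le_left fun h1 => by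
    have : a ∈ N₂ := (inf_eq_left.mp h1) ha
    exact hab (hsub N₂ hN₂ a this b hb)
  have hsup : N₁ ⊔ N₂ = ⊤ := by
    by_contra h1
    exact hab (hsub _ h1 a (le_sup_left (a := N₁) ha) b (le_sup_right (b := N₂) hb))
  have hcen : N₁ ⊓ N₂ ≤ Subgroup.center U := by
    intro z hz
    have h1 : N₁ ⊔ N₂ ≤ Subgroup.centralizer {z} := sup_le
      (fun u hu => Subgroup.mem_centralizer_singleton_iff.mpr (hsub N₁ hN₁ u hu z hz.1))
      (fun u hu => Subgroup.mem_centralizer_singleton_iff.mpr (hsub N₂ hN₂ u hu z hz.2))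
    rw [hsup] at h1
    exact Subgroup.mem_center_iff.mpr fun g =>
      Subgroup.mem_centralizer_singleton_iff.mp (h1 (Subgroup.mem_top g))
  have hcc : ∀ u v w : U, Commute ⁅u, v⁆ w := fun u v w =>
    (Subgroup.mem_center_iff.mp (hcen ⟨hcomm₁ u v, hcomm₂ u v⟩) w).symm
  have hcp : ∀ u v : U, ⁅u, v⁆ ^ p = 1 := by
    intro u v
    have h1 : ∀ n : ℕ, ⁅u, v⁆ ^ n = ⁅u ^ n, v⁆ := fun n => by
      induction n with
      | zero => simp
      | succ n ih =>
        have h2 : ⁅u ^ (n + 1), v⁆ = u * ⁅u ^ n, v⁆ * u⁻¹ * ⁅u, v⁆ := by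
          rw [commutatorElement_def, commutatorElement_def, commutatorElement_def, pow_succ']
          group
        rw [h2, ← (hcc (u ^ n) v u).eq, mul_inv_cancel_right, ← ih, pow_succ]
    rw [h1, commutatorElement_eq_one_iff_mul_comm]
    exact (Subgroup.mem_center_iff.mp (hcen ⟨hpow₁ u, hpow₂ u⟩) v).symm
  have hch : p ∣ p.choose 2 := hp.out.dvd_choose_self two_ne_zero hp2
  let f : U →* (N₁ ⊓ N₂ : Subgroup U) :=
    { toFun := fun u => ⟨u ^ p, hpow₁ u, hpow₂ u⟩
      map_one' := Subtype.ext (one_pow p)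
      map_mul' := fun u v => Subtype.ext (by
        change (u * v) ^ p = u ^ p * v ^ p
        obtain ⟨k, hk⟩ := hch
        rw [mul_pow_of_commute_commutatorElement (hcc _ _ _) (hcc _ _ _), hk, pow_mul, hcp,
          one_pow, mul_one]) }
  have hker : Nat.card f.ker ≤ p :=
    (Subgroup.card_le_of_le fun u hu => h u (congrArg Subtype.val (MonoidHom.mem_ker.mp hu))).trans hA
  have hcardU : Nat.card U = Nat.card f.range * Nat.card f.ker := by
    rw [← Subgroup.index_ker, Subgroup.index_mul_card]
  have h1 : Nat.card f.range ≤ Nat.card (N₁ ⊓ N₂ : Subgroup U) := Subgroup.card_le_card_group _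
  have h2 : Nat.card (N₁ ⊓ N₂ : Subgroup U) < Nat.card N₁ := Set.ncard_lt_ncard hlt
  have h3 := Nat.mul_le_mul h1 hker
  rw [← hcardU, ← hc₁, mul_comm] at h3
  exact absurd (Nat.le_of_mul_le_mul_right h3 hp.out.pos) (not_le.mpr h2)

end UniqueSubgroup

section Coprime

variable {G : Type*} [Group G] {p : ℕ}

theorem closure_le_of_mem {H : Subgroup G} {a b : G} (ha : a ∈ H) (hb : b ∈ H) :
    Subgroup.closure {a, b} ≤ H := by
  rw [Subgroup.closure_le]
  rintro y (rfl | rfl)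
  exacts [ha, hb]

theorem left_mem_closure_pair (a b : G) : a ∈ Subgroup.closure ({a, b} : Set G) :=
  Subgroup.subset_closure (Set.mem_insert _ _)

theorem right_mem_closure_pair (a b : G) : b ∈ Subgroup.closure ({a, b} : Set G) :=
  Subgroup.subset_closure (Set.mem_insert_of_mem _ rfl)

theorem conj_mem_closure_pair (x g : G) :
    g⁻¹ * x * g ∈ Subgroup.closure ({x, g} : Set G) :=
  mul_mem (mul_mem (inv_mem (right_mem_closure_pair _ _)) (left_mem_closure_pair _ _))
    (right_mem_closure_pair _ _)

theorem not_dvd_card_of_le [Finite G] {H K : Subgroup G} (h : H ≤ K) (hK : ¬ p ∣ Nat.card K) :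
    ¬ p ∣ Nat.card H :=
  fun hd => hK (hd.trans (Subgroup.card_dvd_of_le h))

theorem eq_one_of_pow_eq_one_of_mem [Finite G] [hp : Fact p.Prime] {K : Subgroup G}
    (hK : ¬ p ∣ Nat.card K) {e : G} (he : e ^ p = 1) (heK : e ∈ K) : e = 1 := by
  by_contra h
  exact hK ((orderOf_eq_prime he h).symm ▸ K.orderOf_dvd_natCard heK)

theorem mem_zpowers_of_mem_zpowers_of_orderOf_eq [Finite G] [hp : Fact p.Prime] {x s : G}
    (hx : orderOf x = p) (hs : s ∈ Subgroup.zpowers x) (h1 : s ≠ 1) : x ∈ Subgroup.zpowers s := by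
  have h2 : orderOf s = orderOf x := by
    have h3 := orderOf_dvd_of_mem_zpowers hs
    rw [hx] at h3 ⊢
    exact ((Nat.dvd_prime hp.out).mp h3).resolve_left fun h => h1 (orderOf_eq_one_iff.mp h)
  rw [Subgroup.eq_of_le_of_card_ge (Subgroup.zpowers_le.mpr hs)
    (by rw [Nat.card_zpowers, Nat.card_zpowers, h2])]
  exact Subgroup.mem_zpowers x

/-- If `x` normalizes a `p'`-subgroup `K` and `k ∈ K`, then `x` and its conjugate by `k` are
conjugate by an element of `K` which lies in the subgroup generated by both. -/
theorem exists_mem_closure_conj_eq [Finite G] [Fact p.Prime] {K : Subgroup G}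
    (hK : ¬ p ∣ Nat.card K) {x k₀ : G} (hx : x ∈ Subgroup.normalizer (K : Set G))
    (hxp : x ^ p = 1) (hk₀ : k₀ ∈ K) :
    ∃ k ∈ K, k ∈ Subgroup.closure ({x, k₀⁻¹ * x * k₀} : Set G) ∧ Commute (k₀ * k⁻¹) x := by
  set B := Subgroup.closure ({x, k₀⁻¹ * x * k₀} : Set G) with hB
  have hxB : x ∈ B := left_mem_closure_pair _ _
  have h1 : k₀⁻¹ * (x * k₀ * x⁻¹) ∈ B ⊓ K := by
    refine ⟨?_, K.mul_mem (K.inv_mem hk₀) ((Subgroup.mem_normalizer_iff.mp hx _).mp hk₀)⟩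
    have h2 : k₀⁻¹ * x * k₀ ∈ B := right_mem_closure_pair _ _
    have := B.mul_mem h2 (B.inv_mem hxB)
    rwa [show k₀⁻¹ * x * k₀ * x⁻¹ = k₀⁻¹ * (x * k₀ * x⁻¹) by group] at this
  have hN : x ∈ Subgroup.normalizer ((B ⊓ K : Subgroup G) : Set G) :=
    mem_normalizer_inf (Subgroup.le_normalizer hxB) hx
  obtain ⟨k, ⟨hkB, hk⟩, hc⟩ := exists_commute_mul_of_not_dvd_card
    (not_dvd_card_of_le inf_le_right hK) hN (isPGroup_zpowers_of_pow_eq_one hxp) h1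
  exact ⟨k⁻¹, K.inv_mem hk, B.inv_mem hkB, by rwa [inv_inv]⟩

end Coprime

/-- A minimal nonsolvable group whose two-generated subgroups are solvable, together with a
strongly `p`-embedded subgroup `M`, a normal abelian `p`-subgroup `D` of `M` and an element
`x ∈ D` of order `p` which is central in a Sylow `p`-subgroup `P`. -/
structure IsStronglyEmbedded {G : Type*} [Group G] (p : ℕ) (M D P : Subgroup G) (x : G) : Prop where
  minimal : IsMinimalNonsolvable G
  two_lt : 2 < p
  ne_top : M ≠ ⊤
  normalizer_le : ∀ R ≤ M, IsPGroup p R → R ≠ ⊥ → Subgroup.normalizer (R : Set G) ≤ M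
  isSyl : IsSyl p P ⊤
  orderOf_eq : orderOf x = p
  commute : ∀ s ∈ P, Commute s x
  mem : x ∈ D
  le : D ≤ M
  isPGroup : IsPGroup p D
  comm : ∀ d ∈ D, Commute d x
  le_normalizer : M ≤ Subgroup.normalizer (D : Set G)

namespace IsStronglyEmbedded

variable {G : Type*} [Group G] [Finite G] {p : ℕ} [hp : Fact p.Prime] {M D P : Subgroup G} {x : G}

omit [Finite G] hp in
theorem dvd_card (h : IsStronglyEmbedded p M D P x) : p ∣ Nat.card G :=
  h.orderOf_eq ▸ orderOf_dvd_natCard x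

omit [Finite G] hp in
theorem pow_eq_one (h : IsStronglyEmbedded p M D P x) : x ^ p = 1 := by
  rw [← h.orderOf_eq, pow_orderOf_eq_one]

omit [Finite G] in
theorem ne_one (h : IsStronglyEmbedded p M D P x) : x ≠ 1 := fun h1 =>
  hp.out.one_lt.ne (by rw [← h.orderOf_eq, h1, orderOf_one])

omit [Finite G] hp in
theorem mem_M (h : IsStronglyEmbedded p M D P x) : x ∈ M :=
  h.le h.mem

omit [Finite G] in
theorem isPGroup_zpowers (h : IsStronglyEmbedded p M D P x) : IsPGroup p (Subgroup.zpowers x) :=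
  isPGroup_zpowers_of_pow_eq_one h.pow_eq_one

omit [Finite G] in
theorem zpowers_ne_bot (h : IsStronglyEmbedded p M D P x) : Subgroup.zpowers x ≠ ⊥ :=
  fun h1 => h.ne_one (Subgroup.zpowers_eq_bot.mp h1)

omit [Finite G] in
theorem normalizer_zpowers_le (h : IsStronglyEmbedded p M D P x) {e : G} (he : e ∈ M)
    (hep : e ^ p = 1) (he1 : e ≠ 1) :
    Subgroup.normalizer (Subgroup.zpowers e : Set G) ≤ M :=
  h.normalizer_le _ (Subgroup.zpowers_le.mpr he) (isPGroup_zpowers_of_pow_eq_one hep)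
    fun h1 => he1 (Subgroup.zpowers_eq_bot.mp h1)

omit [Finite G] in
theorem mem_of_commute (h : IsStronglyEmbedded p M D P x) {e c : G} (he : e ∈ M)
    (hep : e ^ p = 1) (he1 : e ≠ 1) (hc : Commute c e) : c ∈ M := by
  refine h.normalizer_zpowers_le he hep he1 (Subgroup.centralizer_le_normalizer _ ?_)
  rw [Subgroup.mem_centralizer_iff]
  rintro _ ⟨n, rfl⟩
  exact (hc.zpow_right n).symm.eq

theorem piCoreOf_eq_bot (h : IsStronglyEmbedded p M D P x) {H : Subgroup G} (hx : x ∈ H)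
    (hHM : ¬ H ≤ M) : piCoreOf {p} H = ⊥ := by
  by_contra hR
  set R := piCoreOf {p} H with hRdef
  have hRp : IsPGroup p R := isPiSubgroup_singleton.mp (isPiSubgroup_piCoreOf _ _)
  have hHR : H ≤ Subgroup.normalizer (R : Set G) := le_normalizer_piCoreOf _ _
  have hxR : Subgroup.zpowers x ≤ Subgroup.normalizer (R : Set G) := by
    rw [Subgroup.zpowers_le]
    exact hHR hx
  obtain ⟨z, hz, hzp, hc⟩ := (h.isPGroup_zpowers.to_sup_of_normal_right' hRp hxR)
    |>.exists_orderOf_eq_commute hRp (sup_le hxR Subgroup.le_normalizer) hR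
  have hz1 : z ≠ 1 := fun h1 => hp.out.one_lt.ne (by rw [← hzp, h1, orderOf_one])
  have hzM : z ∈ M := h.mem_of_commute h.mem_M h.pow_eq_one h.ne_one
    (hc x ((le_sup_left : Subgroup.zpowers x ≤ _) (Subgroup.mem_zpowers x)))
  have hRM : R ≤ M := fun r hr => h.mem_of_commute hzM (by rw [← hzp, pow_orderOf_eq_one]) hz1
    (hc r ((le_sup_right : R ≤ _) hr)).symm
  exact hHM (hHR.trans (h.normalizer_le R hRM hRp hR))

theorem commute_of_le (h : IsStronglyEmbedded p M D P x) {N : Subgroup G} (hN : N ≤ M)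
    (hpN : ¬ p ∣ Nat.card N) (hx : x ∈ Subgroup.normalizer (N : Set G)) {n : G} (hn : n ∈ N) :
    Commute n x := by
  rw [← commutatorElement_eq_one_iff_commute]
  have h1 : ⁅n, x⁆ ∈ D ⊓ N :=
    ⟨commutatorElement_mem_of_mem_normalizer' h.mem (h.le_normalizer (hN hn)),
      commutatorElement_mem_of_mem_normalizer hn hx⟩
  rwa [(disjoint_of_isPGroup_of_not_dvd h.isPGroup hpN).eq_bot, Subgroup.mem_bot] at h1

theorem not_dvd_card_piCoreOf (p : ℕ) [hp : Fact p.Prime] (H : Subgroup G) :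
    ¬ p ∣ Nat.card (piCoreOf {p}ᶜ H) :=
  (isPiSubgroup_compl_singleton hp.out).mp (isPiSubgroup_piCoreOf _ _)

theorem notMem_of_not_dvd (h : IsStronglyEmbedded p M D P x) {N : Subgroup G}
    (hN : ¬ p ∣ Nat.card N) : x ∉ N :=
  fun hx => h.ne_one (eq_one_of_pow_eq_one_of_mem hN h.pow_eq_one hx)

theorem exists_not_commute (h : IsStronglyEmbedded p M D P x) {H : Subgroup G} (hx : x ∈ H)
    (hH : H ≠ ⊤) (hHM : ¬ H ≤ M) : ∃ k ∈ piCoreOf {p}ᶜ H, ¬ Commute k x := by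
  by_contra! hc
  have := h.minimal.proper H hH
  have h1 : piCore {p} H = ⊥ :=
    (Subgroup.map_eq_bot_iff_of_injective _ H.subtype_injective).mp (h.piCoreOf_eq_bot hx hHM)
  have h2 := centralizer_piCore_le (π := {p}ᶜ) (G := H) (by rwa [compl_compl])
  refine h.notMem_of_not_dvd (not_dvd_card_piCoreOf p H) ⟨⟨x, hx⟩, h2 ?_, rfl⟩
  rw [Subgroup.mem_centralizer_iff]
  exact fun k hk => Subtype.ext (hc k ⟨k, hk, rfl⟩).eq

omit [Finite G] hp in
theorem closure_ne_top (h : IsStronglyEmbedded p M D P x) (a b : G) :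
    Subgroup.closure ({a, b} : Set G) ≠ ⊤ := fun h1 => by
  have := h.minimal.two_generated a b
  rw [h1] at this
  exact h.minimal.not_solvable (Group.isSolvable_of_surjective
    (f := (Subgroup.topEquiv (G := G)).toMonoidHom) Subgroup.topEquiv.surjective)

theorem mem_zpowers (h : IsStronglyEmbedded p M D P x) {c : G} (hcx : Commute c x)
    (hcp : c ^ p = 1) : c ∈ Subgroup.zpowers x := by
  by_contra hc
  obtain ⟨g, -, hg⟩ := SetLike.exists_of_lt (lt_top_iff_ne_top.mpr h.ne_top)
  obtain ⟨k₀, hk₀, hk₀x⟩ := h.exists_not_commute (left_mem_closure_pair x g) (h.closure_ne_top x g)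
    (fun h1 => hg (h1 (right_mem_closure_pair x g)))
  obtain ⟨k, hk, hkB, hkc⟩ := exists_mem_closure_conj_eq (not_dvd_card_piCoreOf p _)
    (le_normalizer_piCoreOf _ _ (left_mem_closure_pair x g)) h.pow_eq_one hk₀
  have hkx : ¬ Commute k x := fun h1 => hk₀x (by simpa using hkc.mul_left h1)
  have hconj : k₀⁻¹ * x * k₀ = (c * k)⁻¹ * x * (c * k) := by
    have h1 : k₀ * k⁻¹ * x = x * (k₀ * k⁻¹) := hkc.eq
    have h2 : c * x = x * c := hcx.eq
    have h3 : c⁻¹ * x * c = x := by rw [mul_assoc, ← h2, inv_mul_cancel_left]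
    have h4 : (k₀ * k⁻¹)⁻¹ * x * (k₀ * k⁻¹) = x := by
      rw [mul_assoc, ← h1, inv_mul_cancel_left]
    calc k₀⁻¹ * x * k₀ = k⁻¹ * ((k₀ * k⁻¹)⁻¹ * x * (k₀ * k⁻¹)) * k := by group
      _ = k⁻¹ * (c⁻¹ * x * c) * k := by rw [h3, h4]
      _ = _ := by group
  set L := Subgroup.closure ({x, c * k} : Set G) with hL
  have hBL : Subgroup.closure ({x, k₀⁻¹ * x * k₀} : Set G) ≤ L :=
    closure_le_of_mem (left_mem_closure_pair _ _) (hconj ▸ conj_mem_closure_pair _ _)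
  have hxL : x ∈ L := left_mem_closure_pair _ _
  have hcL : c ∈ L := by
    have := L.mul_mem (right_mem_closure_pair x (c * k)) (L.inv_mem (hBL hkB))
    rwa [mul_inv_cancel_right] at this
  have hLM : ¬ L ≤ M := by
    intro hLM
    refine hkx (h.commute_of_le (N := Subgroup.closure ({x, k₀⁻¹ * x * k₀} : Set G) ⊓
      piCoreOf {p}ᶜ (Subgroup.closure ({x, g} : Set G))) (inf_le_left.trans (hBL.trans hLM))
      (not_dvd_card_of_le inf_le_right (not_dvd_card_piCoreOf p _))
      (mem_normalizer_inf (Subgroup.le_normalizer (left_mem_closure_pair _ _))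
        (le_normalizer_piCoreOf _ _ (left_mem_closure_pair x g))) ⟨hkB, hk⟩)
  obtain ⟨l, hl, hlx⟩ := h.exists_not_commute hxL (h.closure_ne_top _ _) hLM
  have hsol : Group.IsSolvable L := h.minimal.proper _ (h.closure_ne_top _ _)
  refine hlx (commute_of_forall_commute_pow_mul (c := c)
    (Group.isSolvable_of_isSolvable_injective
      (Subgroup.inclusion_injective (piCoreOf_le {p}ᶜ L))) (not_dvd_card_piCoreOf p L)
    (le_normalizer_piCoreOf _ _ hxL) (le_normalizer_piCoreOf _ _ hcL) hcx.symm h.pow_eq_one hcp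
    (fun i k hk hke => ?_) l hl)
  have hex : Commute (x ^ i * c) x := ((Commute.refl x).pow_left i).mul_left hcx
  have he1 : x ^ i * c ≠ 1 := fun h1 => hc (by
    rw [eq_inv_of_mul_eq_one_right h1]
    exact inv_mem (pow_mem (Subgroup.mem_zpowers x) i))
  have hep : (x ^ i * c) ^ p = 1 := by
    rw [(hcx.symm.pow_left i).mul_pow, hcp, mul_one, ← pow_mul, mul_comm, pow_mul, h.pow_eq_one,
      one_pow]
  have heM := h.mem_of_commute h.mem_M h.pow_eq_one h.ne_one hex
  refine h.commute_of_le (N := piCoreOf {p}ᶜ L ⊓ Subgroup.centralizer {x ^ i * c})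
    (fun y hy => h.mem_of_commute heM hep he1 (Subgroup.mem_centralizer_singleton_iff.mp hy.2))
    (not_dvd_card_of_le inf_le_left (not_dvd_card_piCoreOf p L))
    (mem_normalizer_inf (le_normalizer_piCoreOf _ _ hxL) (Subgroup.le_normalizer
      (Subgroup.mem_centralizer_singleton_iff.mpr hex.symm.eq)))
    ⟨hk, Subgroup.mem_centralizer_singleton_iff.mpr hke.eq⟩

theorem zpowers_eq_zpowers (h : IsStronglyEmbedded p M D P x) {c : G} (hcx : Commute c x)
    (hcp : c ^ p = 1) (hc1 : c ≠ 1) : Subgroup.zpowers c = Subgroup.zpowers x :=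
  le_antisymm (Subgroup.zpowers_le.mpr (h.mem_zpowers hcx hcp)) (Subgroup.zpowers_le.mpr
    (mem_zpowers_of_mem_zpowers_of_orderOf_eq h.orderOf_eq (h.mem_zpowers hcx hcp) hc1))

theorem eq_normalizer (h : IsStronglyEmbedded p M D P x) :
    M = Subgroup.normalizer (Subgroup.zpowers x : Set G) := by
  refine le_antisymm (fun m hm => ?_)
    (h.normalizer_zpowers_le h.mem_M h.pow_eq_one h.ne_one)
  have h1 : m * x * m⁻¹ ∈ D := (Subgroup.mem_normalizer_iff.mp (h.le_normalizer hm) x).mp h.mem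
  have h2 := h.zpowers_eq_zpowers (h.comm _ h1)
    (by rw [conj_pow, h.pow_eq_one, mul_one, mul_inv_cancel])
    (fun h3 => h.ne_one (by rwa [conj_eq_one_iff] at h3))
  rw [Subgroup.mem_normalizer_iff_map_conj_eq, MonoidHom.map_zpowers]
  exact h2

end IsStronglyEmbedded

namespace IsStronglyEmbedded

variable {G : Type*} [Group G] [Finite G] {p : ℕ} [hp : Fact p.Prime] {M D P : Subgroup G} {x : G}

omit [Finite G] in
theorem mem_centralizer_M (h : IsStronglyEmbedded p M D P x) {c : G} (hc : Commute c x) : c ∈ M :=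
  h.mem_of_commute h.mem_M h.pow_eq_one h.ne_one hc

theorem isPGroup_centralizer (h : IsStronglyEmbedded p M D P x) :
    IsPGroup p (Subgroup.centralizer {x}) := by
  set C := Subgroup.centralizer {x} with hC
  have := h.minimal.simple
  have hCM : C ≤ M := fun c hc => h.mem_centralizer_M (Subgroup.mem_centralizer_singleton_iff.mp hc)
  have hsol : Group.IsSolvable C :=
    h.minimal.proper C fun h1 => h.ne_top (top_le_iff.mp (h1 ▸ hCM))
  have hcore : piCore {p}ᶜ C = ⊥ := by
    refine (Subgroup.map_eq_bot_iff_of_injective _ C.subtype_injective).mp ?_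
    exact eq_bot_of_centralizer_le_normalizer (p := p) (e := x) h.minimal.two_generated h.dvd_card
      h.isPGroup_zpowers (not_dvd_card_piCoreOf p C) (piCoreOf_le _ _) (le_normalizer_piCoreOf _ _)
  set U := piCore {p} C with hU
  have hUp : IsPGroup p U := isPiSubgroup_singleton.mp (isPiSubgroup_piCore _)
  have hcomm : ∀ c : C, Commute (c : G) x := fun c =>
    Subgroup.mem_centralizer_singleton_iff.mp c.2
  have hz : ∀ u : C, u ^ p = 1 → (u : G) ∈ Subgroup.zpowers x := fun u hu =>
    h.mem_zpowers (hcomm u) (by rw [← Subgroup.coe_pow, hu, Subgroup.coe_one])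
  have hxC : x ∈ C := Subgroup.mem_centralizer_singleton_iff.mpr rfl
  have hUc : ∀ a b : U, a * b = b * a := by
    refine hUp.mul_comm_of_forall_pow_eq_one h.two_lt
      (A := (Subgroup.zpowers (⟨x, hxC⟩ : C)).subgroupOf U) ?_ fun u hu => ?_
    · refine (Nat.le_of_dvd Nat.card_pos (Subgroup.card_comap_dvd_of_injective _ _
        U.subtype_injective)).trans ?_
      rw [Nat.card_zpowers, ← Subgroup.orderOf_coe, h.orderOf_eq]
    · obtain ⟨n, hn⟩ := hz u (by rw [← Subgroup.coe_pow, hu, Subgroup.coe_one])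
      exact ⟨n, Subtype.ext hn⟩
  have key : ∀ s : C, ∀ q : ℕ, q.Prime → orderOf s = q → q = p := by
    intro s q hq hs
    by_contra hqp
    have hmem : ∀ u ∈ U, ⁅u, s⁆ ∈ U := fun u hu => by
      rw [commutatorElement_def, mul_assoc, mul_assoc, ← mul_assoc s]
      exact U.mul_mem hu (Subgroup.Normal.conj_mem inferInstance _ (U.inv_mem hu) _)
    let φ : U →* U := MonoidHom.mk' (fun u => ⟨⁅(u : C), s⁆, hmem u u.2⟩) fun a b => by
      refine Subtype.ext ?_
      have h1 : (a : C) * ⁅(b : C), s⁆ = ⁅(b : C), s⁆ * a :=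
        congrArg Subtype.val (hUc a ⟨_, hmem b b.2⟩)
      have h2 : ⁅(b : C), s⁆ * ⁅(a : C), s⁆ = ⁅(a : C), s⁆ * ⁅(b : C), s⁆ :=
        congrArg Subtype.val (hUc ⟨_, hmem b b.2⟩ ⟨_, hmem a a.2⟩)
      change ⁅(a * b : C), s⁆ = ⁅(a : C), s⁆ * ⁅(b : C), s⁆
      rw [← h2]
      calc ⁅(a * b : C), s⁆ = a * ⁅(b : C), s⁆ * (a : C)⁻¹ * ⁅(a : C), s⁆ := by
            simp only [commutatorElement_def]; group
        _ = _ := by rw [h1]; group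
    have hφ : ∀ u, φ u = 1 := by
      by_contra! hu
      obtain ⟨u, hu⟩ := hu
      obtain ⟨v, hv⟩ : ∃ v : U, orderOf (φ v) = p := ⟨u ^ (orderOf (φ u) / p), by
        rw [map_pow]
        exact orderOf_pow_orderOf_div (orderOf_pos _).ne' (hUp.dvd_orderOf hu)⟩
      set w : C := (φ v : U).1 with hw
      have hwo : orderOf w = p := by rw [hw, Subgroup.orderOf_coe, hv]
      have hws : Commute w s := by
        obtain ⟨i, hi⟩ := hz w (by rw [← hwo, pow_orderOf_eq_one])
        have h1 : Commute (x ^ i) (s : G) := ((hcomm s).symm).zpow_left i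
        exact Subtype.ext ((hi : x ^ i = (w : G)) ▸ h1 : Commute (w : G) s).eq
      have h1 : w * s = v * s * (v : C)⁻¹ := by
        rw [hw]
        change ⁅(v : C), s⁆ * s = _
        rw [commutatorElement_def, inv_mul_cancel_right]
      have h2 : w ^ q = 1 := by
        have h3 := hws.mul_pow q
        have h4 : s ^ q = 1 := hs ▸ pow_orderOf_eq_one s
        rwa [h1, conj_pow, h4, mul_one, mul_inv_cancel, mul_one, eq_comm] at h3
      exact hqp ((Nat.prime_dvd_prime_iff_eq hp.out hq).mp
        (hwo ▸ orderOf_dvd_of_pow_eq_one h2)).symm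
    have hsU : s ∈ U := by
      refine centralizer_piCore_le hcore ?_
      rw [Subgroup.mem_centralizer_iff]
      exact fun u hu => commutatorElement_eq_one_iff_mul_comm.mp
        (congrArg Subtype.val (hφ ⟨u, hu⟩))
    have h1 : p ∣ orderOf (⟨s, hsU⟩ : U) := hUp.dvd_orderOf fun h1 => hq.one_lt.ne (by
      rw [← hs, show s = 1 from congrArg Subtype.val h1, orderOf_one])
    rw [← Subgroup.orderOf_coe, hs] at h1
    exact hqp ((Nat.prime_dvd_prime_iff_eq hp.out hq).mp h1).symm
  rw [isPGroup_iff_primeFactors_card_subset hp.out.ne_zero]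
  intro q hq
  have := Fact.mk (Nat.prime_of_mem_primeFactors hq)
  obtain ⟨s, hs⟩ := exists_prime_orderOf_dvd_card' q (Nat.dvd_of_mem_primeFactors hq)
  rw [key s q this.out hs]
  exact Nat.mem_primeFactors.mpr ⟨hp.out, dvd_rfl, hp.out.ne_zero⟩

theorem eq_one_of_commute (h : IsStronglyEmbedded p M D P x) {N : Subgroup G}
    (hN : ¬ p ∣ Nat.card N) {n : G} (hn : n ∈ N) (hc : Commute n x) : n = 1 := by
  have h1 := disjoint_of_isPGroup_of_not_dvd h.isPGroup_centralizer hN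
  exact Subgroup.disjoint_def.mp h1 (Subgroup.mem_centralizer_singleton_iff.mpr hc.eq) hn

/-- Every element of an `x`-invariant `p'`-subgroup is a commutator with `x`. -/
theorem exists_eq_inv_mul_conj (h : IsStronglyEmbedded p M D P x) {N : Subgroup G}
    (hN : ¬ p ∣ Nat.card N) (hx : x ∈ Subgroup.normalizer (N : Set G)) {m : G} (hm : m ∈ N) :
    ∃ n ∈ N, n⁻¹ * x * n * x⁻¹ = m := by
  let φ : N → N := fun n => ⟨(n : G)⁻¹ * x * n * x⁻¹, by
    rw [mul_assoc, mul_assoc, ← mul_assoc x]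
    exact N.mul_mem (N.inv_mem n.2) ((Subgroup.mem_normalizer_iff.mp hx _).mp n.2)⟩
  have hφ : Function.Injective φ := by
    intro a b hab
    have h1 : (a : G)⁻¹ * x * a * x⁻¹ = (b : G)⁻¹ * x * b * x⁻¹ := congrArg Subtype.val hab
    have h2 : (a : G)⁻¹ * x * a = (b : G)⁻¹ * x * b := mul_right_cancel h1
    have h3 : Commute ((b : G) * (a : G)⁻¹) x := by
      change (b : G) * (a : G)⁻¹ * x = x * (b * (a : G)⁻¹)
      calc (b : G) * (a : G)⁻¹ * x = b * ((a : G)⁻¹ * x * a) * (a : G)⁻¹ := by group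
        _ = _ := by rw [h2]; group
    exact Subtype.ext (mul_inv_eq_one.mp (h.eq_one_of_commute hN
      (N.mul_mem b.2 (N.inv_mem a.2)) h3)).symm
  obtain ⟨n, hn⟩ := Finite.surjective_of_injective hφ ⟨m, hm⟩
  exact ⟨n, n.2, congrArg Subtype.val hn⟩

/-- An `x`-invariant `p'`-subgroup `K` satisfies `k ∈ ⟨x, xᵏ⟩` for all `k ∈ K`. -/
theorem mem_closure_conj (h : IsStronglyEmbedded p M D P x) {K : Subgroup G}
    (hK : ¬ p ∣ Nat.card K) (hx : x ∈ Subgroup.normalizer (K : Set G)) {k : G} (hk : k ∈ K) :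
    k ∈ Subgroup.closure ({x, k⁻¹ * x * k} : Set G) := by
  obtain ⟨k', hk', hcl, hc⟩ := exists_mem_closure_conj_eq hK hx h.pow_eq_one hk
  have h1 := mul_inv_eq_one.mp (h.eq_one_of_commute hK (K.mul_mem hk (K.inv_mem hk')) hc)
  exact h1 ▸ hcl

omit [Finite G] in
theorem of_mem_zpowers (h : IsStronglyEmbedded p M D P x) {c : G} (hc : c ∈ Subgroup.zpowers x)
    (hc1 : c ≠ 1) : IsStronglyEmbedded p M D P c := by
  have hcomm : ∀ g, Commute g x → Commute g c := by
    obtain ⟨i, rfl⟩ := hc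
    exact fun g hg => hg.zpow_right i
  refine { h with orderOf_eq := ?_, commute := ?_, mem := ?_, comm := ?_ }
  · have h1 := orderOf_dvd_of_mem_zpowers hc
    rw [h.orderOf_eq] at h1
    exact ((Nat.dvd_prime hp.out).mp h1).resolve_left fun h2 => hc1 (orderOf_eq_one_iff.mp h2)
  · exact fun s hs => hcomm s (h.commute s hs)
  · exact Subgroup.zpowers_le.mpr h.mem hc
  · exact fun d hd => hcomm d (h.comm d hd)

/-- Modulo the largest normal `p'`-subgroup of `H`, the element `x` generates a normal subgroup. -/
theorem zpowers_quotient_normal (h : IsStronglyEmbedded p M D P x) {H : Subgroup G} (hx : x ∈ H)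
    (hH : H ≠ ⊤) :
    (Subgroup.zpowers (QuotientGroup.mk' (piCore {p}ᶜ H) ⟨x, hx⟩)).Normal := by
  have hsol := h.minimal.proper H hH
  set K := piCore {p}ᶜ H with hK
  set f := QuotientGroup.mk' K with hf
  have hfs : Function.Surjective f := QuotientGroup.mk'_surjective K
  have hKp : ¬ p ∣ Nat.card K := (isPiSubgroup_compl_singleton hp.out).mp (isPiSubgroup_piCore _)
  set V := piCore {p} (H ⧸ K) with hV
  have hVp : IsPGroup p V := isPiSubgroup_singleton.mp (isPiSubgroup_piCore _)
  have hcen := centralizer_piCore_le (G := H ⧸ K) (π := {p}) (piCore_quotient_eq_bot _)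
  set y : H := ⟨x, hx⟩ with hy
  have hyp : y ^ p = 1 := Subtype.ext h.pow_eq_one
  have hfy1 : f y ≠ 1 := fun h1 => h.ne_one (congrArg Subtype.val (eq_one_of_pow_eq_one_of_mem hKp
    hyp ((QuotientGroup.eq_one_iff y).mp h1)))
  have hfyp : (f y) ^ p = 1 := by rw [← map_pow, hyp, map_one]
  have hV1 : V ≠ ⊥ := by
    intro h1
    rw [← hV, h1] at hcen
    refine hfy1 (Subgroup.mem_bot.mp (hcen ?_))
    rw [Subgroup.mem_centralizer_iff]
    rintro z hz
    rw [Subgroup.mem_bot.mp hz, one_mul, mul_one]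
  obtain ⟨S, hyS⟩ := (isPGroup_zpowers_of_pow_eq_one hyp).exists_le_sylow
  have hSK : Disjoint (S : Subgroup H) K := disjoint_of_isPGroup_of_not_dvd S.isPGroup' hKp
  have hsK : ∀ t ∈ S, f t = 1 → t = 1 := fun t ht h1 =>
    Subgroup.disjoint_def.mp hSK ht ((QuotientGroup.eq_one_iff t).mp h1)
  have hyS' : y ∈ S := hyS (Subgroup.mem_zpowers y)
  set T := S.mapSurjective hfs with hT
  have hlift : ∀ z ∈ V, z ^ p = 1 → Commute z (f y) → z ∈ Subgroup.zpowers (f y) := by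
    intro z hz hzp hzy
    obtain ⟨s, hs, rfl⟩ := hVp.le_sylow_of_normal T hz
    have hsy : Commute s y := by
      rw [← commutatorElement_eq_one_iff_commute]
      refine hsK _ ?_ ?_
      · exact mul_mem (mul_mem (mul_mem hs hyS') (inv_mem hs)) (inv_mem hyS')
      · rwa [map_commutatorElement, commutatorElement_eq_one_iff_commute]
    have hsp : s ^ p = 1 := hsK _ (pow_mem hs p) (by rw [map_pow, hzp])
    obtain ⟨i, hi⟩ := h.mem_zpowers (congrArg Subtype.val hsy) (congrArg Subtype.val hsp)
    exact ⟨i, by rw [show s = y ^ i from Subtype.ext hi.symm, map_zpow]⟩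
  obtain ⟨z, hz, hzp, hzc⟩ := T.isPGroup'.exists_orderOf_eq_commute hVp
    (by rw [Subgroup.normalizer_eq_top]; exact le_top) hV1
  have hz1 : z ≠ 1 := fun h1 => hp.out.one_lt.ne (by rw [← hzp, h1, orderOf_one])
  have hzy : f y ∈ Subgroup.zpowers z := mem_zpowers_of_mem_zpowers_of_orderOf_eq
    (orderOf_eq_prime hfyp hfy1)
    (hlift z hz (by rw [← orderOf_dvd_iff_pow_eq_one, hzp]) (hzc _ ⟨y, hyS', rfl⟩)) hz1
  have hyV : f y ∈ V := Subgroup.zpowers_le.mpr hz hzy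
  have hyc : ∀ v ∈ V, Commute (f y) v := by
    obtain ⟨i, hi⟩ := hzy
    intro v hv
    rw [← hi]
    exact (hzc v (hVp.le_sylow_of_normal T hv)).zpow_left i
  refine ⟨?_⟩
  rintro _ ⟨i, rfl⟩ g
  change g * f y ^ i * g⁻¹ ∈ _
  rw [← conj_zpow]
  refine zpow_mem (hlift _ ((inferInstance : V.Normal).conj_mem _ hyV g)
    (by rw [conj_pow, hfyp, mul_one, mul_inv_cancel]) ?_) i
  have h1 := hyc _ ((inferInstance : V.Normal).conj_mem _ hyV g⁻¹)
  have h2 := h1.map (MulAut.conj g).toMonoidHom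
  simpa [mul_assoc] using h2

theorem le_piCoreOf_of_not_dvd (h : IsStronglyEmbedded p M D P x) {H N : Subgroup G} (hx : x ∈ H)
    (hH : H ≠ ⊤) (hNH : N ≤ H) (hN : ¬ p ∣ Nat.card N)
    (hxN : x ∈ Subgroup.normalizer (N : Set G)) : N ≤ piCoreOf {p}ᶜ H := by
  have hnor := h.zpowers_quotient_normal hx hH
  set K := piCore {p}ᶜ H with hK
  set f := QuotientGroup.mk' K with hf
  set y : H := ⟨x, hx⟩ with hy
  have hfyp : (f y) ^ p = 1 := by
    rw [← map_pow, show y ^ p = 1 from Subtype.ext h.pow_eq_one, map_one]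
  intro m hm
  obtain ⟨n, hn, rfl⟩ := h.exists_eq_inv_mul_conj hN hxN hm
  set n' : H := ⟨n, hNH hn⟩
  have hNp : ¬ p ∣ Nat.card ((N.subgroupOf H).map f) := by
    rw [← isPiSubgroup_compl_singleton hp.out] at hN ⊢
    refine IsPiSubgroup.map ?_ f
    rwa [← isPiSubgroup_map_iff H.subtype_injective, Subgroup.map_subgroupOf_eq_of_le hNH]
  refine ⟨n'⁻¹ * y * n' * y⁻¹, ?_, rfl⟩
  rw [SetLike.mem_coe, ← hK, ← QuotientGroup.eq_one_iff]
  refine Subgroup.disjoint_def.mp (disjoint_of_isPGroup_of_not_dvd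
    (isPGroup_zpowers_of_pow_eq_one hfyp) hNp) (x := f _) ?_ ?_
  · rw [map_mul, map_mul, map_mul, map_inv, map_inv]
    have h1 := hnor.conj_mem _ (Subgroup.mem_zpowers _) (f n')⁻¹
    rw [inv_inv] at h1
    exact mul_mem h1 (inv_mem (Subgroup.mem_zpowers _))
  · exact ⟨_, hm, rfl⟩

theorem exists_mul_mem (h : IsStronglyEmbedded p M D P x) {H : Subgroup G} (hx : x ∈ H)
    (hH : H ≠ ⊤) {g : G} (hg : g ∈ H) : ∃ k ∈ piCoreOf {p}ᶜ H, k * g ∈ M := by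
  have hnor := h.zpowers_quotient_normal hx hH
  obtain ⟨i, hi⟩ := hnor.conj_mem _ (Subgroup.mem_zpowers _) (QuotientGroup.mk' _ ⟨g, hg⟩)
  change QuotientGroup.mk' (piCore {p}ᶜ H) ⟨x, hx⟩ ^ i = _ at hi
  rw [← map_zpow, ← map_inv, ← map_mul, ← map_mul, eq_comm, ← mul_inv_eq_one, ← map_inv, ← map_mul]
    at hi
  have hk : g * x * g⁻¹ * (x ^ i)⁻¹ ∈ piCoreOf {p}ᶜ H :=
    ⟨_, (QuotientGroup.eq_one_iff _).mp hi, rfl⟩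
  set c := x ^ i with hc
  have hcx : c ∈ Subgroup.zpowers x := ⟨i, rfl⟩
  have hc1 : c ≠ 1 := by
    intro h1
    rw [h1, inv_one, mul_one] at hk
    have h2 := eq_one_of_pow_eq_one_of_mem (not_dvd_card_piCoreOf p H)
      (by rw [conj_pow, h.pow_eq_one, mul_one, mul_inv_cancel]) hk
    exact h.ne_one (by rwa [conj_eq_one_iff] at h2)
  have h1 := h.of_mem_zpowers hcx hc1
  obtain ⟨n, hn, hnk⟩ := h1.exists_eq_inv_mul_conj (not_dvd_card_piCoreOf p H)
    (le_normalizer_piCoreOf _ H (zpow_mem hx i)) hk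
  refine ⟨n, hn, ?_⟩
  have h2 : n * g * x * (n * g)⁻¹ = c := by
    have h3 := mul_right_cancel hnk
    rw [mul_inv_rev, show n * g * x * (g⁻¹ * n⁻¹) = n * (g * x * g⁻¹) * n⁻¹ by group, ← h3]
    group
  rw [h.eq_normalizer, Subgroup.mem_normalizer_iff_map_conj_eq, MonoidHom.map_zpowers]
  change Subgroup.zpowers (n * g * x * (n * g)⁻¹) = _
  rw [h2]
  exact le_antisymm (Subgroup.zpowers_le.mpr hcx) (Subgroup.zpowers_le.mpr
    (mem_zpowers_of_mem_zpowers_of_orderOf_eq h.orderOf_eq hcx hc1))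

end IsStronglyEmbedded

section FixedPointFree

/-- If `τ` is a fixed-point-free operator of order dividing a prime on an abelian group and is
compatible with a fixed-point-free operator `σ` on an operator group `R`, then `R` acts trivially
on `|R|`-th powers. -/
theorem map_pow_card_eq_of_fixedPointFree {A R : Type*} [CommGroup A] [Group R] [Finite R] {p : ℕ}
    (hp : p.Prime) (ρ : R →* MulAut A) (σ : R →* R) (τ : A →* A)
    (h : ∀ r v, τ (ρ r v) = ρ (σ r) (τ v)) (hσp : ∀ r, σ^[p] r = r) (hτp : ∀ v, τ^[p] v = v)
    (hσ : ∀ r, σ r = r → r = 1) (hτ : ∀ v, τ v = v → v = 1) (s : R) (v : A) :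
    ρ s (v ^ Nat.card R) = v ^ Nat.card R := by
  have := Fintype.ofFinite R
  have hnorm : ∀ w, ∏ i ∈ Finset.range p, τ^[i] w = 1 := fun w => by
    apply hτ
    rw [map_prod, Finset.prod_congr rfl fun i _ => (Function.iterate_succ_apply' τ i w).symm]
    have h1 := Finset.prod_range_succ (fun i => τ^[i] w) p
    rw [Finset.prod_range_succ'] at h1
    simpa [hτp w] using h1
  have hit : ∀ i r w, τ^[i] (ρ r w) = ρ (σ^[i] r) (τ^[i] w) := by
    intro i
    induction i with
    | zero => simp
    | succ i ih => intro r w; rw [Function.iterate_succ_apply, h, ih]; rfl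
  have hinj : ∀ i, 0 < i → i < p → Function.Bijective fun r : R => r * σ^[i] r⁻¹ := by
    intro i hi hip
    apply Function.Injective.bijective_of_finite
    intro a b hab
    have h1 : a * σ^[i] a⁻¹ = b * σ^[i] b⁻¹ := hab
    have h2 : σ^[i] (b⁻¹ * a) = b⁻¹ * a := by
      rw [iterate_map_inv, iterate_map_inv, mul_inv_eq_iff_eq_mul] at h1
      rw [iterate_map_mul, iterate_map_inv, eq_inv_mul_iff_mul_eq, ← mul_assoc, ← h1]
    have h3 : Function.IsPeriodicPt σ (Nat.gcd i p) (b⁻¹ * a) :=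
      Function.IsPeriodicPt.gcd h2 (hσp _)
    rw [Nat.gcd_comm, Nat.coprime_of_lt_prime hi.ne' hip hp] at h3
    exact (inv_mul_eq_one.mp (hσ _ h3)).symm
  have hkey : ∀ r, ∏ i ∈ Finset.range p, ρ (r * σ^[i] r⁻¹) (τ^[i] v) = 1 := fun r => by
    rw [← map_one (ρ r), ← hnorm (ρ r⁻¹ v), map_prod]
    refine Finset.prod_congr rfl fun i _ => ?_
    rw [hit, map_mul, MulAut.mul_apply]
  obtain ⟨m, rfl⟩ := Nat.exists_eq_succ_of_ne_zero hp.ne_zero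
  have htot : (∏ i ∈ Finset.range m, ∏ r : R, ρ r (τ^[i + 1] v)) * v ^ Nat.card R = 1 := by
    have h1 : ∏ r : R, ∏ i ∈ Finset.range (m + 1), ρ (r * σ^[i] r⁻¹) (τ^[i] v) = 1 :=
      Finset.prod_eq_one fun r _ => hkey r
    rw [Finset.prod_comm, Finset.prod_range_succ'] at h1
    rw [← h1]
    congr 1
    · refine Finset.prod_congr rfl fun i hi => ?_
      exact ((hinj (i + 1) i.succ_pos (by simpa using hi)).prod_comp
        fun r => ρ r (τ^[i + 1] v)).symm
    · simp [Nat.card_eq_fintype_card]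
  rw [eq_inv_of_mul_eq_one_right htot, map_inv, map_prod]
  congr 1
  refine Finset.prod_congr rfl fun i _ => ?_
  rw [map_prod]
  refine Eq.trans ?_ ((Group.mulLeft_bijective s).prod_comp fun r => ρ r (τ^[i + 1] v))
  exact Finset.prod_congr rfl fun r _ => by rw [map_mul, MulAut.mul_apply]

theorem exists_inv_mul_map_eq {K : Type*} [Group K] [Finite K] (φ : K →* K)
    (hφ : ∀ k, φ k = k → k = 1) (m : K) : ∃ k, k⁻¹ * φ k = m := by
  refine Finite.surjective_of_injective (f := fun k => k⁻¹ * φ k) (fun a b hab => ?_) m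
  have h1 : a⁻¹ * φ a = b⁻¹ * φ b := hab
  refine mul_inv_eq_one.mp (hφ _ ?_)
  rw [map_mul, map_inv, mul_inv_eq_iff_eq_mul, mul_assoc, ← h1, mul_inv_cancel_left]

theorem exists_sylow_map_le {K : Type*} [Group K] [Finite K] (φ : MulAut K)
    (hφ : ∀ k, φ k = k → k = 1) (r : ℕ) [Fact r.Prime] :
    ∃ R : Sylow r K, ∀ k ∈ R, φ k ∈ R := by
  obtain ⟨R⟩ : Nonempty (Sylow r K) := inferInstance
  obtain ⟨g, hg⟩ := MulAction.exists_smul_eq K R (φ • R)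
  obtain ⟨n, hn⟩ := exists_inv_mul_map_eq φ.toMonoidHom hφ g⁻¹
  have h1 : φ n = n * g⁻¹ := inv_mul_eq_iff_eq_mul.mp hn
  have h2 : φ * MulAut.conj n = MulAut.conj (φ n) * φ := by
    ext k
    simp
  have h3 : φ • n • R = n • R := by
    rw [Sylow.smul_def, smul_smul, h2, ← smul_smul, ← hg, ← Sylow.smul_def, smul_smul, h1,
      inv_mul_cancel_right]
    rfl
  refine ⟨n • R, fun k hk => ?_⟩
  rw [← h3]
  exact Subgroup.smul_mem_pointwise_smul k φ _ hk

theorem exists_derivedSeries_comm (K : Type*) [Group K] [Group.IsSolvable K] [Nontrivial K] :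
    ∃ n, derivedSeries K n ≠ ⊥ ∧ ∀ a ∈ derivedSeries K n,
      ∀ b ∈ derivedSeries K n, a * b = b * a := by
  classical
  have hex : ∃ n, derivedSeries K n = ⊥ := (Group.isSolvable_def K).mp inferInstance
  obtain ⟨m, hm⟩ : ∃ m, Nat.find hex = m + 1 := Nat.exists_eq_succ_of_ne_zero fun h0 => by
    have := Nat.find_spec hex
    rw [h0, derivedSeries_zero] at this
    exact top_ne_bot this
  refine ⟨m, Nat.find_min hex (by omega), fun a ha b hb => ?_⟩
  have h1 := Nat.find_spec hex
  rw [hm, derivedSeries_succ] at h1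
  exact commutatorElement_eq_one_iff_mul_comm.mp
    (Subgroup.mem_bot.mp (h1 ▸ Subgroup.commutator_mem_commutator ha hb))

theorem mulAut_pow_apply {K : Type*} [Group K] (φ : MulAut K) (n : ℕ) (k : K) :
    (φ ^ n) k = φ^[n] k := by
  rw [hom_coe_pow (fun f : MulAut K => (f : K → K)) rfl (fun _ _ => rfl)]

theorem center_ne_bot_of_fixedPointFree {K : Type*} [Group K] [Finite K] [Group.IsSolvable K]
    [Nontrivial K] {p : ℕ} (hp : p.Prime) (φ : MulAut K) (hφp : φ ^ p = 1)
    (hφ : ∀ k, φ k = k → k = 1) : Subgroup.center K ≠ ⊥ := by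
  obtain ⟨n, hD, hDc⟩ := exists_derivedSeries_comm K
  set E := derivedSeries K n with hE
  obtain ⟨q, hq, hqE⟩ := Nat.exists_prime_and_dvd
    (fun h1 => hD (Subgroup.card_eq_one.mp h1) : Nat.card E ≠ 1)
  have := Fact.mk hq
  let J : Subgroup K :=
    { carrier := {v | v ∈ E ∧ v ^ q = 1}
      mul_mem' := fun {a b} ha hb => ⟨E.mul_mem ha.1 hb.1, by
        rw [(show Commute a b from hDc a ha.1 b hb.1).mul_pow, ha.2, hb.2, one_mul]⟩
      one_mem' := ⟨E.one_mem, one_pow q⟩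
      inv_mem' := fun {a} ha => ⟨E.inv_mem ha.1, by rw [inv_pow, ha.2, inv_one]⟩ }
  have hJc : ∀ a b : J, a * b = b * a := fun a b => Subtype.ext (hDc a a.2.1 b b.2.1)
  have hJφ : ∀ ψ : MulAut K, ∀ v ∈ J, ψ v ∈ J := fun ψ v hv =>
    ⟨Subgroup.characteristic_iff_le_comap.mp (derivedSeries_characteristic K n) ψ hv.1, by
      rw [← map_pow, hv.2, map_one]⟩
  have hJn : J.Normal := ⟨fun v hv g => hJφ (MulAut.conj g) v hv⟩
  have hJq : IsPGroup q J := fun v => ⟨1, Subtype.ext (by simpa using v.2.2)⟩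
  have hJ1 : J ≠ ⊥ := by
    obtain ⟨v, hv⟩ := exists_prime_orderOf_dvd_card' q hqE
    intro h1
    have h2 : (v : K) ∈ J := ⟨v.2, by
      rw [← Subgroup.coe_pow, ← hv, pow_orderOf_eq_one, Subgroup.coe_one]⟩
    rw [h1, Subgroup.mem_bot] at h2
    exact hq.one_lt.ne (by rw [← hv, ← Subgroup.orderOf_coe, h2, orderOf_one])
  obtain ⟨Q⟩ : Nonempty (Sylow q K) := inferInstance
  obtain ⟨z, hz, hzq, hzQ⟩ := Q.isPGroup'.exists_orderOf_eq_commute hJq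
    (by rw [Subgroup.normalizer_eq_top]; exact le_top) hJ1
  have hφp' : ∀ k, φ^[p] k = k := fun k => by
    rw [← mulAut_pow_apply, hφp, MulAut.one_apply]
  have key : ∀ r : ℕ, r.Prime → r ≠ q → ∃ R : Sylow r K, ∀ s ∈ R, Commute z s := by
    intro r hr hrq
    have := Fact.mk hr
    obtain ⟨R, hR⟩ := exists_sylow_map_le φ hφ r
    refine ⟨R, fun s hs => ?_⟩
    let := { (inferInstance : Group J) with mul_comm := hJc : CommGroup J }
    let σ : R →* R := (φ.toMonoidHom.comp (R : Subgroup K).subtype).codRestrict _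
      fun s => hR s s.2
    let τ : J →* J := (φ.toMonoidHom.comp J.subtype).codRestrict J fun v => hJφ φ v v.2
    have hσc : Function.Semiconj (Subtype.val : R → K) σ φ := fun s => rfl
    have hτc : Function.Semiconj (Subtype.val : J → K) τ φ := fun s => rfl
    have h1 := map_pow_card_eq_of_fixedPointFree hp
      ((MulAut.conjNormal (H := J)).comp (R : Subgroup K).subtype) σ τ
      (fun s v => Subtype.ext (by
        change φ (s * v * (s : K)⁻¹) = φ s * φ v * (φ s)⁻¹
        rw [map_mul, map_mul, map_inv]))
      (fun s => Subtype.ext ((hσc.iterate_right p s).trans (hφp' s)))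
      (fun s => Subtype.ext ((hτc.iterate_right p s).trans (hφp' s)))
      (fun s hs => Subtype.ext (hφ s (congrArg Subtype.val hs)))
      (fun s hs => Subtype.ext (hφ s (congrArg Subtype.val hs))) ⟨s, hs⟩ ⟨z, hz⟩
    have h2 : s * z ^ Nat.card R * s⁻¹ = z ^ Nat.card R := congrArg Subtype.val h1
    have h3 : Commute (z ^ Nat.card R) s := (mul_inv_eq_iff_eq_mul.mp h2).symm
    have h4 : (Nat.card R).Coprime q := by
      obtain ⟨k, hk⟩ := IsPGroup.iff_card.mp R.isPGroup'
      rw [hk]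
      exact Nat.Coprime.pow_left k ((Nat.coprime_primes hr hq).mpr hrq)
    obtain ⟨k, -, hk⟩ := Nat.exists_mul_mod_eq_one_of_coprime h4 hq.one_lt
    have h5 : z = (z ^ Nat.card R) ^ k := by
      rw [← pow_mul, ← pow_mod_orderOf, hzq, hk, pow_one]
    rw [h5]
    exact h3.pow_left k
  have hzc : Subgroup.centralizer {z} = ⊤ := by
    rw [← Subgroup.card_eq_iff_eq_top]
    refine Nat.dvd_antisymm (Subgroup.card_subgroup_dvd_card _) ?_
    rw [← Nat.factorization_prime_le_iff_dvd Nat.card_pos.ne' Nat.card_pos.ne']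
    intro r hr
    have := Fact.mk hr
    obtain ⟨R, hR⟩ : ∃ R : Sylow r K, ∀ s ∈ R, Commute z s := by
      rcases eq_or_ne r q with rfl | hrq
      exacts [⟨Q, hzQ⟩, key r hr hrq]
    rw [← hr.pow_dvd_iff_le_factorization Nat.card_pos.ne', ← R.card_eq_multiplicity]
    refine Subgroup.card_dvd_of_le fun s hs => ?_
    exact Subgroup.mem_centralizer_singleton_iff.mpr (hR s hs).symm.eq
  intro h1
  have h2 : z ∈ Subgroup.center K := by
    rw [Subgroup.mem_center_iff]
    intro g
    exact Subgroup.mem_centralizer_singleton_iff.mp (hzc ▸ Subgroup.mem_top g)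
  rw [h1, Subgroup.mem_bot] at h2
  exact hq.one_lt.ne (by rw [← hzq, h2, orderOf_one])

/-- A finite solvable group with a fixed-point-free automorphism of prime order is nilpotent. -/
theorem isNilpotent_of_fixedPointFree {K : Type*} [Group K] [Finite K] [hK : Group.IsSolvable K]
    {p : ℕ} (hp : p.Prime) (φ : MulAut K) (hφp : φ ^ p = 1) (hφ : ∀ k, φ k = k → k = 1) :
    Group.IsNilpotent K := by
  induction hn : Nat.card K using Nat.strong_induction_on generalizing K with
  | _ n ih =>
  subst hn
  rcases subsingleton_or_nontrivial K with _ | _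
  · infer_instance
  set Z := Subgroup.center K with hZ
  have hZφ : Z.map φ.toMonoidHom = Z :=
    Subgroup.characteristic_iff_map_eq.mp Subgroup.centerCharacteristic φ
  have hZφ' : ∀ z ∈ Z, φ z ∈ Z := fun z hz => hZφ ▸ Subgroup.mem_map_of_mem _ hz
  let ψ : MulAut (K ⧸ Z) := QuotientGroup.congr Z Z φ hZφ
  have hψ : Function.Semiconj (QuotientGroup.mk : K → K ⧸ Z) φ ψ := fun k => rfl
  refine Group.of_quotient_center_nilpotent
    (ih (Nat.card (K ⧸ Z)) ?_ (K := K ⧸ Z) ψ ?_ ?_ rfl)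
  · have h1 := Z.card_eq_card_quotient_mul_card_subgroup
    have h2 : 1 < Nat.card Z := Z.one_lt_card_iff_ne_bot.mpr
      (center_ne_bot_of_fixedPointFree hp φ hφp hφ)
    rw [h1]
    exact lt_mul_of_one_lt_right Nat.card_pos h2
  · ext k
    obtain ⟨k, rfl⟩ := QuotientGroup.mk_surjective k
    rw [mulAut_pow_apply, ← hψ.iterate_right, ← mulAut_pow_apply, hφp]
    rfl
  · intro k hk
    obtain ⟨k, rfl⟩ := QuotientGroup.mk_surjective k
    have h1 : k⁻¹ * φ k ∈ Z := QuotientGroup.eq.mp hk.symm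
    obtain ⟨n, hn⟩ := exists_inv_mul_map_eq
      ((φ.toMonoidHom.comp Z.subtype).codRestrict Z fun z => hZφ' z z.2)
      (fun z hz => Subtype.ext (hφ z (congrArg Subtype.val hz))) ⟨_, h1⟩
    have h2 : (n : K)⁻¹ * φ n = k⁻¹ * φ k := congrArg Subtype.val hn
    have h3 : k * (n : K)⁻¹ = 1 := hφ _ (by
      rw [map_mul, map_inv, mul_inv_eq_iff_eq_mul, mul_assoc, h2, mul_inv_cancel_left])
    rw [QuotientGroup.eq_one_iff, mul_inv_eq_one.mp h3]
    exact n.2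

end FixedPointFree

namespace IsStronglyEmbedded

variable {G : Type*} [Group G] [Finite G] {p : ℕ} [hp : Fact p.Prime] {M D P : Subgroup G} {x : G}

theorem isNilpotent_of_not_dvd (h : IsStronglyEmbedded p M D P x) {K : Subgroup G}
    (hK : ¬ p ∣ Nat.card K) (hx : x ∈ Subgroup.normalizer (K : Set G)) : Group.IsNilpotent K := by
  have := h.minimal.proper K fun h1 => h.notMem_of_not_dvd hK (h1 ▸ Subgroup.mem_top x)
  refine isNilpotent_of_fixedPointFree hp.out (K.normalizerMonoidHom ⟨x, hx⟩) ?_ fun k hk => ?_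
  · rw [← map_pow, ← map_one K.normalizerMonoidHom]
    congr 1
    exact Subtype.ext h.pow_eq_one
  · have h1 : x * k * x⁻¹ = k := congrArg Subtype.val hk
    exact Subtype.ext (h.eq_one_of_commute hK k.2 (mul_inv_eq_iff_eq_mul.mp h1).symm)

end IsStronglyEmbedded

/-- `X` is a maximal subgroup containing `x` which does not normalize `⟨x⟩`. -/
structure IsMaxOver {G : Type*} [Group G] (x : G) (X : Subgroup G) : Prop where
  isCoatom : IsCoatom X
  mem : x ∈ X
  not_le : ¬ X ≤ Subgroup.normalizer (Subgroup.zpowers x : Set G)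

namespace IsStronglyEmbedded

variable {G : Type*} [Group G] [Finite G] {p : ℕ} [hp : Fact p.Prime] {M D P X X' : Subgroup G}
  {x : G}

theorem exists_isMaxOver_ge (h : IsStronglyEmbedded p M D P x) {H : Subgroup G} (hx : x ∈ H)
    (hH : H ≠ ⊤) (hHM : ¬ H ≤ M) : ∃ X, IsMaxOver x X ∧ H ≤ X := by
  obtain ⟨X, hX, hHX⟩ := (eq_top_or_exists_le_coatom H).resolve_left hH
  exact ⟨X, ⟨hX, hHX hx, fun h1 => hHM (hHX.trans (h.eq_normalizer ▸ h1))⟩, hHX⟩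

theorem eq_one_of_mem_M (h : IsStronglyEmbedded p M D P x) {N : Subgroup G}
    (hN : ¬ p ∣ Nat.card N) (hx : x ∈ Subgroup.normalizer (N : Set G)) {n : G} (hn : n ∈ N)
    (hnM : n ∈ M) : n = 1 := by
  refine h.eq_one_of_commute hN hn (commutatorElement_eq_one_iff_commute.mp ?_)
  exact Subgroup.disjoint_def.mp (disjoint_of_isPGroup_of_not_dvd h.isPGroup hN)
    (commutatorElement_mem_of_mem_normalizer' h.mem (h.le_normalizer hnM))
    (commutatorElement_mem_of_mem_normalizer hn hx)

theorem piCoreOf_ne_bot (h : IsStronglyEmbedded p M D P x) {H : Subgroup G} (hx : x ∈ H)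
    (hH : H ≠ ⊤) (hHM : ¬ H ≤ M) : piCoreOf {p}ᶜ H ≠ ⊥ := by
  obtain ⟨k, hk, hkx⟩ := h.exists_not_commute hx hH hHM
  intro h1
  rw [h1, Subgroup.mem_bot] at hk
  exact hkx (hk ▸ Commute.one_left x)

theorem normalizer_piCoreOf_eq (h : IsStronglyEmbedded p M D P x) (hX : IsMaxOver x X) :
    Subgroup.normalizer (piCoreOf {p}ᶜ X : Set G) = X := by
  have h1 : piCoreOf {p}ᶜ X ≠ ⊥ :=
    h.piCoreOf_ne_bot hX.mem hX.isCoatom.1 (h.eq_normalizer ▸ hX.not_le)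
  have h2 : Group.IsSolvable (piCoreOf {p}ᶜ X) := h.minimal.proper _ fun h3 =>
    h.notMem_of_not_dvd (not_dvd_card_piCoreOf p X) (h3 ▸ Subgroup.mem_top x)
  exact (hX.isCoatom.le_iff.mp (le_normalizer_piCoreOf {p}ᶜ X)).resolve_left
    (h.minimal.normalizer_ne_top h1 h2)

theorem eq_or_lt_of_normalizer_le (h : IsStronglyEmbedded p M D P x) (hX : IsMaxOver x X)
    (hX' : IsMaxOver x X') {I : Subgroup G} (hx : x ∈ Subgroup.normalizer (I : Set G))
    (hI : I ≤ piCoreOf {p}ᶜ X) (hIX : Subgroup.normalizer (I : Set G) ≤ X') :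
    X = X' ∨ I < piCoreOf {p}ᶜ X ⊓ piCoreOf {p}ᶜ X' := by
  rcases hI.eq_or_lt with rfl | hlt
  · rw [h.normalizer_piCoreOf_eq hX] at hIX
    exact Or.inl ((hX.isCoatom.le_iff.mp hIX).resolve_left hX'.isCoatom.1).symm
  · right
    have hxK := le_normalizer_piCoreOf {p}ᶜ X hX.mem
    have h1 := lt_inf_normalizer_of_lt
      (h.isNilpotent_of_not_dvd (not_dvd_card_piCoreOf p X) hxK) hlt
    refine h1.trans_le (le_inf inf_le_left ?_)
    refine h.le_piCoreOf_of_not_dvd hX'.mem hX'.isCoatom.1 (inf_le_right.trans hIX)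
      (not_dvd_card_of_le inf_le_left (not_dvd_card_piCoreOf p X))
      (mem_normalizer_inf hxK (Subgroup.le_normalizer hx))

theorem piCoreOf_inf_piCoreOf_eq_bot (h : IsStronglyEmbedded p M D P x) (hX : IsMaxOver x X)
    (hX' : IsMaxOver x X') (hne : X ≠ X') : piCoreOf {p}ᶜ X ⊓ piCoreOf {p}ᶜ X' = ⊥ := by
  by_contra hbot
  let S : Set (Subgroup G) := {I | I ≠ ⊥ ∧ ∃ Y Y', IsMaxOver x Y ∧ IsMaxOver x Y' ∧ Y ≠ Y' ∧
    I = piCoreOf {p}ᶜ Y ⊓ piCoreOf {p}ᶜ Y'}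
  obtain ⟨I, ⟨hI1, Y, Y', hY, hY', hYY', rfl⟩, hmax⟩ := (Set.toFinite S).exists_maximal
    ⟨_, hbot, X, X', hX, hX', hne, rfl⟩
  set I := piCoreOf {p}ᶜ Y ⊓ piCoreOf {p}ᶜ Y' with hI
  have hIp : ¬ p ∣ Nat.card I := not_dvd_card_of_le inf_le_left (not_dvd_card_piCoreOf p Y)
  have hxI : x ∈ Subgroup.normalizer (I : Set G) := mem_normalizer_inf
    (le_normalizer_piCoreOf _ _ hY.mem) (le_normalizer_piCoreOf _ _ hY'.mem)
  have hsol : Group.IsSolvable I := h.minimal.proper _ fun h3 =>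
    h.notMem_of_not_dvd hIp (h3 ▸ Subgroup.mem_top x)
  have hIM : ¬ Subgroup.normalizer (I : Set G) ≤ M := fun h1 => hI1
    ((Subgroup.eq_bot_iff_forall I).mpr fun i hi =>
      h.eq_one_of_mem_M hIp hxI hi (h1 (Subgroup.le_normalizer hi)))
  obtain ⟨Z, hZ, hIZ⟩ := h.exists_isMaxOver_ge hxI (h.minimal.normalizer_ne_top hI1 hsol) hIM
  have key : ∀ W, IsMaxOver x W → I ≤ piCoreOf {p}ᶜ W → W = Z := by
    intro W hW hIW
    by_contra hWZ
    have h1 := (h.eq_or_lt_of_normalizer_le hW hZ hxI hIW hIZ).resolve_left hWZ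
    exact h1.not_ge
      (hmax ⟨fun h2 => hI1 (le_bot_iff.mp (h2 ▸ h1.le)), W, Z, hW, hZ, hWZ, rfl⟩ h1.le)
  exact hYY' ((key Y hY inf_le_left).trans (key Y' hY' inf_le_right).symm)

theorem le_of_isMaxOver (h : IsStronglyEmbedded p M D P x) (hX : IsMaxOver x X) : M ≤ X := by
  intro c hc
  have hKp := not_dvd_card_piCoreOf p X
  have hxK := le_normalizer_piCoreOf {p}ᶜ X hX.mem
  obtain ⟨k, hk, hkx⟩ := h.exists_not_commute hX.mem hX.isCoatom.1 (h.eq_normalizer ▸ hX.not_le)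
  have hk1 : k ≠ 1 := fun h1 => hkx (h1 ▸ Commute.one_left x)
  have hkc := h.mem_closure_conj hKp hxK hk
  set L := Subgroup.closure ({x, c * k} : Set G) with hL
  have hxL : x ∈ L := left_mem_closure_pair _ _
  have hconj : k⁻¹ * x * k ∈ L := by
    have h1 : c⁻¹ * x * c⁻¹⁻¹ ∈ Subgroup.zpowers x := (Subgroup.mem_normalizer_iff.mp
      (h.eq_normalizer ▸ inv_mem hc) x).mp (Subgroup.mem_zpowers x)
    rw [inv_inv] at h1
    have h2 : c⁻¹ * x * c ≠ 1 := fun h3 => h.ne_one (by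
      have := conj_eq_one_iff (a := c⁻¹) (b := x)
      rw [inv_inv] at this
      exact this.mp h3)
    obtain ⟨i, hi⟩ := mem_zpowers_of_mem_zpowers_of_orderOf_eq h.orderOf_eq h1 h2
    have h3 : ((c * k)⁻¹ * x * (c * k)) ^ i = k⁻¹ * x * k := by
      rw [show (c * k)⁻¹ * x * (c * k) = k⁻¹ * (c⁻¹ * x * c) * k⁻¹⁻¹ by group, conj_zpow, inv_inv]
      change k⁻¹ * (fun i : ℤ => (c⁻¹ * x * c) ^ i) i * k = _
      rw [hi]
    exact h3 ▸ zpow_mem (conj_mem_closure_pair _ _) i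
  have hkL : k ∈ L := closure_le_of_mem hxL hconj hkc
  have hcL : c ∈ L := by
    have := L.mul_mem (right_mem_closure_pair x (c * k)) (L.inv_mem hkL)
    rwa [mul_inv_cancel_right] at this
  obtain ⟨X', hX', hLX⟩ := h.exists_isMaxOver_ge hxL (h.closure_ne_top _ _)
    fun h1 => hk1 (h.eq_one_of_mem_M hKp hxK hk (h1 hkL))
  have hkX : k ∈ piCoreOf {p}ᶜ X' := h.le_piCoreOf_of_not_dvd hX'.mem hX'.isCoatom.1 inf_le_right
    (not_dvd_card_of_le inf_le_left hKp)
    (mem_normalizer_inf hxK (Subgroup.le_normalizer hX'.mem)) ⟨hk, hLX hkL⟩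
  by_cases hXX : X = X'
  · exact hXX ▸ hLX hcL
  · have h1 : k ∈ piCoreOf {p}ᶜ X ⊓ piCoreOf {p}ᶜ X' := ⟨hk, hkX⟩
    rw [h.piCoreOf_inf_piCoreOf_eq_bot hX hX' hXX, Subgroup.mem_bot] at h1
    exact absurd h1 hk1

theorem inf_eq (h : IsStronglyEmbedded p M D P x) (hX : IsMaxOver x X)
    (hX' : IsMaxOver x X') (hne : X ≠ X') : X ⊓ X' = M := by
  refine le_antisymm ?_ (le_inf (h.le_of_isMaxOver hX) (h.le_of_isMaxOver hX'))
  by_contra hM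
  have hx : x ∈ X ⊓ X' := ⟨hX.mem, hX'.mem⟩
  refine h.piCoreOf_ne_bot hx (fun h1 => hX.isCoatom.1 (top_le_iff.mp (h1 ▸ inf_le_left))) hM
    (le_bot_iff.mp ?_)
  rw [← h.piCoreOf_inf_piCoreOf_eq_bot hX hX' hne]
  have hKp := not_dvd_card_piCoreOf p (X ⊓ X')
  have hxK := le_normalizer_piCoreOf {p}ᶜ (X ⊓ X') hx
  have hle := piCoreOf_le {p}ᶜ (X ⊓ X')
  exact le_inf (h.le_piCoreOf_of_not_dvd hX.mem hX.isCoatom.1 (hle.trans inf_le_left) hKp hxK)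
    (h.le_piCoreOf_of_not_dvd hX'.mem hX'.isCoatom.1 (hle.trans inf_le_right) hKp hxK)

theorem exists_isMaxOver_mem (h : IsStronglyEmbedded p M D P x) (g : G) :
    ∃ X, IsMaxOver x X ∧ g ∈ X := by
  have key : ∀ g ∉ M, ∃ X, IsMaxOver x X ∧ g ∈ X := by
    intro g hg
    obtain ⟨X, hX, hle⟩ := h.exists_isMaxOver_ge (left_mem_closure_pair x g) (h.closure_ne_top x g)
      fun h1 => hg (h1 (right_mem_closure_pair x g))
    exact ⟨X, hX, hle (right_mem_closure_pair x g)⟩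
  by_cases hg : g ∈ M
  · obtain ⟨g₀, -, hg₀⟩ := SetLike.exists_of_lt (lt_top_iff_ne_top.mpr h.ne_top)
    obtain ⟨X, hX, -⟩ := key g₀ hg₀
    exact ⟨X, hX, h.le_of_isMaxOver hX hg⟩
  · exact key g hg

end IsStronglyEmbedded

namespace IsStronglyEmbedded

variable {G : Type*} [Group G] [Finite G] {p : ℕ} [hp : Fact p.Prime] {M D P X X' : Subgroup G}
  {x : G}

omit [Finite G] hp in
theorem map_conj (h : IsStronglyEmbedded p M D P x) (g : G) :
    IsStronglyEmbedded p (M.map (MulAut.conj g).toMonoidHom) (D.map (MulAut.conj g).toMonoidHom)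
      (P.map (MulAut.conj g).toMonoidHom) (g * x * g⁻¹) where
  minimal := h.minimal
  two_lt := h.two_lt
  ne_top h1 := h.ne_top (by
    have h2 : (⊤ : Subgroup G) ≤ M.map (MulAut.conj g).toMonoidHom := h1.ge
    rw [← inv_inv g, ← map_conj_le_iff] at h2
    refine top_le_iff.mp (le_trans ?_ h2)
    exact (Subgroup.map_top_of_surjective _ (MulAut.conj g⁻¹).surjective).ge)
  normalizer_le R hRM hR hR1 := by
    rw [← inv_inv g, ← map_conj_le_iff] at hRM ⊢
    rw [map_conj_normalizer]
    exact h.normalizer_le _ hRM (hR.map_conj _) fun h1 => hR1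
      ((Subgroup.map_eq_bot_iff_of_injective _ (MulAut.conj g⁻¹).injective).mp h1)
  isSyl := by
    have h1 := h.isSyl.map_conj g
    rwa [Subgroup.map_top_of_surjective _ (MulAut.conj g).surjective] at h1
  orderOf_eq := by
    rw [← h.orderOf_eq]
    exact orderOf_injective (MulAut.conj g).toMonoidHom (MulAut.conj g).injective x
  commute := by
    rintro _ ⟨s, hs, rfl⟩
    exact (h.commute s hs).map (MulAut.conj g).toMonoidHom
  mem := ⟨x, h.mem, rfl⟩
  le := Subgroup.map_mono h.le
  isPGroup := h.isPGroup.map_conj g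
  comm := by
    rintro _ ⟨s, hs, rfl⟩
    exact (h.comm s hs).map (MulAut.conj g).toMonoidHom
  le_normalizer := (Subgroup.map_mono h.le_normalizer).trans (map_conj_normalizer D g).le

theorem exists_of_orderOf_eq (h : IsStronglyEmbedded p M D P x) {e : G} (he : orderOf e = p) :
    ∃ M' D' P', IsStronglyEmbedded p M' D' P' e ∧ Nat.card M' = Nat.card M := by
  have hep : e ^ p = 1 := he ▸ pow_orderOf_eq_one e
  obtain ⟨g, -, hg⟩ := h.isSyl.exists_map_conj_le (isPGroup_zpowers_of_pow_eq_one hep) le_top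
  have h1 : g * e * g⁻¹ ∈ P := hg ⟨e, Subgroup.mem_zpowers e, rfl⟩
  have h2 := h.mem_zpowers (h.commute _ h1) (by rw [conj_pow, hep, mul_one, mul_inv_cancel])
  have h3 : g * e * g⁻¹ ≠ 1 := fun h3 => hp.out.one_lt.ne
    (by rw [← he, conj_eq_one_iff.mp h3, orderOf_one])
  have h4 := (h.of_mem_zpowers h2 h3).map_conj g⁻¹
  rw [show g⁻¹ * (g * e * g⁻¹) * g⁻¹⁻¹ = e by group] at h4
  exact ⟨_, _, _, h4, Subgroup.card_map_of_injective (MulAut.conj g⁻¹).injective⟩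

theorem mem_piCoreOf_of_pow_eq_one (h : IsStronglyEmbedded p M D P x) {H : Subgroup G}
    (hx : x ∈ H) (hH : H ≠ ⊤) {r : ℕ} [hr : Fact r.Prime] (hrM : ¬ r ∣ Nat.card M) {y : G}
    (hy : y ∈ H) (hyr : y ^ r = 1) : y ∈ piCoreOf {p}ᶜ H := by
  obtain ⟨k, hk, hkM⟩ := h.exists_mul_mem hx hH hy
  have hpow : ∀ n : ℕ, (k * y) ^ n * (y ^ n)⁻¹ ∈ piCoreOf {p}ᶜ H := by
    intro n
    induction n with
    | zero => simp
    | succ n ih =>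
      have h1 := (Subgroup.mem_normalizer_iff.mp
        (le_normalizer_piCoreOf {p}ᶜ H (H.pow_mem hy n)) k).mp hk
      convert (piCoreOf {p}ᶜ H).mul_mem ih h1 using 1
      rw [pow_succ, pow_succ y]
      group
  have h1 := hpow r
  rw [hyr, inv_one, mul_one] at h1
  have h2 := h.eq_one_of_mem_M (not_dvd_card_piCoreOf p H) (le_normalizer_piCoreOf _ _ hx) h1
    (M.pow_mem hkM r)
  have h3 := eq_one_of_pow_eq_one_of_mem hrM h2 hkM
  rw [eq_inv_of_mul_eq_one_right h3]
  exact inv_mem hk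

theorem dvd_card_of_prime_dvd_card (h : IsStronglyEmbedded p M D P x) {r : ℕ}
    [hr : Fact r.Prime] (hrG : r ∣ Nat.card G) : r ∣ Nat.card M := by
  by_contra hrM
  have := h.minimal.simple
  obtain ⟨y, hy⟩ := exists_prime_orderOf_dvd_card' r hrG
  have hyr : y ^ r = 1 := hy ▸ pow_orderOf_eq_one y
  refine hr.out.one_lt.ne' ?_
  rw [← hy, orderOf_eq_one_iff]
  refine eq_one_of_forall_exists_mem_normalizer h.dvd_card fun w => ?_
  have hy := left_mem_closure_pair y w
  have hw := right_mem_closure_pair y w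
  by_cases hpH : p ∣ Nat.card (Subgroup.closure ({y, w} : Set G))
  · obtain ⟨⟨e, heH⟩, he⟩ := exists_prime_orderOf_dvd_card' p hpH
    rw [Subgroup.orderOf_mk] at he
    obtain ⟨M', D', P', h', hM'⟩ := h.exists_of_orderOf_eq he
    exact ⟨_, h'.mem_piCoreOf_of_pow_eq_one heH (h.closure_ne_top y w) (hM' ▸ hrM) hy hyr,
      le_normalizer_piCoreOf _ _ hw, not_dvd_card_piCoreOf p _⟩
  · exact ⟨_, hy, Subgroup.le_normalizer hw, hpH⟩

theorem exists_commute_of_isMaxOver (h : IsStronglyEmbedded p M D P x) (hX : IsMaxOver x X) :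
    ∃ t ∈ M, ∃ y ∈ X, t ≠ 1 ∧ y ∉ M ∧ Commute t y := by
  set K := piCoreOf {p}ᶜ X with hK
  have hKp : ¬ p ∣ Nat.card K := not_dvd_card_piCoreOf p X
  have hxK : x ∈ Subgroup.normalizer (K : Set G) := le_normalizer_piCoreOf _ _ hX.mem
  have hK1 : K ≠ ⊥ := h.piCoreOf_ne_bot hX.mem hX.isCoatom.1 (h.eq_normalizer ▸ hX.not_le)
  have hnil := h.isNilpotent_of_not_dvd hKp hxK
  obtain ⟨r, hr, hrK⟩ := Nat.exists_prime_and_dvd fun h1 => hK1 (K.eq_bot_of_card_eq h1)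
  have hr' : Fact r.Prime := ⟨hr⟩
  obtain ⟨⟨t, htM⟩, ht⟩ := exists_prime_orderOf_dvd_card' r
    (h.dvd_card_of_prime_dvd_card (hrK.trans K.card_subgroup_dvd_card))
  rw [Subgroup.orderOf_mk] at ht
  set J := piCoreOf {r} K with hJ
  have hJ1 : J ≠ ⊥ := by
    obtain ⟨S, hS, -⟩ := exists_isSyl (p := r) (R := ⊥) (H := K) IsPGroup.of_bot bot_le
    have h1 : (hS.toSylow : Subgroup K).Normal := inferInstance
    have h2 : S ≤ J := le_piCoreOf hS.le
      (Subgroup.normal_subgroupOf_iff_le_normalizer hS.le |>.mp h1)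
      (isPiSubgroup_singleton.mpr hS.isPGroup)
    exact fun h3 => hS.ne_bot hrK (le_bot_iff.mp (h3 ▸ h2))
  have htr : t ^ r = 1 := ht ▸ pow_orderOf_eq_one t
  obtain ⟨y, hyJ, hy, hyt⟩ := (isPGroup_zpowers_of_pow_eq_one htr).exists_orderOf_eq_commute
    (isPiSubgroup_singleton.mp (isPiSubgroup_piCoreOf {r} K))
    (Subgroup.zpowers_le.mpr (normalizer_le_normalizer_piCoreOf {r} K
      (le_normalizer_piCoreOf _ _ (h.le_of_isMaxOver hX htM)))) hJ1
  have hyK : y ∈ K := piCoreOf_le _ _ hyJ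
  refine ⟨t, htM, y, piCoreOf_le _ _ hyK, ?_, fun hyM => ?_, (hyt t (Subgroup.mem_zpowers t)).symm⟩
  · rintro rfl
    rw [orderOf_one] at ht
    exact hr.one_lt.ne ht
  · rw [h.eq_one_of_mem_M hKp hxK hyK hyM, orderOf_one] at hy
    exact hr.one_lt.ne hy

theorem isMaxOver_of_mem (h : IsStronglyEmbedded p M D P x) (hX : IsMaxOver x X) {b : G}
    (hb : orderOf b = p) (hbX : b ∈ X) : IsMaxOver b X := by
  refine ⟨hX.isCoatom, hbX, fun hle => hX.not_le ?_⟩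
  obtain ⟨M', D', P', h', hM'⟩ := h.exists_of_orderOf_eq hb
  rw [← h'.eq_normalizer] at hle
  have h1 := Subgroup.eq_of_le_of_card_ge ((h.le_of_isMaxOver hX).trans hle) hM'.le
  rwa [← h.eq_normalizer, h1]

theorem mem_zpowers_of_mem_M (h : IsStronglyEmbedded p M D P x) {b : G} (hb : orderOf b = p)
    (hbM : b ∈ M) : b ∈ Subgroup.zpowers x := by
  have hbp : b ^ p = 1 := hb ▸ pow_orderOf_eq_one b
  obtain ⟨z, hz, hzp, hzb⟩ := (isPGroup_zpowers_of_pow_eq_one hbp).exists_orderOf_eq_commute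
    h.isPGroup_zpowers (Subgroup.zpowers_le.mpr (h.eq_normalizer ▸ hbM)) h.zpowers_ne_bot
  have hz1 : z ≠ 1 := fun h1 => hp.out.one_lt.ne (by rw [← hzp, h1, orderOf_one])
  exact Subgroup.zpowers_le.mpr hz ((h.of_mem_zpowers hz hz1).mem_zpowers
    (hzb b (Subgroup.mem_zpowers b)).symm hbp)

theorem mem_normalizer_zpowers_of_notMem (h : IsStronglyEmbedded p M D P x) (hX : IsMaxOver x X)
    {x' t b : G} (hx' : orderOf x' = p) (hx'X : x' ∈ X) (hx'M : x' ∉ M) (ht : t ∈ M)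
    (ht' : t ∈ Subgroup.normalizer (Subgroup.zpowers x' : Set G)) (hb : orderOf b = p)
    (hbX : b ∉ X) : t ∈ Subgroup.normalizer (Subgroup.zpowers b : Set G) := by
  obtain ⟨M', D', P', h', -⟩ := h.exists_of_orderOf_eq hx'
  obtain ⟨M'', D'', P'', h'', -⟩ := h.exists_of_orderOf_eq hb
  obtain ⟨Y, hY, hbY⟩ := h.exists_isMaxOver_mem b
  obtain ⟨Z, hZ, hbZ⟩ := h'.exists_isMaxOver_mem b
  by_cases hYZ : Y = Z
  · refine absurd ?_ hx'M
    rw [← h.inf_eq hX hY fun h1 => hbX (h1 ▸ hbY)]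
    exact ⟨hx'X, hYZ ▸ hZ.mem⟩
  · rw [← h''.eq_normalizer, ← h''.inf_eq (h.isMaxOver_of_mem hY hb hbY)
      (h'.isMaxOver_of_mem hZ hb hbZ) hYZ]
    exact ⟨h.le_of_isMaxOver hY ht, h'.le_of_isMaxOver hZ (h'.eq_normalizer ▸ ht')⟩

omit [Finite G] hp in
theorem orderOf_conj_eq (h : IsStronglyEmbedded p M D P x) (g : G) :
    orderOf (g * x * g⁻¹) = p :=
  (h.map_conj g).orderOf_eq

omit [Finite G] in
theorem exists_conj_notMem (h : IsStronglyEmbedded p M D P x) (hX : X ≠ ⊤) :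
    ∃ g, g * x * g⁻¹ ∉ X := by
  by_contra! hcon
  have := h.minimal.simple
  have hle : Subgroup.normalClosure {x} ≤ X := (Subgroup.closure_le X).mpr fun b hb => by
    obtain ⟨a, ha, hab⟩ := Group.mem_conjugatesOfSet_iff.mp hb
    obtain ⟨g, rfl⟩ := isConj_iff.mp hab
    exact Set.mem_singleton_iff.mp ha ▸ hcon g
  rcases (Subgroup.normalClosure_normal (s := {x})).eq_bot_or_eq_top with h1 | h1
  · have h2 := Subgroup.subset_normalClosure (Set.mem_singleton x)
    rw [SetLike.mem_coe, h1, Subgroup.mem_bot] at h2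
    exact h.ne_one h2
  · exact hX (top_le_iff.mp (h1 ▸ hle))

omit [Finite G] in
theorem mem_normalizer_zpowers_conj_iff {t g : G} :
    t ∈ Subgroup.normalizer (Subgroup.zpowers (g * x * g⁻¹) : Set G) ↔
      g⁻¹ * t * g ∈ Subgroup.normalizer (Subgroup.zpowers x : Set G) := by
  have h1 : Subgroup.zpowers (g * x * g⁻¹) =
      (Subgroup.zpowers x).map (MulAut.conj g).toMonoidHom :=
    (MonoidHom.map_zpowers (MulAut.conj g).toMonoidHom x).symm
  rw [h1, ← map_conj_normalizer]
  constructor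
  · rintro ⟨s, hs, rfl⟩
    change g⁻¹ * (g * s * g⁻¹) * g ∈ _
    rwa [show g⁻¹ * (g * s * g⁻¹) * g = s by group]
  · intro hs
    refine ⟨_, hs, ?_⟩
    change g * (g⁻¹ * t * g) * g⁻¹ = t
    group

theorem not_isStronglyEmbedded : ¬ IsStronglyEmbedded p M D P x := by
  intro h
  have := h.minimal.simple
  obtain ⟨X, hX, -⟩ := h.exists_isMaxOver_mem 1
  obtain ⟨t, ht, y, hy, ht1, hyM, hty⟩ := h.exists_commute_of_isMaxOver hX
  have hx'M : y * x * y⁻¹ ∉ M := fun h1 => by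
    refine hyM (h.eq_normalizer.ge (Subgroup.mem_normalizer_iff_map_conj_eq.mpr ?_))
    rw [MonoidHom.map_zpowers]
    exact Subgroup.eq_of_le_of_card_ge
      (Subgroup.zpowers_le.mpr (h.mem_zpowers_of_mem_M (h.orderOf_conj_eq y) h1))
      (by rw [Nat.card_zpowers, Nat.card_zpowers, h.orderOf_eq]; exact (h.orderOf_conj_eq y).ge)
  have htN : t ∈ Subgroup.normalizer (Subgroup.zpowers (y * x * y⁻¹) : Set G) := by
    rw [mem_normalizer_zpowers_conj_iff, mul_assoc, hty.eq, inv_mul_cancel_left, ← h.eq_normalizer]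
    exact ht
  have hX' : ∀ b : G, orderOf b = p → b ∉ X →
      t ∈ Subgroup.normalizer (Subgroup.zpowers b : Set G) := fun b =>
    h.mem_normalizer_zpowers_of_notMem hX (h.orderOf_conj_eq y)
      (X.mul_mem (X.mul_mem hy hX.mem) (X.inv_mem hy)) hx'M ht htN
  obtain ⟨g₀, hg₀⟩ := h.exists_conj_notMem hX.isCoatom.1
  obtain ⟨Y, hY, hgY⟩ := h.exists_isMaxOver_mem (g₀ * x * g₀⁻¹)
  have key : ∀ b : G, orderOf b = p → t ∈ Subgroup.normalizer (Subgroup.zpowers b : Set G) := by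
    intro b hb
    by_cases hbX : b ∈ X
    · by_cases hbY : b ∈ Y
      · have h1 : b ∈ M := by
          rw [← h.inf_eq hX hY fun h1 => hg₀ (h1 ▸ hgY)]
          exact ⟨hbX, hbY⟩
        have h2 : b ≠ 1 := fun h2 => hp.out.one_lt.ne (by rw [← hb, h2, orderOf_one])
        exact (h.of_mem_zpowers (h.mem_zpowers_of_mem_M hb h1) h2).eq_normalizer.le ht
      · exact h.mem_normalizer_zpowers_of_notMem hY (h.orderOf_conj_eq g₀) hgY
          (fun h1 => hg₀ (h.le_of_isMaxOver hX h1)) ht (hX' _ (h.orderOf_conj_eq g₀) hg₀) hb hbY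
    · exact hX' b hb hbX
  have htc : t ∈ M.normalCore := fun g => by
    have h1 := mem_normalizer_zpowers_conj_iff.mp (key _ (h.orderOf_conj_eq g⁻¹))
    rwa [inv_inv, ← h.eq_normalizer] at h1
  rcases M.normalCore_normal.eq_bot_or_eq_top with h1 | h1
  · rw [h1, Subgroup.mem_bot] at htc
    exact ht1 htc
  · exact h.ne_top (top_le_iff.mp (h1 ▸ M.normalCore_le))

end IsStronglyEmbedded

theorem IsMinimalNonsolvable.false {G : Type*} [Group G] [Finite G]
    (hG : IsMinimalNonsolvable G) : False := by
  have := hG.simple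
  obtain ⟨p, hp, hpG, hp5⟩ : ∃ p, p.Prime ∧ p ∣ Nat.card G ∧ 5 ≤ p := by
    by_contra! hcon
    have : Fact (Nat.Prime 2) := ⟨Nat.prime_two⟩
    have : Fact (Nat.Prime 3) := ⟨Nat.prime_three⟩
    have hc := center_eq_top_of_isSimpleGroup_of_two_primes (G := G) (p := 2) (q := 3)
      fun r hr hrG => by
        have h1 := hcon r hr hrG
        have h2 := hr.two_le
        have h3 : r ≠ 4 := by rintro rfl; norm_num at hr
        omega
    exact hG.not_solvable (Group.isSolvable_of_comm fun a b =>
      (Subgroup.mem_center_iff.mp (hc ▸ Subgroup.mem_top b) a))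
  have : Fact p.Prime := ⟨hp⟩
  obtain ⟨P₀⟩ : Nonempty (Sylow p G) := inferInstance
  have hP := isSyl_of_sylow P₀
  set P : Subgroup G := (P₀ : Subgroup G)
  have hP1 : P ≠ ⊥ := hP.ne_bot (by rwa [Subgroup.card_top])
  obtain ⟨x, hx, hxp, hxP⟩ := hP.isPGroup.exists_orderOf_eq_commute hP.isPGroup
    Subgroup.le_normalizer hP1
  have hD := isDstarMem_Dstar P
  have hDp : IsPGroup p (Dstar P) := hP.isPGroup.to_le hD.le
  have hxD := mem_Dstar_of_forall_commute hx hxP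
  exact IsStronglyEmbedded.not_isStronglyEmbedded (p := p) (x := x)
    (M := Subgroup.normalizer (Dstar P : Set G)) (D := Dstar P) (P := P)
    { minimal := hG
      two_lt := by omega
      ne_top := hG.normalizer_ne_top (hP.isPGroup.Dstar_ne_bot hP1) hDp.isSolvable'
      normalizer_le := fun R hRM hR hR1 =>
        IsMinimalNonsolvable.normalizer_le_normalizer_Dstar hp5 hG hpG hP hR hR1 hRM
      isSyl := hP
      orderOf_eq := hxp
      commute := fun s hs => (hxP s hs).symm
      mem := hxD
      le := Subgroup.le_normalizer
      isPGroup := hDp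
      comm := fun d hd => (hD.comm hd x hxD).symm
      le_normalizer := le_rfl }

/-- A finite group all of whose two-generated subgroups are solvable is solvable. -/
theorem isSolvable_of_finite_of_two_generated {G : Type*} [Group G] [Finite G]
    (h : ∀ a b : G, Group.IsSolvable (Subgroup.closure ({a, b} : Set G))) :
    Group.IsSolvable G := by
  induction hn : Nat.card G using Nat.strong_induction_on generalizing G with | _ n ih =>
  subst hn
  by_contra hns
  have hproper : ∀ H : Subgroup G, H ≠ ⊤ → Group.IsSolvable H := by
    intro H hH
    refine ih _ ?_ (fun a b => ?_) rfl
    · exact lt_of_le_of_ne H.card_le_card_group fun h1 => hH (H.eq_top_of_card_eq h1)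
    · refine isSolvable_of_map_injective H.subtype_injective ?_
      rw [MonoidHom.map_closure, Set.image_pair]
      exact h a b
  have hnt : Nontrivial G := by
    by_contra h1
    rw [not_nontrivial_iff_subsingleton] at h1
    exact hns inferInstance
  refine IsMinimalNonsolvable.false ⟨⟨fun N hN => ?_⟩, hproper, h, hns⟩
  by_contra! hcon
  refine hns ?_
  have h1 := hproper N hcon.2
  have h2 : Group.IsSolvable (G ⧸ N) := by
    refine ih _ ?_ (fun a b => ?_) rfl
    · rw [N.card_eq_card_quotient_mul_card_subgroup]
      exact lt_mul_of_one_lt_right Nat.card_pos ((Subgroup.one_lt_card_iff_ne_bot N).mpr hcon.1)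
    · obtain ⟨a, rfl⟩ := QuotientGroup.mk'_surjective N a
      obtain ⟨b, rfl⟩ := QuotientGroup.mk'_surjective N b
      rw [← Set.image_pair, ← MonoidHom.map_closure]
      have := h a b
      exact isSolvable_map _ _
  exact Group.isSolvable_of_ker_le_range N.subtype (QuotientGroup.mk' N) (by simp)

/-- a subgroup `G` of `GL_n(K)`, `K` a product of fields, in which every
two elements generate a solvable subgroup, has a locally nilpotent normal subgroup `N`
with `G/N` solvable. -/
theorem solvable_mod_locallyNilpotent_of_two_generated_solvable {I : Type*}
    (P : I → Type*) [∀ α, Field (P α)] (n : ℕ) (hn : 1 ≤ n)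
    (G : Subgroup (Matrix.GeneralLinearGroup (Fin n) (∀ α, P α)))
    (hsol : ∀ a b : G, IsSolvable (Subgroup.closure ({a, b} : Set G))) :
    ∃ (N : Subgroup G) (hN : N.Normal), LocallyNilpotent N ∧
      @IsSolvable (G ⧸ N) (@QuotientGroup.Quotient.group G _ N hN) := by
  have : Group.IsSolvable G := isSolvable_of_two_generated_isSolvable
    (fun Q _ _ h => isSolvable_of_finite_of_two_generated h) P G hsol
  exact ⟨⊥, inferInstance, fun H _ => inferInstance,
    Group.isSolvable_of_surjective (QuotientGroup.mk'_surjective ⊥)⟩
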